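/- Let W(k) = {A ∈ ℝ : A > 1 and ⌊A^{k!}⌋ is a prime number for every k ≥ 1}. For every A ∈ ∂̃W(k) there exists a constant η = η(A) > 0 such that for all integers m, n ≥ 3, |A − m/n| ≥ exp(−exp(η · log M · log log M)), where M = max(m, n). -/

import Mathlib

/-- The set `W(k)` of `A > 1` such that `⌊A ^ (k !)⌋` is prime for every `k ≥ 1`. -/
def Wfact : Set ℝ :=
  {A : ℝ | 1 < A ∧ ∀ k : ℕ, 1 ≤ k → Prime ⌊A ^ Nat.factorial k⌋}

/-- `U` is a connected component of `S` (as a subset of `ℝ`). -/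
def IsCCompOf (U S : Set ℝ) : Prop := ∃ x ∈ S, U = connectedComponentIn S x

/-- The left sub-boundary of `X ⊆ ℝ`. -/
def subL (X : Set ℝ) : Set ℝ :=
  {A : ℝ | ∃ U : Set ℝ, IsCCompOf U Xᶜ ∧ BddAbove U ∧ A = sSup U}

/-- The right sub-boundary of `X ⊆ ℝ`. -/
def subR (X : Set ℝ) : Set ℝ :=
  {A : ℝ | ∃ U : Set ℝ, IsCCompOf U Xᶜ ∧ BddBelow U ∧ A = sInf U}

/-- The sub-boundary of `X ⊆ ℝ`. -/
def subB (X : Set ℝ) : Set ℝ := subL X ∪ subR X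


section
namespace HH
open Finset
open scoped ArithmeticFunction.vonMangoldt ArithmeticFunction.Moebius ArithmeticFunction.zeta
local notation "ψ" => Chebyshev.psi

theorem psi_nat (N : ℕ) : ψ (N : ℝ) = ∑ n ∈ Ioc 0 N, Λ n := by
  simp [Chebyshev.psi]

theorem psi_le6 {x : ℝ} (hx : 0 ≤ x) : ψ x ≤ 6 * x := by
  have := Chebyshev.psi_le_const_mul_self hx
  have h2 : Real.log 4 ≤ 2 := by
    have : Real.log 4 = 2 * Real.log 2 := by
      rw [show (4:ℝ) = 2 ^ 2 by norm_num, Real.log_pow]; norm_num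
    have := Real.log_two_lt_d9
    linarith
  nlinarith

theorem log_fact_le (n : ℕ) (hn : 1 ≤ n) :
    Real.log (n.factorial) ≤ n * Real.log n - n + Real.log n + 1 := by
  induction n, hn using Nat.le_induction with
  | base => simp
  | succ n hn ih =>
    rw [Nat.factorial_succ]
    push_cast
    have hn0 : (0:ℝ) < n := by exact_mod_cast hn
    rw [Real.log_mul (by positivity) (by positivity)]
    have h := Real.one_sub_inv_le_log_of_pos (x := (n + 1) / n) (by positivity)
    rw [Real.log_div (by positivity) (by positivity)] at h
    have h2 : 1 ≤ (n + 1) * (Real.log (n + 1) - Real.log n) := by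
      calc (1:ℝ) = (n + 1) * (1 - ((n + 1 : ℝ) / n)⁻¹) := by field_simp; ring
        _ ≤ _ := by gcongr
    nlinarith

theorem le_log_fact (n : ℕ) (hn : 1 ≤ n) :
    n * Real.log n - n ≤ Real.log (n.factorial) := by
  have := Stirling.le_log_factorial_stirling (n := n) (by omega)
  have h1 : 0 ≤ Real.log n := Real.log_natCast_nonneg n
  have h2 : 0 ≤ Real.log (2 * Real.pi) := Real.log_nonneg (by nlinarith [Real.pi_gt_three])
  linarith

theorem log_fact_sum (N : ℕ) : Real.log (N.factorial) = ∑ n ∈ Ioc 0 N, Real.log n := by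
  induction N with
  | zero => simp
  | succ n ih =>
    rw [← Finset.insert_Ioc_right_eq_Ioc_add_one (by omega), sum_insert (by simp), ← ih, Nat.factorial_succ]
    push_cast
    rw [Real.log_mul (by positivity) (by positivity)]

theorem log_fact_eq (N : ℕ) : Real.log (N.factorial) = ∑ n ∈ Ioc 0 N, Λ n * ((N / n : ℕ) : ℝ) := by
  have := ArithmeticFunction.sum_Ioc_mul_zeta_eq_sum (R := ℝ) Λ N
  rw [ArithmeticFunction.vonMangoldt_mul_zeta] at this
  rw [← this, log_fact_sum]
  simp [ArithmeticFunction.log_apply]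

theorem log_fact_eq_psi (N : ℕ) : Real.log (N.factorial) = ∑ n ∈ Ioc 0 N, ψ ((N / n : ℕ) : ℝ) := by
  have := ArithmeticFunction.sum_Ioc_mul_eq_sum_sum (R := ℝ) ζ Λ N
  rw [ArithmeticFunction.zeta_mul_vonMangoldt] at this
  rw [log_fact_sum]
  simp only [ArithmeticFunction.log_apply] at this
  rw [this]
  apply sum_congr rfl
  intro n hn
  rw [psi_nat]
  simp at hn
  simp [ArithmeticFunction.zeta_apply, hn.1.ne']

/-- Mertens for naturals -/
theorem mertens_nat (N : ℕ) (hN : 1 ≤ N) :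
    |∑ n ∈ Ioc 0 N, Λ n / n - Real.log N| ≤ 7 := by
  have hN0 : (0:ℝ) < N := by exact_mod_cast hN
  have h1 := log_fact_le N hN
  have h2 := le_log_fact N hN
  have h3 : Real.log N ≤ N - 1 := Real.log_le_sub_one_of_pos hN0
  rw [log_fact_eq] at h1 h2
  have a1 : ∑ n ∈ Ioc 0 N, Λ n * ((N / n : ℕ) : ℝ) ≤ N * ∑ n ∈ Ioc 0 N, Λ n / n := by
    rw [mul_sum]
    apply sum_le_sum
    intro n _
    calc Λ n * ((N / n : ℕ) : ℝ) ≤ Λ n * (N / n) := by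
          gcongr
          exact Nat.cast_div_le
      _ = _ := by ring
  have a2 : N * ∑ n ∈ Ioc 0 N, Λ n / n ≤ ∑ n ∈ Ioc 0 N, Λ n * ((N / n : ℕ) : ℝ) + 6 * N := by
    have := psi_le6 hN0.le
    rw [psi_nat] at this
    refine le_trans ?_ (add_le_add le_rfl this)
    rw [mul_sum, ← sum_add_distrib]
    apply sum_le_sum
    intro n hn
    have hn0 : 0 < n := (mem_Ioc.1 hn).1
    have : (N:ℝ) / n ≤ (N / n : ℕ) + 1 := by
      rw [div_le_iff₀ (by positivity)]
      have := Nat.lt_mul_div_succ N hn0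
      have : N ≤ (N / n + 1) * n := by rw [mul_comm]; exact this.le
      exact_mod_cast this
    calc N * (Λ n / n) = Λ n * (N / n) := by ring
      _ ≤ Λ n * ((N / n : ℕ) + 1) := by
        gcongr
      _ = _ := by ring
  rw [abs_le]
  constructor
  · have : N * (Real.log N - 1) ≤ N * ∑ n ∈ Ioc 0 N, Λ n / n := by linarith
    have := le_of_mul_le_mul_left this hN0
    linarith
  · have : N * ∑ n ∈ Ioc 0 N, Λ n / n ≤ N * (Real.log N + 7) := by nlinarith
    have := le_of_mul_le_mul_left this hN0
    linarith

theorem log_floor {x : ℝ} (hx : 1 ≤ x) : Real.log ⌊x⌋₊ ≤ Real.log x ∧ Real.log x ≤ Real.log ⌊x⌋₊ + 1 := by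
  have h1 : 1 ≤ ⌊x⌋₊ := Nat.one_le_floor_iff x |>.2 hx
  have h1' : (1:ℝ) ≤ ⌊x⌋₊ := by exact_mod_cast h1
  have h2 : (⌊x⌋₊ : ℝ) ≤ x := Nat.floor_le (by linarith)
  have h3 : x < ⌊x⌋₊ + 1 := Nat.lt_floor_add_one x
  refine ⟨Real.log_le_log (by linarith) h2, ?_⟩
  have : Real.log x ≤ Real.log (⌊x⌋₊ * 2) := Real.log_le_log (by linarith) (by linarith)
  rw [Real.log_mul (by positivity) (by norm_num)] at this
  linarith [Real.log_two_lt_d9]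

theorem mertens {x : ℝ} (hx : 1 ≤ x) :
    |∑ n ∈ Ioc 0 ⌊x⌋₊, Λ n / n - Real.log x| ≤ 8 := by
  have h := mertens_nat ⌊x⌋₊ (Nat.one_le_floor_iff x |>.2 hx)
  obtain ⟨h1, h2⟩ := log_floor hx
  rw [abs_le] at h ⊢
  constructor <;> linarith [h.1, h.2]

/-- hyperbola reorganisation -/
theorem sum_hyper (N : ℕ) (k : ℕ → ℕ → ℝ) :
    ∑ d ∈ Ioc 0 N, ∑ m ∈ Ioc 0 (N / d), k d m =
      ∑ n ∈ Ioc 0 N, ∑ p ∈ n.divisorsAntidiagonal, k p.1 p.2 := by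
  rw [sum_sigma', sum_sigma']
  refine sum_bij' (fun s _ => ⟨s.1 * s.2, (s.1, s.2)⟩) (fun s _ => ⟨s.2.1, s.2.2⟩) ?_ ?_ ?_ ?_ ?_
  · rintro ⟨d, m⟩ h
    simp only [mem_sigma, mem_Ioc, Nat.mem_divisorsAntidiagonal] at h ⊢
    have : d * m ≤ N := by
      have := (Nat.le_div_iff_mul_le h.1.1).1 h.2.2
      rwa [mul_comm]
    have h0 := Nat.mul_pos h.1.1 h.2.1
    exact ⟨⟨h0, this⟩, trivial, h0.ne'⟩
  · rintro ⟨n, d, m⟩ h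
    simp only [mem_sigma, mem_Ioc, Nat.mem_divisorsAntidiagonal] at h ⊢
    obtain ⟨⟨h1, h2⟩, rfl, h3⟩ := h
    have hd : 0 < d := Nat.pos_of_ne_zero (by rintro rfl; simp at h1)
    have hm : 0 < m := Nat.pos_of_ne_zero (by rintro rfl; simp at h1)
    refine ⟨⟨hd, le_trans (Nat.le_mul_of_pos_right _ hm) h2⟩, hm, ?_⟩
    rw [Nat.le_div_iff_mul_le hd, mul_comm]; exact h2
  · rintro ⟨d, m⟩ h; rfl
  · rintro ⟨n, d, m⟩ h
    simp only [mem_sigma, mem_Ioc, Nat.mem_divisorsAntidiagonal] at h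
    obtain ⟨⟨h1, h2⟩, rfl, h3⟩ := h
    rfl
  · rintro ⟨d, m⟩ h; rfl

theorem sum_mu (n : ℕ) : ∑ d ∈ n.divisors, (μ d : ℝ) = if n = 1 then 1 else 0 := by
  have : (((μ : ArithmeticFunction ℤ) : ArithmeticFunction ℝ) * (ζ : ArithmeticFunction ℝ)) n = (1 : ArithmeticFunction ℝ) n := by
    rw [ArithmeticFunction.coe_moebius_mul_coe_zeta]
  rw [ArithmeticFunction.coe_mul_zeta_apply] at this
  simpa [ArithmeticFunction.one_apply] using this

/-- Tatuzawa-Iseki -/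
theorem tatuzawa (F : ℝ → ℝ) {x : ℝ} (hx : 1 ≤ x) :
    ∑ d ∈ Ioc 0 ⌊x⌋₊, (μ d : ℝ) * Real.log (x / d) * ∑ m ∈ Ioc 0 (⌊x⌋₊ / d), F (x / d / m) =
      F x * Real.log x + ∑ n ∈ Ioc 0 ⌊x⌋₊, Λ n * F (x / n) := by
  have hN : 1 ≤ ⌊x⌋₊ := Nat.one_le_floor_iff x |>.2 hx
  simp only [mul_sum]
  rw [sum_hyper ⌊x⌋₊ (fun d m => (μ d : ℝ) * Real.log (x / d) * F (x / d / m))]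
  have : ∀ n ∈ Ioc 0 ⌊x⌋₊, ∑ p ∈ n.divisorsAntidiagonal, (μ p.1 : ℝ) * Real.log (x / p.1) * F (x / p.1 / p.2)
      = (if n = 1 then F x * Real.log x else 0) + Λ n * F (x / n) := by
    intro n hn
    have hn0 : n ≠ 0 := by simp at hn; omega
    have e : ∀ p ∈ n.divisorsAntidiagonal, (μ p.1 : ℝ) * Real.log (x / p.1) * F (x / p.1 / p.2)
        = ((μ p.1 : ℝ) * Real.log x - μ p.1 * ArithmeticFunction.log p.1) * F (x / n) := by
      intro p hp
      obtain ⟨rfl, h⟩ := Nat.mem_divisorsAntidiagonal.1 hp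
      have : (p.1 : ℝ) ≠ 0 := by
        have : p.1 ≠ 0 := by rintro h'; simp [h'] at h
        exact_mod_cast this
      rw [Real.log_div (by positivity) this, ArithmeticFunction.log_apply, div_div]
      push_cast
      ring
    rw [sum_congr rfl e, ← sum_mul, Nat.sum_divisorsAntidiagonal (fun d _ => (μ d : ℝ) * Real.log x - μ d * ArithmeticFunction.log d)]
    rw [sum_sub_distrib, ArithmeticFunction.sum_moebius_mul_log_eq, ← sum_mul, sum_mu n]
    split_ifs with h
    · subst h; simp; ring
    · ring
  rw [sum_congr rfl this, sum_add_distrib]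
  congr 1
  rw [sum_ite_eq' , if_pos (by simp; omega)]

theorem harm (N : ℕ) (hN : 1 ≤ N) :
    |∑ n ∈ Ioc 0 N, (1:ℝ) / n - Real.log N - Real.eulerMascheroniConstant| ≤ 1 / N := by
  have hN0 : (0:ℝ) < N := by exact_mod_cast hN
  have h1 := Real.eulerMascheroniSeq_lt_eulerMascheroniConstant N
  have h2 := Real.eulerMascheroniConstant_lt_eulerMascheroniSeq' N
  have e : ∑ n ∈ Ioc 0 N, (1:ℝ) / n = (harmonic N : ℝ) := by
    rw [harmonic_eq_sum_Icc]
    push_cast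
    simp
    rfl
  rw [e]
  simp only [Real.eulerMascheroniSeq, Real.eulerMascheroniSeq', if_neg (show N ≠ 0 by omega)] at h1 h2
  have h3 : Real.log (N + 1) - Real.log N ≤ 1 / N := by
    rw [← Real.log_div (by positivity) (by positivity)]
    refine (Real.log_le_sub_one_of_pos (by positivity)).trans (le_of_eq ?_)
    field_simp; ring
  rw [abs_le]
  have : 0 ≤ 1 / (N:ℝ) := by positivity
  constructor <;> linarith

theorem sum_inv_sqrt (N : ℕ) : ∑ d ∈ Ioc 0 N, 1 / √(d:ℝ) ≤ 2 * √(N:ℝ) := by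
  induction N with
  | zero => simp
  | succ n ih =>
    rw [← Finset.insert_Ioc_right_eq_Ioc_add_one (by omega), sum_insert (by simp)]
    have h : 1 / √((n + 1 : ℕ):ℝ) ≤ 2 * (√((n + 1 : ℕ):ℝ) - √(n:ℝ)) := by
      have hp : 0 < √((n + 1 : ℕ):ℝ) := Real.sqrt_pos.2 (by positivity)
      rw [div_le_iff₀ hp]
      have a := Real.sq_sqrt (show (0:ℝ) ≤ ((n + 1 : ℕ):ℝ) by positivity)
      have b := Real.sq_sqrt (show (0:ℝ) ≤ (n:ℝ) by positivity)
      push_cast at a ⊢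
      push_cast at hp
      nlinarith [sq_nonneg (√((n:ℝ) + 1) - √(n:ℝ))]
    linarith

theorem log_le_sqrt_bound {t : ℝ} (ht : 1 ≤ t) : Real.log t * (2 * Real.log t + 4) ≤ 48 * √t := by
  set s := √(√t) with hs
  have h1 : 1 ≤ √t := Real.one_le_sqrt.2 ht
  have h2 : 1 ≤ s := Real.one_le_sqrt.2 h1
  have e : s ^ 2 = √t := Real.sq_sqrt (by linarith)
  have hl : Real.log t = 4 * Real.log s := by
    rw [hs, Real.log_sqrt (by linarith), Real.log_sqrt (by linarith)]; ring
  have h3 : Real.log s ≤ s - 1 := Real.log_le_sub_one_of_pos (by linarith)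
  have h4 : 0 ≤ Real.log s := Real.log_nonneg h2
  rw [hl, ← e]
  have : Real.log s ≤ s := by linarith
  nlinarith [mul_le_mul this this h4 (by linarith)]

theorem floor_div (x : ℝ) (d : ℕ) : ⌊x / d⌋₊ = ⌊x⌋₊ / d := Nat.floor_div_natCast x d

theorem G_bound {x : ℝ} (hx : 1 ≤ x) :
    |∑ m ∈ Ioc 0 ⌊x⌋₊, (ψ (x / m) - x / m + (Real.eulerMascheroniConstant + 1))| ≤ 2 * Real.log x + 4 := by
  set N := ⌊x⌋₊ with hNd
  have hN : 1 ≤ N := Nat.one_le_floor_iff x |>.2 hx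
  have hN0 : (1:ℝ) ≤ N := by exact_mod_cast hN
  have h2 : (N : ℝ) ≤ x := Nat.floor_le (by linarith)
  have h3 : x < N + 1 := Nat.lt_floor_add_one x
  have e : ∑ m ∈ Ioc 0 N, (ψ (x / m) - x / m + (Real.eulerMascheroniConstant + 1)) =
      Real.log N.factorial - x * ∑ n ∈ Ioc 0 N, (1:ℝ) / n + (Real.eulerMascheroniConstant + 1) * N := by
    rw [sum_add_distrib, sum_sub_distrib, log_fact_eq_psi, mul_sum]
    congr 1
    · congr 1
      · apply sum_congr rfl
        intro m _
        rw [Chebyshev.psi_eq_psi_coe_floor, floor_div]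
      · apply sum_congr rfl
        intro m _
        ring
    · simp; ring
  rw [e]
  have a1 := harm N hN
  have a2 := log_fact_le N hN
  have a3 := le_log_fact N hN
  have a4 := Real.one_half_lt_eulerMascheroniConstant
  have a5 := Real.eulerMascheroniConstant_lt_two_thirds
  have a6 : Real.log N ≤ Real.log x := Real.log_le_log (by linarith) h2
  have a7 : 0 ≤ Real.log N := Real.log_natCast_nonneg N
  set γ := Real.eulerMascheroniConstant
  set H := ∑ n ∈ Ioc 0 N, (1:ℝ) / n
  have b : |x * (H - Real.log N - γ)| ≤ 2 := by
    rw [abs_mul, abs_of_nonneg (by linarith)]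
    calc x * |H - Real.log N - γ| ≤ x * (1 / N) := by gcongr
      _ ≤ 2 := by rw [mul_one_div, div_le_iff₀ (by linarith)]; linarith
  rw [abs_le] at b ⊢
  have c1 : 0 ≤ (x - N) * Real.log N := mul_nonneg (by linarith) a7
  have c2 : (x - N) * Real.log N ≤ 1 * Real.log N := mul_le_mul_of_nonneg_right (by linarith) a7
  have c3 : 0 ≤ (x - N) * γ := mul_nonneg (by linarith) (by linarith)
  have c4 : (x - N) * γ ≤ 1 * γ := mul_le_mul_of_nonneg_right (by linarith) (by linarith)
  constructor <;> nlinarith [b.1, b.2]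

theorem selberg {x : ℝ} (hx : 1 ≤ x) :
    |ψ x * Real.log x + ∑ n ∈ Ioc 0 ⌊x⌋₊, Λ n * ψ (x / n) - 2 * x * Real.log x| ≤ 120 * x := by
  set c := Real.eulerMascheroniConstant + 1 with hc
  have a4 := Real.one_half_lt_eulerMascheroniConstant
  have a5 := Real.eulerMascheroniConstant_lt_two_thirds
  have T := tatuzawa (fun t => ψ t - t + c) hx
  set N := ⌊x⌋₊ with hNd
  have h2 : (N : ℝ) ≤ x := Nat.floor_le (by linarith)
  have B : |∑ d ∈ Ioc 0 N, (μ d : ℝ) * Real.log (x / d) * ∑ m ∈ Ioc 0 (N / d), (ψ (x / d / m) - x / d / m + c)| ≤ 96 * x := by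
    refine (abs_sum_le_sum_abs _ _).trans ?_
    have : ∀ d ∈ Ioc 0 N, |(μ d : ℝ) * Real.log (x / d) * ∑ m ∈ Ioc 0 (N / d), (ψ (x / d / m) - x / d / m + c)| ≤ 48 * √x * (1 / √(d:ℝ)) := by
      intro d hd
      rw [mem_Ioc] at hd
      have hd0 : (0:ℝ) < d := by exact_mod_cast hd.1
      have hdN : (d:ℝ) ≤ N := by exact_mod_cast hd.2
      have hd1 : 1 ≤ x / d := by rw [le_div_iff₀ hd0]; linarith
      rw [hNd, ← floor_div, abs_mul, abs_mul]
      have hG := G_bound hd1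
      have hmu : |(μ d : ℝ)| ≤ 1 := by exact_mod_cast ArithmeticFunction.abs_moebius_le_one
      have hl : 0 ≤ Real.log (x / d) := Real.log_nonneg hd1
      rw [abs_of_nonneg hl]
      calc _ ≤ 1 * Real.log (x / d) * (2 * Real.log (x / d) + 4) := by gcongr
        _ ≤ 48 * √(x / d) := by rw [one_mul]; exact log_le_sqrt_bound hd1
        _ = _ := by rw [Real.sqrt_div' _ hd0.le]; ring
    refine (sum_le_sum this).trans ?_
    rw [← mul_sum]
    calc 48 * √x * ∑ d ∈ Ioc 0 N, 1 / √(d:ℝ) ≤ 48 * √x * (2 * √(N:ℝ)) := by gcongr; exact sum_inv_sqrt N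
      _ ≤ 48 * √x * (2 * √x) := by gcongr
      _ = 96 * x := by
        have := Real.mul_self_sqrt (show 0 ≤ x by linarith)
        nlinarith
  rw [T] at B
  have e : ∑ n ∈ Ioc 0 N, Λ n * (ψ (x / n) - x / n + c) =
      ∑ n ∈ Ioc 0 N, Λ n * ψ (x / n) - x * ∑ n ∈ Ioc 0 N, Λ n / n + c * ψ x := by
    rw [Chebyshev.psi, mul_sum, mul_sum, ← sum_sub_distrib, ← sum_add_distrib]
    apply sum_congr rfl
    intro n _
    ring
  rw [e] at B
  have M := mertens hx
  rw [← hNd] at M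
  have p1 := psi_le6 (show 0 ≤ x by linarith)
  have p0 := Chebyshev.psi_nonneg x
  have l1 : Real.log x ≤ x - 1 := Real.log_le_sub_one_of_pos (by linarith)
  have l0 : 0 ≤ Real.log x := Real.log_nonneg hx
  have M' : |x * (∑ n ∈ Ioc 0 N, Λ n / n - Real.log x)| ≤ 8 * x := by
    rw [abs_mul, abs_of_nonneg (by linarith : 0 ≤ x)]; nlinarith
  have q1 : c * ψ x ≤ 2 * (6 * x) := by
    apply mul_le_mul _ p1 p0 (by norm_num); linarith
  have q0 : 0 ≤ c * ψ x := mul_nonneg (by linarith) p0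
  have r1 : c * Real.log x ≤ 2 * x := by
    apply mul_le_mul _ (by linarith) l0 (by norm_num); linarith
  have r0 : 0 ≤ c * Real.log x := mul_nonneg (by linarith) l0
  rw [abs_le] at B M' ⊢
  constructor <;> nlinarith [B.1, B.2, M'.1, M'.2]
end HH

end

section
namespace HH
open Finset
open scoped ArithmeticFunction.Moebius

theorem sum_mu_between (l n : ℕ) (hn : Squarefree n) :
    ∑ d ∈ n.divisors, (if l ∣ d then (μ d : ℝ) else 0) = if l = n then (μ l : ℝ) else 0 := by
  by_cases hl : l ∣ n
  · obtain ⟨q, rfl⟩ := hl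
    have hne := hn.ne_zero
    have hl0 : l ≠ 0 := by rintro rfl; simp at hne
    have hq0 : q ≠ 0 := by rintro rfl; simp at hne
    have e : ((l * q).divisors.filter (fun d => l ∣ d)) = q.divisors.image (fun e => l * e) := by
      ext d
      simp only [mem_filter, Nat.mem_divisors, mem_image]
      constructor
      · rintro ⟨⟨h1, h2⟩, e, rfl⟩
        exact ⟨e, ⟨Nat.dvd_of_mul_dvd_mul_left (Nat.pos_of_ne_zero hl0) h1, hq0⟩, rfl⟩
      · rintro ⟨e, ⟨h1, h2⟩, rfl⟩
        exact ⟨⟨Nat.mul_dvd_mul_left l h1, hne⟩, dvd_mul_right _ _⟩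
    rw [← sum_filter, e, sum_image (by intro a _ b _ h; exact Nat.eq_of_mul_eq_mul_left (Nat.pos_of_ne_zero hl0) h)]
    have : ∀ e ∈ q.divisors, (μ (l * e) : ℝ) = μ l * μ e := by
      intro e he
      have : l.Coprime e := by
        have := Nat.coprime_of_squarefree_mul hn
        exact Nat.Coprime.coprime_dvd_right (Nat.dvd_of_mem_divisors he) this
      rw [ArithmeticFunction.isMultiplicative_moebius.map_mul_of_coprime this]
      push_cast; ring
    rw [sum_congr rfl this, ← mul_sum, sum_mu]
    by_cases h1 : q = 1
    · subst h1; simp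
    · rw [if_neg h1, if_neg]
      · simp
      · intro h
        apply h1
        have : l * 1 = l * q := by simpa using h
        exact (Nat.eq_of_mul_eq_mul_left (Nat.pos_of_ne_zero hl0) this).symm
  · rw [if_neg (by rintro rfl; exact hl dvd_rfl)]
    apply sum_eq_zero
    intro d hd
    rw [if_neg]
    intro h; exact hl (h.trans (Nat.dvd_of_mem_divisors hd))

/-- normalising sum -/
noncomputable def GG (s : BoundingSieve) (R : ℕ) : ℝ :=
  ∑ l ∈ s.prodPrimes.divisors, if l ≤ R then s.selbergTerms l else 0

/-- Selberg weights -/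
noncomputable def lam (s : BoundingSieve) (R : ℕ) (d : ℕ) : ℝ :=
  if d ∣ s.prodPrimes then
    (μ d : ℝ) / (s.nu d * GG s R) * ∑ l ∈ s.prodPrimes.divisors, (if d ∣ l ∧ l ≤ R then s.selbergTerms l else 0)
  else 0

variable (s : BoundingSieve) (R : ℕ)

theorem st_nonneg {l : ℕ} (hl : l ∈ s.prodPrimes.divisors) : 0 < s.selbergTerms l :=
  BoundingSieve.selbergTerms_pos (Nat.dvd_of_mem_divisors hl)

theorem GG_pos (hR : 1 ≤ R) : 0 < GG s R := by
  unfold GG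
  have h1 : 1 ∈ s.prodPrimes.divisors := by simp [BoundingSieve.prodPrimes_ne_zero]
  refine lt_of_lt_of_le ?_ (single_le_sum (f := fun l => if l ≤ R then s.selbergTerms l else 0) ?_ h1)
  · rw [if_pos hR]; exact st_nonneg s h1
  · intro i hi
    split_ifs
    · exact (st_nonneg s hi).le
    · exact le_rfl

theorem lam_one (hR : 1 ≤ R) : lam s R 1 = 1 := by
  have := (GG_pos s R hR).ne'
  simp only [lam, one_dvd, true_and, if_true]
  rw [← GG]
  simp [s.nu_mult.map_one]
  field_simp

theorem lam_supp {d : ℕ} (h : lam s R d ≠ 0) : d ∣ s.prodPrimes ∧ d ≤ R := by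
  unfold lam at h
  split_ifs at h with hd
  · refine ⟨hd, ?_⟩
    by_contra hR
    apply h
    rw [sum_eq_zero, mul_zero]
    intro l hl
    rw [if_neg]
    rintro ⟨h1, h2⟩
    exact hR ((Nat.le_of_dvd (Nat.pos_of_mem_divisors hl) h1).trans h2)
  · exact absurd rfl h

theorem lam_quad (hR : 1 ≤ R) :
    ∑ d1 ∈ s.prodPrimes.divisors, ∑ d2 ∈ s.prodPrimes.divisors,
      lam s R d1 * lam s R d2 * s.nu (d1.lcm d2) = 1 / GG s R := by
  have hG := GG_pos s R hR
  have e1 : ∑ d1 ∈ s.prodPrimes.divisors, ∑ d2 ∈ s.prodPrimes.divisors,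
      lam s R d1 * lam s R d2 * s.nu (d1.lcm d2) = s.mainSum (BoundingSieve.lambdaSquared (lam s R)) := by
    rw [BoundingSieve.mainSum_lambdaSquared_eq_sum_sum_mul]
    apply sum_congr rfl; intro d1 h1
    apply sum_congr rfl; intro d2 h2
    rw [s.nu_mult.map_lcm]
    · ring
    · refine (BoundingSieve.nu_pos_of_dvd_prodPrimes ?_).ne'
      exact (Nat.gcd_dvd_left d1 d2).trans (Nat.dvd_of_mem_divisors h1)
  rw [e1, BoundingSieve.mainSum_lambdaSquared_eq_sum_mul_sum_sq]
  have e2 : ∀ l ∈ s.prodPrimes.divisors,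
      (∑ d ∈ s.prodPrimes.divisors, if l ∣ d then s.nu d * lam s R d else 0) =
        if l ≤ R then (μ l : ℝ) * s.selbergTerms l / GG s R else 0 := by
    intro l hl
    have a1 : ∀ d ∈ s.prodPrimes.divisors, (if l ∣ d then s.nu d * lam s R d else 0) =
        ∑ l' ∈ s.prodPrimes.divisors, (if l' ≤ R then s.selbergTerms l' / GG s R else 0) *
          (if d ∣ l' then (if l ∣ d then (μ d : ℝ) else 0) else 0) := by
      intro d hd
      have hnu := (BoundingSieve.nu_pos_of_dvd_prodPrimes (Nat.dvd_of_mem_divisors hd)).ne'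
      by_cases h : l ∣ d
      · simp only [if_pos h]
        rw [lam, if_pos (Nat.dvd_of_mem_divisors hd), mul_sum, mul_sum]
        apply sum_congr rfl
        intro l' _
        by_cases h1 : d ∣ l' <;> by_cases h2 : l' ≤ R <;> simp [h1, h2]
        field_simp
      · simp [if_neg h]
    rw [sum_congr rfl a1, sum_comm]
    simp only [← mul_sum]
    have a2 : ∀ l' ∈ s.prodPrimes.divisors,
        ∑ d ∈ s.prodPrimes.divisors, (if d ∣ l' then (if l ∣ d then (μ d : ℝ) else 0) else 0)
          = if l = l' then (μ l : ℝ) else 0 := by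
      intro l' hl'
      rw [← sum_filter, Nat.divisors_filter_dvd_of_dvd BoundingSieve.prodPrimes_ne_zero (Nat.dvd_of_mem_divisors hl')]
      exact sum_mu_between l l' (BoundingSieve.squarefree_of_mem_divisors_prodPrimes hl')
    rw [sum_congr rfl (fun l' hl' => by rw [a2 l' hl'])]
    simp only [mul_ite, mul_zero]
    rw [sum_ite_eq, if_pos hl]
    split_ifs
    · ring
    · ring
  have e3 : ∀ l ∈ s.prodPrimes.divisors, (s.selbergTerms l)⁻¹ *
      (∑ d ∈ s.prodPrimes.divisors, if l ∣ d then s.nu d * lam s R d else 0) ^ 2 =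
        (if l ≤ R then s.selbergTerms l else 0) * (1 / (GG s R) ^ 2) := by
    intro l hl
    rw [e2 l hl]
    have hp := st_nonneg s hl
    split_ifs
    · have : (μ l : ℝ) ^ 2 = 1 := by
        exact_mod_cast ArithmeticFunction.moebius_sq_eq_one_of_squarefree (BoundingSieve.squarefree_of_mem_divisors_prodPrimes hl)
      rw [div_pow, mul_pow, this]
      field_simp
    · simp
  rw [sum_congr rfl e3, ← sum_mul, ← GG]
  field_simp

theorem lam_le (hR : 1 ≤ R) (d : ℕ) : |lam s R d| ≤ 1 := by
  have hG := GG_pos s R hR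
  unfold lam
  split_ifs with hd
  swap
  · simp
  have hnu := BoundingSieve.nu_pos_of_dvd_prodPrimes hd
  have hP := BoundingSieve.prodPrimes_ne_zero (s := s)
  have key : (s.nu d)⁻¹ * ∑ l ∈ s.prodPrimes.divisors, (if d ∣ l ∧ l ≤ R then s.selbergTerms l else 0) ≤ GG s R := by
    have hdsq := BoundingSieve.squarefree_of_dvd_prodPrimes hd
    have hd0 : 0 < d := Nat.pos_of_ne_zero hdsq.ne_zero
    set Mset := s.prodPrimes.divisors.filter (fun m => d * m ∣ s.prodPrimes ∧ d * m ≤ R) with hM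
    have b1 : ∑ l ∈ s.prodPrimes.divisors, (if d ∣ l ∧ l ≤ R then s.selbergTerms l else 0) =
        ∑ m ∈ Mset, s.selbergTerms d * s.selbergTerms m := by
      rw [← sum_filter]
      symm
      refine sum_bij (fun m _ => d * m) ?_ ?_ ?_ ?_
      · intro m hm
        simp only [hM, mem_filter, Nat.mem_divisors] at hm ⊢
        exact ⟨⟨hm.2.1, hP⟩, dvd_mul_right _ _, hm.2.2⟩
      · intro a _ b _ h; exact Nat.eq_of_mul_eq_mul_left hd0 h
      · intro l hl
        simp only [hM, mem_filter, Nat.mem_divisors] at hl ⊢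
        obtain ⟨⟨h1, _⟩, ⟨m, rfl⟩, h3⟩ := hl
        exact ⟨m, ⟨⟨(dvd_mul_left m d).trans h1, hP⟩, h1, h3⟩, rfl⟩
      · intro m hm
        simp only [hM, mem_filter, Nat.mem_divisors] at hm
        have : d.Coprime m := Nat.coprime_of_squarefree_mul (BoundingSieve.squarefree_of_dvd_prodPrimes hm.2.1)
        rw [BoundingSieve.selbergTerms_isMultiplicative.map_mul_of_coprime this]
    have b2 := BoundingSieve.sum_divisors_selbergTerms_eq_selbergTerms_mul_nu_inv hd
    rw [← sum_filter, Nat.divisors_filter_dvd_of_dvd hP hd] at b2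
    rw [b1, ← mul_sum, ← mul_assoc, mul_comm (s.nu d)⁻¹, ← b2, sum_mul_sum, ← sum_product']
    rw [GG, ← sum_filter]
    have b3 : ∑ x ∈ d.divisors ×ˢ Mset, s.selbergTerms x.1 * s.selbergTerms x.2 =
        ∑ l ∈ (d.divisors ×ˢ Mset).image (fun x => x.1 * x.2), s.selbergTerms l := by
      have cop : ∀ x ∈ d.divisors ×ˢ Mset, d.Coprime x.2 := by
        intro x hx
        simp only [hM, mem_product, mem_filter, Nat.mem_divisors] at hx
        exact Nat.coprime_of_squarefree_mul (BoundingSieve.squarefree_of_dvd_prodPrimes hx.2.2.1)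
      rw [sum_image]
      · apply sum_congr rfl
        intro x hx
        have h1 : x.1 ∣ d := Nat.dvd_of_mem_divisors (mem_product.1 hx).1
        rw [BoundingSieve.selbergTerms_isMultiplicative.map_mul_of_coprime (Nat.Coprime.coprime_dvd_left h1 (cop x hx))]
      · intro x hx y hy h
        have hx1 : x.1 ∣ d := Nat.dvd_of_mem_divisors (mem_product.1 hx).1
        have hy1 : y.1 ∣ d := Nat.dvd_of_mem_divisors (mem_product.1 hy).1
        simp only [] at h
        have ex : Nat.gcd d (x.1 * x.2) = x.1 := by
          rw [Nat.Coprime.gcd_mul_right_cancel_right _ (cop x hx).symm]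
          exact Nat.gcd_eq_right hx1
        have ey : Nat.gcd d (y.1 * y.2) = y.1 := by
          rw [Nat.Coprime.gcd_mul_right_cancel_right _ (cop y hy).symm]
          exact Nat.gcd_eq_right hy1
        have e1 : x.1 = y.1 := by rw [← ex, ← ey, h]
        have h0 : 0 < x.1 := Nat.pos_of_dvd_of_pos hx1 hd0
        rw [← e1] at h
        exact Prod.ext e1 (Nat.eq_of_mul_eq_mul_left h0 h)
    rw [b3]
    apply sum_le_sum_of_subset_of_nonneg
    · intro l hl
      simp only [hM, mem_image, mem_product, mem_filter, Nat.mem_divisors] at hl ⊢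
      obtain ⟨x, ⟨⟨h1, _⟩, h2, h3, h4⟩, rfl⟩ := hl
      exact ⟨⟨(Nat.mul_dvd_mul_right h1 _).trans h3, hP⟩, (Nat.mul_le_mul_right _ (Nat.le_of_dvd hd0 h1)).trans h4⟩
    · intro l hl _
      exact (st_nonneg s (mem_filter.1 hl).1).le
  set S := ∑ l ∈ s.prodPrimes.divisors, (if d ∣ l ∧ l ≤ R then s.selbergTerms l else 0) with hS
  have hS0 : 0 ≤ S := sum_nonneg (fun l hl => by split_ifs; exacts [(st_nonneg s hl).le, le_rfl])
  have hmu : |(μ d : ℝ)| ≤ 1 := by exact_mod_cast ArithmeticFunction.abs_moebius_le_one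
  rw [abs_mul, abs_div, abs_of_nonneg hS0, abs_of_pos (mul_pos hnu hG)]
  calc |(μ d : ℝ)| / (s.nu d * GG s R) * S ≤ 1 / (s.nu d * GG s R) * S := by gcongr
    _ = ((s.nu d)⁻¹ * S) / GG s R := by field_simp
    _ ≤ 1 := by rw [div_le_one hG]; exact key
end HH

end

section
namespace HH
open Finset
open scoped ArithmeticFunction.Moebius

/-- the density -/
noncomputable def gp (p : ℕ) : ℝ := (2 - 1 / (p:ℝ)) / p

theorem gp_pos {p : ℕ} (hp : p.Prime) : 0 < gp p := by
  have : (2:ℝ) ≤ p := by exact_mod_cast hp.two_le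
  unfold gp
  apply div_pos _ (by linarith)
  have : 1 / (p:ℝ) ≤ 1 := by rw [div_le_one (by linarith)]; linarith
  linarith

theorem one_sub_gp {p : ℕ} (hp : p.Prime) : 1 - gp p = (1 - 1 / (p:ℝ)) ^ 2 := by
  have : (2:ℝ) ≤ p := by exact_mod_cast hp.two_le
  unfold gp
  field_simp
  ring

theorem gp_lt {p : ℕ} (hp : p.Prime) : gp p < 1 := by
  have h : (2:ℝ) ≤ p := by exact_mod_cast hp.two_le
  have := one_sub_gp hp
  have : 0 < (1 - 1 / (p:ℝ)) ^ 2 := by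
    apply pow_pos
    have : 1 / (p:ℝ) ≤ 1 / 2 := by gcongr
    linarith
  linarith

/-- concrete sieve -/
noncomputable def sv (R : ℕ) : BoundingSieve where
  support := ∅
  prodPrimes := primorial R
  prodPrimes_squarefree := squarefree_primorial R
  weights := fun _ => 0
  weights_nonneg := fun _ => le_rfl
  totalMass := 0
  nu := ArithmeticFunction.prodPrimeFactors gp
  nu_mult := ArithmeticFunction.IsMultiplicative.prodPrimeFactors gp
  nu_pos_of_prime := by
    intro p hp _
    rw [ArithmeticFunction.prodPrimeFactors_apply hp.ne_zero, hp.primeFactors, prod_singleton]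
    exact gp_pos hp
  nu_lt_one_of_prime := by
    intro p hp _
    rw [ArithmeticFunction.prodPrimeFactors_apply hp.ne_zero, hp.primeFactors, prod_singleton]
    exact gp_lt hp

theorem sv_nu (R n : ℕ) (hn : n ≠ 0) : (sv R).nu n = ∏ p ∈ n.primeFactors, gp p := by
  simp [sv, ArithmeticFunction.prodPrimeFactors_apply hn]

theorem st_ge (R l : ℕ) (hl : Squarefree l) : (l.divisors.card : ℝ) / l ≤ (sv R).selbergTerms l := by
  rw [BoundingSieve.selbergTerms_apply, sv_nu _ _ hl.ne_zero, ← prod_mul_distrib]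
  have h1 : (l.divisors.card : ℝ) ≤ ∏ p ∈ l.primeFactors, (2:ℝ) := by
    rw [Nat.card_divisors hl.ne_zero]
    push_cast
    apply prod_le_prod
    · intros; positivity
    · intro p _
      have : l.factorization p ≤ 1 := hl.natFactorization_le_one p
      have : (l.factorization p : ℝ) ≤ 1 := by exact_mod_cast this
      linarith
  have h2 : (l : ℝ) = ∏ p ∈ l.primeFactors, (p:ℝ) := by
    rw [← Nat.cast_prod, Nat.prod_primeFactors_of_squarefree hl]
  calc (l.divisors.card : ℝ) / l ≤ (∏ p ∈ l.primeFactors, (2:ℝ)) / l := by gcongr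
    _ = ∏ p ∈ l.primeFactors, ((2:ℝ) / p) := by rw [h2, prod_div_distrib]
    _ ≤ _ := by
      apply prod_le_prod
      · intros; positivity
      · intro p hp
        have hp' := Nat.prime_of_mem_primeFactors hp
        have h : (2:ℝ) ≤ p := by exact_mod_cast hp'.two_le
        rw [sv_nu _ _ hp'.ne_zero, hp'.primeFactors, prod_singleton, one_sub_gp hp']
        unfold gp
        have e : (1 - 1 / (p:ℝ)) = (p - 1) / p := by field_simp
        have e2 : (2 - 1 / (p:ℝ)) = (2 * p - 1) / p := by field_simp
        rw [e, e2]
        have h1 : (0:ℝ) < p - 1 := by linarith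
        rw [div_pow, inv_div, div_div, ← sq, div_mul_div_comm, div_le_div_iff₀ (by positivity) (by positivity)]
        have : 0 ≤ (p:ℝ) ^ 2 * (3 * p - 2) := by apply mul_nonneg (by positivity); linarith
        nlinarith

theorem sum_inv_sq (Y : ℕ) : ∑ s ∈ Icc 1 Y, 1 / (s:ℝ) ^ 2 ≤ 2 := by
  have := sum_Ioo_inv_sq_le (α := ℝ) 0 (Y + 1)
  norm_num at this
  refine le_trans (le_of_eq ?_) this
  apply sum_congr
  · ext; simp; omega
  · intros; simp

theorem sqf_harm (Y : ℕ) : Real.log (Y + 1) / 2 ≤ ∑ a ∈ (Icc 1 Y).filter Squarefree, 1 / (a:ℝ) := by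
  have h1 : Real.log (Y + 1) ≤ ∑ n ∈ Icc 1 Y, 1 / (n:ℝ) := by
    have := log_add_one_le_harmonic Y
    rw [harmonic_eq_sum_Icc] at this
    push_cast at this
    simpa using this
  have h2 : ∑ n ∈ Icc 1 Y, 1 / (n:ℝ) ≤ (∑ s ∈ Icc 1 Y, 1 / (s:ℝ) ^ 2) * ∑ a ∈ (Icc 1 Y).filter Squarefree, 1 / (a:ℝ) := by
    rw [sum_mul_sum, ← sum_product']
    have : ∀ n ∈ Icc 1 Y, ∃ x ∈ (Icc 1 Y ×ˢ (Icc 1 Y).filter Squarefree), x.1 ^ 2 * x.2 = n := by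
      intro n hn
      rw [mem_Icc] at hn
      obtain ⟨a, b, ha, hb, e, hs⟩ := Nat.sq_mul_squarefree_of_pos hn.1
      refine ⟨(b, a), ?_, e⟩
      simp only [mem_product, mem_Icc, mem_filter]
      have : a ≤ n := by rw [← e]; exact Nat.le_mul_of_pos_left _ (by positivity)
      have : b ≤ n := by
        calc b ≤ b ^ 2 := Nat.le_self_pow (by norm_num) b
          _ ≤ b ^ 2 * a := Nat.le_mul_of_pos_right _ ha
          _ = n := e
      exact ⟨⟨hb, by omega⟩, ⟨ha, by omega⟩, hs⟩
    have hsub : Icc 1 Y ⊆ (Icc 1 Y ×ˢ (Icc 1 Y).filter Squarefree).image (fun x => x.1 ^ 2 * x.2) := by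
      intro n hn
      obtain ⟨x, hx, e⟩ := this n hn
      exact mem_image.2 ⟨x, hx, e⟩
    refine (sum_le_sum_of_subset_of_nonneg hsub (fun _ _ _ => by positivity)).trans ?_
    refine (sum_image_le_of_nonneg (fun _ _ => by positivity)).trans (le_of_eq ?_)
    apply sum_congr rfl
    intro x _
    push_cast
    rw [div_mul_div_comm, one_mul]
  have h3 : (∑ s ∈ Icc 1 Y, 1 / (s:ℝ) ^ 2) * ∑ a ∈ (Icc 1 Y).filter Squarefree, 1 / (a:ℝ) ≤
      2 * ∑ a ∈ (Icc 1 Y).filter Squarefree, 1 / (a:ℝ) := by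
    gcongr
    exact sum_inv_sq Y
  linarith

theorem GG_ge (R : ℕ) (hR : 1 ≤ R) : (Real.log R) ^ 2 / 32 ≤ GG (sv R) R := by
  set Y := Nat.sqrt R with hY
  have hYR : Y * Y ≤ R := Nat.sqrt_le R
  have hY1 : Real.log R / 4 ≤ Real.log (Y + 1) / 2 := by
    have h : (R:ℝ) ≤ (Y + 1) ^ 2 := by
      have := Nat.lt_succ_sqrt R
      have : R ≤ (Y + 1) ^ 2 := by rw [sq]; exact this.le
      exact_mod_cast this
    have := Real.log_le_log (by positivity) h
    rw [Real.log_pow] at this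
    push_cast at this
    linarith
  have hA := sqf_harm Y
  set A := ∑ a ∈ (Icc 1 Y).filter Squarefree, 1 / (a:ℝ)
  have hlog : 0 ≤ Real.log R := Real.log_natCast_nonneg R
  have hA2 : (Real.log R / 4) ^ 2 ≤ A ^ 2 := by gcongr; linarith
  set V := (sv R).prodPrimes.divisors.filter (fun l => l ≤ R) with hV
  have hG : ∑ l ∈ V, (l.divisors.card : ℝ) / l ≤ GG (sv R) R := by
    rw [GG, ← sum_filter]
    apply sum_le_sum
    intro l hl
    exact st_ge R l (BoundingSieve.squarefree_of_mem_divisors_prodPrimes (mem_filter.1 hl).1)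
  set T := V.sigma (fun l => l.divisorsAntidiagonal)
  have hT : ∑ t ∈ T, 1 / (t.1 : ℝ) = ∑ l ∈ V, (l.divisors.card : ℝ) / l := by
    rw [sum_sigma]
    apply sum_congr rfl
    intro l _
    simp only [sum_const, nsmul_eq_mul]
    rw [← Nat.map_div_right_divisors, card_map]
    ring
  have key : A ^ 2 ≤ (∑ s ∈ Icc 1 Y, 1 / (s:ℝ) ^ 2) * ∑ t ∈ T, 1 / (t.1 : ℝ) := by
    rw [sq, sum_mul_sum, sum_mul_sum, ← sum_product', ← sum_product']
    have hinj : Set.InjOn (fun x : ℕ × ℕ => (x.1.gcd x.2, (⟨(x.1 / x.1.gcd x.2) * (x.2 / x.1.gcd x.2),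
        (x.1 / x.1.gcd x.2, x.2 / x.1.gcd x.2)⟩ : (Σ _ : ℕ, ℕ × ℕ))))
        ((Icc 1 Y).filter Squarefree ×ˢ (Icc 1 Y).filter Squarefree : Finset (ℕ × ℕ)) := by
      rintro ⟨a, b⟩ _ ⟨c, d⟩ _ h
      simp only [Prod.mk.injEq, Sigma.mk.injEq] at h
      obtain ⟨h1, h2, h3⟩ := h
      have h3 := Prod.mk.injEq _ _ _ _ ▸ eq_of_heq h3
      obtain ⟨h4, h5⟩ := h3
      have ea : a = c := by
        rw [← Nat.div_mul_cancel (Nat.gcd_dvd_left a b), h4, h1, Nat.div_mul_cancel (Nat.gcd_dvd_left c d)]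
      have eb : b = d := by
        rw [← Nat.div_mul_cancel (Nat.gcd_dvd_right a b), h5, h1, Nat.div_mul_cancel (Nat.gcd_dvd_right c d)]
      rw [ea, eb]
    have hsub : ((Icc 1 Y).filter Squarefree ×ˢ (Icc 1 Y).filter Squarefree).image
        (fun x : ℕ × ℕ => (x.1.gcd x.2, (⟨(x.1 / x.1.gcd x.2) * (x.2 / x.1.gcd x.2),
        (x.1 / x.1.gcd x.2, x.2 / x.1.gcd x.2)⟩ : (Σ _ : ℕ, ℕ × ℕ)))) ⊆ Icc 1 Y ×ˢ T := by
      intro z hz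
      obtain ⟨⟨a, b⟩, h, rfl⟩ := mem_image.1 hz
      simp only [mem_product, mem_filter, mem_Icc] at h
      obtain ⟨⟨⟨ha1, ha2⟩, ha3⟩, ⟨hb1, hb2⟩, hb3⟩ := h
      have hg : 0 < a.gcd b := Nat.gcd_pos_of_pos_left _ ha1
      have hgY : a.gcd b ≤ Y := (Nat.gcd_le_left _ ha1).trans ha2
      have hcop : (a / a.gcd b).Coprime (b / a.gcd b) := Nat.coprime_div_gcd_div_gcd hg
      have hsq : Squarefree (a / a.gcd b * (b / a.gcd b)) := by
        rw [Nat.squarefree_mul hcop]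
        exact ⟨ha3.squarefree_of_dvd (Nat.div_dvd_of_dvd (Nat.gcd_dvd_left _ _)),
          hb3.squarefree_of_dvd (Nat.div_dvd_of_dvd (Nat.gcd_dvd_right _ _))⟩
      have hle : a / a.gcd b * (b / a.gcd b) ≤ R :=
        (Nat.mul_le_mul ((Nat.div_le_self _ _).trans ha2) ((Nat.div_le_self _ _).trans hb2)).trans hYR
      have hdvd : a / a.gcd b * (b / a.gcd b) ∣ primorial R :=
        hsq.dvd_primorial.trans (primorial_dvd_primorial hle)
      simp only [mem_product, mem_Icc, T, mem_sigma, hV, mem_filter, Nat.mem_divisors, Nat.mem_divisorsAntidiagonal]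
      exact ⟨⟨hg, hgY⟩, ⟨⟨hdvd, BoundingSieve.prodPrimes_ne_zero⟩, hle⟩, trivial, hsq.ne_zero⟩
    refine le_trans (le_of_eq ?_) (sum_le_sum_of_subset_of_nonneg hsub (fun _ _ _ => by positivity))
    rw [sum_image hinj]
    apply sum_congr rfl
    rintro ⟨a, b⟩ h
    simp only [mem_product, mem_filter, mem_Icc] at h
    have hg : 0 < a.gcd b := Nat.gcd_pos_of_pos_left _ h.1.1.1
    have ha : (a:ℝ) = (a / a.gcd b : ℕ) * (a.gcd b : ℕ) := by
      exact_mod_cast (Nat.div_mul_cancel (Nat.gcd_dvd_left a b)).symm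
    have hb : (b:ℝ) = (b / a.gcd b : ℕ) * (a.gcd b : ℕ) := by
      exact_mod_cast (Nat.div_mul_cancel (Nat.gcd_dvd_right a b)).symm
    simp only [Nat.cast_mul]
    rw [div_mul_div_comm, div_mul_div_comm]
    congr 1
    nth_rewrite 1 [ha]
    nth_rewrite 1 [hb]
    ring
  have : (∑ s ∈ Icc 1 Y, 1 / (s:ℝ) ^ 2) * ∑ t ∈ T, 1 / (t.1 : ℝ) ≤ 2 * ∑ t ∈ T, 1 / (t.1 : ℝ) := by
    gcongr
    exact sum_inv_sq Y
  rw [hT] at this key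
  nlinarith
end HH

end

section
namespace HH
open Finset
open scoped ArithmeticFunction.Moebius ArithmeticFunction.vonMangoldt

/-- Mertens product -/
noncomputable def WW (M : ℕ) : ℝ := ∏ p ∈ (M + 1).primesBelow, (1 - 1 / (p:ℝ))⁻¹

theorem pinv_lt {p : ℕ} (hp : p.Prime) : 0 < 1 / (p:ℝ) ∧ 1 / (p:ℝ) ≤ 1 / 2 := by
  have h : (2:ℝ) ≤ p := by exact_mod_cast hp.two_le
  exact ⟨by positivity, by gcongr⟩

theorem WW_bound : ∃ C : ℝ, 0 < C ∧ ∀ M : ℕ, 2 ≤ M → WW M ≤ C * Real.log M := by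
  have ht := tendsto_sub_mul_tsum_nat_rpow
  have h1 := ht.eventually (eventually_le_nhds (show (1:ℝ) < 2 by norm_num))
  rw [eventually_nhdsWithin_iff, Metric.eventually_nhds_iff] at h1
  obtain ⟨e, he, h1⟩ := h1
  have hl2 : 0 < Real.log 2 := Real.log_pos (by norm_num)
  set c := e * Real.log 2 / 2 with hc
  have hc0 : 0 < c := by positivity
  refine ⟨2 / c * Real.exp (2 * c * (1 + 8 / Real.log 2)), by positivity, ?_⟩
  intro M hM
  have hlM : Real.log 2 ≤ Real.log M := Real.log_le_log (by norm_num) (by exact_mod_cast hM)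
  have hlM0 : 0 < Real.log M := by linarith
  set κ := c / Real.log M with hκ
  have hκ0 : 0 < κ := by positivity
  have hκe : κ < e := by
    rw [hκ, div_lt_iff₀ hlM0, hc]
    nlinarith
  have hz : κ * ∑' n : ℕ, 1 / (n:ℝ) ^ (1 + κ) ≤ 2 := by
    have := h1 (y := 1 + κ) (by rw [Real.dist_eq]; simpa [abs_of_pos hκ0] using hκe) (by simp [hκ0])
    simpa using this
  -- Euler product
  have hsummable : Summable (fun n : ℕ => 1 / (n:ℝ) ^ (1 + κ)) := Real.summable_one_div_nat_rpow.2 (by linarith)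
  have hp1 : ∀ p : ℕ, p.Prime → 0 ≤ 1 / (p:ℝ) ^ (1 + κ) ∧ 1 / (p:ℝ) ^ (1 + κ) ≤ 1 / (p:ℝ) := by
    intro p hp
    have h : (1:ℝ) ≤ p := by exact_mod_cast hp.one_lt.le
    refine ⟨by positivity, ?_⟩
    gcongr
    calc (p:ℝ) = (p:ℝ) ^ (1:ℝ) := (Real.rpow_one _).symm
      _ ≤ _ := Real.rpow_le_rpow_of_exponent_le h (by linarith)
  have hE : ∏ p ∈ (M + 1).primesBelow, (1 - 1 / (p:ℝ) ^ (1 + κ))⁻¹ ≤ ∑' n : ℕ, 1 / (n:ℝ) ^ (1 + κ) := by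
    have := EulerProduct.summable_and_hasSum_smoothNumbers_prod_primesBelow_tsum
      (f := fun n : ℕ => 1 / (n:ℝ) ^ (1 + κ)) (by simp)
      (by
        intro m n _
        push_cast
        rw [Real.mul_rpow (by positivity) (by positivity)]
        field_simp) 
      (by
        intro p hp
        have := hsummable.comp_injective (Nat.pow_right_injective hp.two_le)
        exact this.norm) (M + 1)
    have e1 : ∏ p ∈ (M + 1).primesBelow, ∑' n : ℕ, 1 / (((p ^ n : ℕ) : ℕ):ℝ) ^ (1 + κ) =
        ∏ p ∈ (M + 1).primesBelow, (1 - 1 / (p:ℝ) ^ (1 + κ))⁻¹ := by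
      apply prod_congr rfl
      intro p hp
      have hp' := Nat.prime_of_mem_primesBelow hp
      rw [← tsum_geometric_of_lt_one (hp1 p hp').1 (by linarith [(hp1 p hp').2, (pinv_lt hp').2])]
      apply tsum_congr
      intro n
      push_cast
      rw [div_pow, one_pow, ← Real.rpow_natCast, ← Real.rpow_mul (by positivity), ← Real.rpow_natCast,
        ← Real.rpow_mul (by positivity), mul_comm]
    rw [← e1, ← this.2.tsum_eq]
    exact hsummable.tsum_subtype_le (fun n : ℕ => 1 / (n:ℝ) ^ (1 + κ)) ((M + 1).smoothNumbers) (fun n => by positivity)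
  -- comparison
  have hcmp : WW M ≤ (∏ p ∈ (M + 1).primesBelow, (1 - 1 / (p:ℝ) ^ (1 + κ))⁻¹) *
      ∏ p ∈ (M + 1).primesBelow, Real.exp (2 * κ * (Real.log p / p)) := by
    rw [WW, ← prod_mul_distrib]
    apply prod_le_prod
    · intro p hp
      have hp' := Nat.prime_of_mem_primesBelow hp
      have := pinv_lt hp'
      apply inv_nonneg.2; linarith
    · intro p hp
      have hp' := Nat.prime_of_mem_primesBelow hp
      have h3 := pinv_lt hp'
      have h4 := hp1 p hp'
      have hp0 : (0:ℝ) < p := by exact_mod_cast hp'.pos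
      set u := 1 / (p:ℝ)
      set v := 1 / (p:ℝ) ^ (1 + κ) with hv
      have hvu : v = u * Real.exp (-(κ * Real.log p)) := by
        rw [hv, Real.rpow_add hp0, Real.rpow_one, Real.rpow_def_of_pos hp0, Real.exp_neg, mul_comm (Real.log p)]
        simp only [u]; field_simp
      have h5 : u - v ≤ κ * (Real.log p / p) := by
        have := Real.add_one_le_exp (-(κ * Real.log p))
        have : u - v ≤ u * (κ * Real.log p) := by rw [hvu]; nlinarith
        refine this.trans (le_of_eq ?_)
        simp only [u]; ring
      have hu1 : 0 < 1 - u := by linarith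
      have hv1 : 0 < 1 - v := by linarith
      rw [inv_mul_eq_div, le_div_iff₀ hv1, inv_mul_le_iff₀ hu1]
      have h6 := Real.add_one_le_exp (2 * κ * (Real.log p / p))
      have h7 : 1 - v ≤ (1 - u) * (1 + 2 * (u - v)) := by nlinarith
      refine h7.trans ?_
      gcongr
      linarith
  rw [← Real.exp_sum, ← mul_sum] at hcmp
  have hmert : ∑ p ∈ (M + 1).primesBelow, Real.log p / p ≤ Real.log M + 8 := by
    have := (abs_le.1 (mertens_nat M (by omega))).2
    have h : ∑ p ∈ (M + 1).primesBelow, Real.log p / p ≤ ∑ n ∈ Ioc 0 M, Λ n / n := by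
      have e : ∑ p ∈ (M + 1).primesBelow, Real.log p / p = ∑ p ∈ (M + 1).primesBelow, Λ p / p := by
        apply sum_congr rfl
        intro p hp
        rw [ArithmeticFunction.vonMangoldt_apply_prime (Nat.prime_of_mem_primesBelow hp)]
      rw [e]
      apply sum_le_sum_of_subset_of_nonneg
      · intro p hp
        have := Nat.lt_of_mem_primesBelow hp
        have := (Nat.prime_of_mem_primesBelow hp).pos
        simp; omega
      · intro n _ _
        exact div_nonneg ArithmeticFunction.vonMangoldt_nonneg (by positivity)
    linarith
  have hexp : 2 * κ * ∑ p ∈ (M + 1).primesBelow, Real.log p / p ≤ 2 * c * (1 + 8 / Real.log 2) := by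
    calc 2 * κ * ∑ p ∈ (M + 1).primesBelow, Real.log p / p ≤ 2 * κ * (Real.log M + 8) := by gcongr
      _ = 2 * c * (1 + 8 / Real.log M) := by rw [hκ]; field_simp
      _ ≤ _ := by gcongr
  have hzz : ∑' n : ℕ, 1 / (n:ℝ) ^ (1 + κ) ≤ 2 / c * Real.log M := by
    have : ∑' n : ℕ, 1 / (n:ℝ) ^ (1 + κ) ≤ 2 / κ := by rw [le_div_iff₀ hκ0]; linarith
    refine this.trans (le_of_eq ?_)
    rw [hκ]; field_simp
  have hpos : 0 ≤ ∏ p ∈ (M + 1).primesBelow, (1 - 1 / (p:ℝ) ^ (1 + κ))⁻¹ := by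
    apply prod_nonneg
    intro p hp
    have hp' := Nat.prime_of_mem_primesBelow hp
    apply inv_nonneg.2; linarith [(hp1 p hp').2, (pinv_lt hp').2]
  calc WW M ≤ _ := hcmp
    _ ≤ (2 / c * Real.log M) * Real.exp (2 * c * (1 + 8 / Real.log 2)) := by
      gcongr
      exact hE.trans hzz
    _ = _ := by ring

theorem lcm_hasSum (R M D : ℕ) (hRM : R ≤ M) (hD : D ∣ primorial R) :
    HasSum (fun m : (M + 1).smoothNumbers => 1 / ((D.lcm m : ℕ) : ℝ)) (WW M * (sv R).nu D) := by
  have hsq : Squarefree D := (squarefree_primorial R).squarefree_of_dvd hD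
  have hD0 : D ≠ 0 := hsq.ne_zero
  have hgeo : ∀ p : ℕ, p.Prime → HasSum (fun n : ℕ => (1 / (p:ℝ)) ^ n) (1 - 1 / (p:ℝ))⁻¹ := fun p hp =>
    hasSum_geometric_of_lt_one (pinv_lt hp).1.le (by linarith [(pinv_lt hp).2])
  have hloc : ∀ p : ℕ, p.Prime → HasSum (fun n : ℕ => ((D.gcd (p ^ n) : ℕ) : ℝ) / ((p ^ n : ℕ) : ℝ))
      ((1 - 1 / (p:ℝ))⁻¹ * if p ∈ D.primeFactors then p * gp p else 1) := by
    intro p hp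
    have hp0 : (p:ℝ) ≠ 0 := by exact_mod_cast hp.ne_zero
    by_cases hpD : p ∣ D
    · rw [if_pos (by simp [hp, hpD, hD0])]
      obtain ⟨q, rfl⟩ := hpD
      have hcop : Nat.Coprime p q := Nat.coprime_of_squarefree_mul hsq
      have : (1 - 1 / (p:ℝ))⁻¹ * (p * gp p) = 1 + (1 - 1 / (p:ℝ))⁻¹ := by
        have : 1 - 1 / (p:ℝ) ≠ 0 := by linarith [(pinv_lt hp).2]
        unfold gp
        rw [mul_div_cancel₀ _ hp0]
        have e : 2 - 1 / (p:ℝ) = 1 + (1 - 1 / (p:ℝ)) := by ring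
        rw [e, mul_add, inv_mul_cancel₀ this]; ring
      rw [this]
      rw [← hasSum_nat_add_iff' 1]
      simp only [sum_range_one, pow_zero, Nat.gcd_one_right]
      norm_num
      convert! hgeo p hp using 1
      · ext n
        rw [pow_succ', Nat.gcd_mul_left, Nat.Coprime.gcd_eq_one (Nat.Coprime.pow_right n hcop.symm)]
        push_cast
        rw [div_pow, one_pow]
        field_simp
        ring
      · rw [one_div]
    · rw [if_neg (by simp [hpD]), mul_one]
      convert! hgeo p hp using 1
      ext n
      have : D.gcd (p ^ n) = 1 := Nat.Coprime.pow_right n ((Nat.Prime.coprime_iff_not_dvd hp).2 hpD).symm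
      rw [this]; push_cast; rw [div_pow, one_pow]
  have h := EulerProduct.summable_and_hasSum_smoothNumbers_prod_primesBelow_tsum
      (f := fun n : ℕ => ((D.gcd n : ℕ) : ℝ) / (n:ℝ)) (by simp)
      (by
        intro m n hmn
        rw [Nat.Coprime.gcd_mul _ hmn]
        push_cast
        rw [div_mul_div_comm]) 
      (by
        intro p hp
        exact (hloc p hp).summable.norm) (M + 1)
  have h2 := h.2.div_const (D:ℝ)
  convert! h2 using 1
  · ext m
    have hm0 : (m:ℕ) ≠ 0 := Nat.ne_zero_of_mem_smoothNumbers m.2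
    have e : ((D.gcd m : ℕ) : ℝ) * ((D.lcm m : ℕ):ℝ) = D * (m:ℕ) := by exact_mod_cast Nat.gcd_mul_lcm D m
    have h1 : ((D.lcm m : ℕ):ℝ) ≠ 0 := by exact_mod_cast Nat.lcm_ne_zero hD0 hm0
    have h2 : (D:ℝ) ≠ 0 := by exact_mod_cast hD0
    have h3 : (((m:ℕ):ℕ):ℝ) ≠ 0 := by exact_mod_cast hm0
    rw [div_div, div_eq_div_iff h1 (mul_ne_zero h3 h2)]
    linarith
  · have e1 : ∀ p ∈ (M + 1).primesBelow, ∑' n : ℕ, ((D.gcd (p ^ n) : ℕ) : ℝ) / ((p ^ n : ℕ) : ℝ) =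
        (1 - 1 / (p:ℝ))⁻¹ * if p ∈ D.primeFactors then p * gp p else 1 := fun p hp =>
      (hloc p (Nat.prime_of_mem_primesBelow hp)).tsum_eq
    have e2 : ∏ p ∈ (M + 1).primesBelow, (if p ∈ D.primeFactors then p * gp p else 1) = D * ∏ p ∈ D.primeFactors, gp p := by
      have : D.primeFactors ⊆ (M + 1).primesBelow := by
        intro p hp
        have hp' := Nat.prime_of_mem_primeFactors hp
        rw [Nat.mem_primesBelow]
        refine ⟨?_, hp'⟩
        have : p ∣ primorial R := (Nat.dvd_of_mem_primeFactors hp).trans hD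
        have := (hp'.dvd_primorial_iff).1 this
        omega
      rw [prod_ite_mem, inter_eq_right.2 this, prod_mul_distrib]
      congr 1
      rw [← Nat.cast_prod, Nat.prod_primeFactors_of_squarefree hsq]
    rw [prod_congr rfl e1, prod_mul_distrib, e2, ← WW, sv_nu _ _ hD0]
    have h2 : (D:ℝ) ≠ 0 := by exact_mod_cast hD0
    field_simp

theorem count_dvd (T D : ℕ) (h : D ∣ T) (hD : 0 < D) : ((((Ioc 0 T).filter (fun n => D ∣ n)).card : ℕ) : ℝ) = T / D := by
  rw [Nat.Ioc_filter_dvd_card_eq_div, Nat.cast_div h (by exact_mod_cast hD.ne')]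

/-- each local quadratic form is nonnegative -/
theorem Q_nonneg (lm : ℕ → ℝ) (P m : ℕ) (hP : P ≠ 0) (hm : m ≠ 0) :
    0 ≤ ∑ d1 ∈ P.divisors, ∑ d2 ∈ P.divisors, lm d1 * lm d2 * (1 / (((d1.lcm d2).lcm m : ℕ) : ℝ)) := by
  set T := P * m with hT
  have hT0 : T ≠ 0 := mul_ne_zero hP hm
  have key : ∑ n ∈ (Ioc 0 T).filter (fun n => m ∣ n), (∑ d ∈ P.divisors, if d ∣ n then lm d else 0) ^ 2 =
      T * ∑ d1 ∈ P.divisors, ∑ d2 ∈ P.divisors, lm d1 * lm d2 * (1 / (((d1.lcm d2).lcm m : ℕ) : ℝ)) := by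
    simp only [sq, sum_mul_sum]
    rw [sum_comm, mul_sum]
    apply sum_congr rfl
    intro d1 h1
    rw [sum_comm, mul_sum]
    apply sum_congr rfl
    intro d2 h2
    have e : ∀ n ∈ (Ioc 0 T).filter (fun n => m ∣ n), ((if d1 ∣ n then lm d1 else 0) * (if d2 ∣ n then lm d2 else 0)) =
        if (d1.lcm d2) ∣ n then lm d1 * lm d2 else 0 := by
      intro n _
      by_cases a : d1 ∣ n <;> by_cases b : d2 ∣ n <;> simp [a, b, Nat.lcm_dvd_iff]
    rw [sum_congr rfl e, ← sum_filter, filter_filter, sum_const, nsmul_eq_mul]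
    have hd1 := Nat.pos_of_mem_divisors h1
    have hd2 := Nat.pos_of_mem_divisors h2
    have hl : 0 < (d1.lcm d2).lcm m := Nat.lcm_pos (Nat.lcm_pos hd1 hd2) (Nat.pos_of_ne_zero hm)
    have hdv : (d1.lcm d2).lcm m ∣ T := by
      apply Nat.lcm_dvd
      · exact (Nat.lcm_dvd (Nat.dvd_of_mem_divisors h1) (Nat.dvd_of_mem_divisors h2)).trans (dvd_mul_right _ _)
      · exact dvd_mul_left _ _
    have := count_dvd T _ hdv hl
    have e2 : (Ioc 0 T).filter (fun n => m ∣ n ∧ d1.lcm d2 ∣ n) = (Ioc 0 T).filter (fun n => (d1.lcm d2).lcm m ∣ n) := by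
      apply filter_congr
      intro n _
      exact ⟨fun h => Nat.lcm_dvd h.2 h.1, fun h => ⟨(Nat.dvd_lcm_right _ _).trans h, (Nat.dvd_lcm_left _ _).trans h⟩⟩
    rw [e2, this]
    ring
  have h0 : 0 ≤ ∑ n ∈ (Ioc 0 T).filter (fun n => m ∣ n), (∑ d ∈ P.divisors, if d ∣ n then lm d else 0) ^ 2 :=
    sum_nonneg (fun _ _ => sq_nonneg _)
  rw [key] at h0
  have : (0:ℝ) < T := by exact_mod_cast Nat.pos_of_ne_zero hT0
  exact nonneg_of_mul_nonneg_right h0 this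

theorem lemB : ∃ C : ℝ, 0 < C ∧ ∀ R : ℕ, 2 ≤ R → ∃ lm : ℕ → ℝ, lm 1 = 1 ∧ (∀ d, |lm d| ≤ 1) ∧
    (∀ d, lm d ≠ 0 → d ∣ primorial R ∧ d ≤ R) ∧
    ∀ M : ℕ, R ≤ M → ∑ m ∈ Icc 1 M, ∑ d1 ∈ (primorial R).divisors, ∑ d2 ∈ (primorial R).divisors,
      lm d1 * lm d2 * (1 / (((d1.lcm d2).lcm m : ℕ) : ℝ)) ≤ C * Real.log M / (Real.log R) ^ 2 := by
  obtain ⟨C, hC, hW⟩ := WW_bound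
  refine ⟨32 * C, by positivity, ?_⟩
  intro R hR
  refine ⟨lam (sv R) R, lam_one _ _ (by omega), lam_le _ _ (by omega), fun d hd => lam_supp _ _ hd, ?_⟩
  intro M hM
  set P := primorial R with hP
  have hP0 : P ≠ 0 := (primorial_pos R).ne'
  set Q : ℕ → ℝ := fun m => ∑ d1 ∈ P.divisors, ∑ d2 ∈ P.divisors,
      lam (sv R) R d1 * lam (sv R) R d2 * (1 / (((d1.lcm d2).lcm m : ℕ) : ℝ)) with hQ
  have hs : HasSum (fun m : (M + 1).smoothNumbers => Q m) (∑ d1 ∈ P.divisors, ∑ d2 ∈ P.divisors,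
      lam (sv R) R d1 * lam (sv R) R d2 * (WW M * (sv R).nu (d1.lcm d2))) := by
    apply hasSum_sum
    intro d1 h1
    apply hasSum_sum
    intro d2 h2
    apply HasSum.mul_left
    exact lcm_hasSum R M _ hM (Nat.lcm_dvd (Nat.dvd_of_mem_divisors h1) (Nat.dvd_of_mem_divisors h2))
  have e : (∑ d1 ∈ P.divisors, ∑ d2 ∈ P.divisors,
      lam (sv R) R d1 * lam (sv R) R d2 * (WW M * (sv R).nu (d1.lcm d2))) = WW M * (1 / GG (sv R) R) := by
    rw [← lam_quad (sv R) R (by omega), mul_sum]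
    apply sum_congr rfl; intro d1 _
    rw [mul_sum]
    apply sum_congr rfl; intro d2 _
    ring
  rw [e] at hs
  have hmem : ∀ m ∈ Icc 1 M, m ∈ (M + 1).smoothNumbers := by
    intro m hm
    rw [mem_Icc] at hm
    rw [Nat.mem_smoothNumbers_iff_forall_le]
    exact ⟨by omega, fun p hp _ _ => by omega⟩
  have hle : ∑ m ∈ Icc 1 M, Q m ≤ WW M * (1 / GG (sv R) R) := by
    have e1 : ∑ m ∈ Icc 1 M, Q m = ∑ m ∈ (Icc 1 M).subtype (fun m => m ∈ (M + 1).smoothNumbers), Q m := by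
      rw [sum_subtype_eq_sum_filter, filter_true_of_mem hmem]
    rw [e1]
    apply sum_le_hasSum _ _ hs
    intro m _
    exact Q_nonneg _ P m hP0 (Nat.ne_zero_of_mem_smoothNumbers m.2)
  refine hle.trans ?_
  have hG := GG_ge R (by omega)
  have hlR : 0 < Real.log R := Real.log_pos (by exact_mod_cast (show 1 < R by omega))
  have hlM : 0 < Real.log M := Real.log_pos (by exact_mod_cast (show 1 < M by omega))
  have hG0 : 0 < Real.log R ^ 2 / 32 := by positivity
  calc WW M * (1 / GG (sv R) R) ≤ (C * Real.log M) * (1 / (Real.log R ^ 2 / 32)) := by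
        apply mul_le_mul (hW M (by omega)) _ _ (by positivity)
        · gcongr
        · have := lt_of_lt_of_le hG0 hG; positivity
    _ = _ := by field_simp
end HH

end

section
open Finset
open scoped ArithmeticFunction.vonMangoldt ArithmeticFunction.Moebius ArithmeticFunction.zeta
namespace HH

theorem cnt (D : ℕ) (hD : 1 ≤ D) (y z : ℝ) (hy : 0 ≤ y) (hyz : y ≤ z) :
    |((((Ioc ⌊y⌋₊ ⌊z⌋₊).filter (fun n => D ∣ n)).card : ℕ) : ℝ) - (z - y) / D| ≤ 1 := by
  have hfl : ⌊y⌋₊ ≤ ⌊z⌋₊ := Nat.floor_le_floor hyz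
  have h : ((Ioc ⌊y⌋₊ ⌊z⌋₊).filter (fun n => D ∣ n)).card + ⌊y⌋₊ / D = ⌊z⌋₊ / D := by
    rw [← Nat.Ioc_filter_dvd_card_eq_div, ← Nat.Ioc_filter_dvd_card_eq_div, ← card_union_of_disjoint]
    · congr 1
      rw [← filter_union, union_comm, Ioc_union_Ioc_eq_Ioc (Nat.zero_le _) hfl]
    · apply disjoint_filter_filter
      rw [disjoint_left]; intro a; simp; omega
  have hz : (⌊z⌋₊ / D : ℕ) = ⌊z / D⌋₊ := (floor_div z D).symm
  have hy' : (⌊y⌋₊ / D : ℕ) = ⌊y / D⌋₊ := (floor_div y D).symm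
  rw [hz, hy'] at h
  have h' : ((((Ioc ⌊y⌋₊ ⌊z⌋₊).filter (fun n => D ∣ n)).card : ℕ) : ℝ) + (⌊y / D⌋₊ : ℝ) = (⌊z / D⌋₊ : ℝ) := by
    exact_mod_cast h
  have a1 := Nat.floor_le (a := y / D) (by positivity)
  have a2 := Nat.floor_le (a := z / D) (div_nonneg (hy.trans hyz) (by positivity))
  have a3 := Nat.lt_floor_add_one (y / D)
  have a4 := Nat.lt_floor_add_one (z / D)
  rw [abs_le, sub_div]
  constructor <;> linarith

theorem lemN : ∃ C : ℝ, 0 < C ∧ ∀ R : ℕ, 2 ≤ R → ∃ ν q : ℕ → ℝ,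
    (∀ n, 0 ≤ ν n) ∧ (∀ n, 0 < n → (∀ p : ℕ, p.Prime → p ∣ n → R < p) → ν n = 1) ∧
    (∀ n, 0 < n → n.primeFactors.card ≤ 2 → ν n ≤ 16) ∧
    (∀ m, 1 ≤ m → 0 ≤ q m) ∧
    (∀ m, 1 ≤ m → ∀ y z : ℝ, 0 ≤ y → y ≤ z →
      |∑ n ∈ (Ioc ⌊y⌋₊ ⌊z⌋₊).filter (fun n => m ∣ n), ν n - (z - y) * q m| ≤ (R:ℝ) ^ 2) ∧
    ∀ M : ℕ, R ≤ M → ∑ m ∈ Icc 1 M, q m ≤ C * Real.log M / (Real.log R) ^ 2 := by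
  obtain ⟨C, hC, hlem⟩ := lemB
  refine ⟨C, hC, fun R hR => ?_⟩
  obtain ⟨lm, h1, hle, hsupp, hM⟩ := hlem R hR
  set P := primorial R with hP
  have hP0 : P ≠ 0 := (primorial_pos R).ne'
  refine ⟨fun n => (∑ d ∈ P.divisors, if d ∣ n then lm d else 0) ^ 2,
    fun m => ∑ d1 ∈ P.divisors, ∑ d2 ∈ P.divisors, lm d1 * lm d2 * (1 / (((d1.lcm d2).lcm m : ℕ) : ℝ)),
    fun n => sq_nonneg _, ?_, ?_, fun m hm => Q_nonneg lm P m hP0 (by omega), ?_, hM⟩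
  · intro n hn hp
    have : ∑ d ∈ P.divisors, (if d ∣ n then lm d else 0) = 1 := by
      rw [sum_eq_single 1]
      · simp [h1]
      · intro d hd hd1
        rw [if_neg]
        intro hdn
        obtain ⟨p, hpp, hpd⟩ := Nat.exists_prime_and_dvd hd1
        have a := hp p hpp (hpd.trans hdn)
        have b := (hpp.dvd_primorial_iff).1 (hpd.trans (Nat.dvd_of_mem_divisors hd))
        omega
      · intro h; exact absurd (Nat.mem_divisors.2 ⟨one_dvd _, hP0⟩) h
    simp only [this]; norm_num
  · intro n hn hc
    have hcard : (P.divisors.filter (fun d => d ∣ n)).card ≤ 4 := by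
      calc _ ≤ n.primeFactors.powerset.card := by
            apply card_le_card_of_injOn (fun d => d.primeFactors)
            · intro d hd
              simp only [coe_filter, Set.mem_setOf_eq] at hd
              simp only [coe_powerset, Set.mem_preimage, Set.mem_powerset_iff, coe_subset]
              exact Nat.primeFactors_mono hd.2 hn.ne'
            · intro d hd e he hde
              simp only [coe_filter, Set.mem_setOf_eq, Nat.mem_divisors] at hd he
              have hsd : Squarefree d := (squarefree_primorial R).squarefree_of_dvd hd.1.1
              have hse : Squarefree e := (squarefree_primorial R).squarefree_of_dvd he.1.1
              rw [← Nat.prod_primeFactors_of_squarefree hsd, ← Nat.prod_primeFactors_of_squarefree hse]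
              simp only at hde
              rw [hde]
        _ = 2 ^ n.primeFactors.card := card_powerset _
        _ ≤ 2 ^ 2 := Nat.pow_le_pow_right (by norm_num) hc
        _ = 4 := by norm_num
    have : |∑ d ∈ P.divisors, (if d ∣ n then lm d else 0)| ≤ 4 := by
      rw [← sum_filter]
      calc _ ≤ ∑ d ∈ P.divisors.filter (fun d => d ∣ n), |lm d| := abs_sum_le_sum_abs _ _
        _ ≤ ∑ d ∈ P.divisors.filter (fun d => d ∣ n), 1 := sum_le_sum (fun d _ => hle d)
        _ ≤ 4 := by rw [sum_const, nsmul_eq_mul, mul_one]; exact_mod_cast hcard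
    have := sq_le_sq' (abs_le.1 this).1 (abs_le.1 this).2
    norm_num at this
    exact this
  · intro m hm y z hy hyz
    have key : ∑ n ∈ (Ioc ⌊y⌋₊ ⌊z⌋₊).filter (fun n => m ∣ n), (∑ d ∈ P.divisors, if d ∣ n then lm d else 0) ^ 2 =
      ∑ d1 ∈ P.divisors, ∑ d2 ∈ P.divisors, lm d1 * lm d2 * 
        ((((Ioc ⌊y⌋₊ ⌊z⌋₊).filter (fun n => (d1.lcm d2).lcm m ∣ n)).card : ℕ) : ℝ) := by
      simp only [sq, sum_mul_sum]
      rw [sum_comm]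
      apply sum_congr rfl
      intro d1 h1
      rw [sum_comm]
      apply sum_congr rfl
      intro d2 h2
      have e : ∀ n ∈ (Ioc ⌊y⌋₊ ⌊z⌋₊).filter (fun n => m ∣ n), ((if d1 ∣ n then lm d1 else 0) * (if d2 ∣ n then lm d2 else 0)) =
          if (d1.lcm d2) ∣ n then lm d1 * lm d2 else 0 := by
        intro n _
        by_cases a : d1 ∣ n <;> by_cases b : d2 ∣ n <;> simp [a, b, Nat.lcm_dvd_iff]
      rw [sum_congr rfl e, ← sum_filter, filter_filter, sum_const, nsmul_eq_mul]
      have e2 : (Ioc ⌊y⌋₊ ⌊z⌋₊).filter (fun n => m ∣ n ∧ d1.lcm d2 ∣ n) = (Ioc ⌊y⌋₊ ⌊z⌋₊).filter (fun n => (d1.lcm d2).lcm m ∣ n) := by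
        apply filter_congr
        intro n _
        exact ⟨fun h => Nat.lcm_dvd h.2 h.1, fun h => ⟨(Nat.dvd_lcm_right _ _).trans h, (Nat.dvd_lcm_left _ _).trans h⟩⟩
      rw [e2]
      ring
    rw [key, mul_sum, ← sum_sub_distrib]
    have hb : ∑ d ∈ P.divisors, |lm d| ≤ R := by
      calc ∑ d ∈ P.divisors, |lm d| = ∑ d ∈ P.divisors.filter (fun d => lm d ≠ 0), |lm d| := by
            rw [sum_filter]
            apply sum_congr rfl
            intro d _
            by_cases h : lm d = 0 <;> simp [h]
        _ ≤ ∑ d ∈ P.divisors.filter (fun d => lm d ≠ 0), 1 := sum_le_sum (fun d _ => hle d)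
        _ ≤ ∑ d ∈ Ioc 0 R, (1:ℝ) := by
            apply sum_le_sum_of_subset_of_nonneg
            · intro d hd
              simp only [mem_filter] at hd
              simp only [mem_Ioc]
              exact ⟨Nat.pos_of_mem_divisors hd.1, (hsupp d hd.2).2⟩
            · intros; norm_num
        _ = R := by simp
    calc _ ≤ ∑ d1 ∈ P.divisors, ∑ d2 ∈ P.divisors, |lm d1| * |lm d2| := by
          refine (abs_sum_le_sum_abs _ _).trans (sum_le_sum fun d1 h1 => ?_)
          rw [mul_sum, ← sum_sub_distrib]
          refine (abs_sum_le_sum_abs _ _).trans (sum_le_sum fun d2 h2 => ?_)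
          have hl : 0 < (d1.lcm d2).lcm m := Nat.lcm_pos (Nat.lcm_pos (Nat.pos_of_mem_divisors h1) (Nat.pos_of_mem_divisors h2)) hm
          have := cnt _ hl y z hy hyz
          have e : ∀ a b c d : ℝ, a * b * c - d * (a * b * (1 / (((d1.lcm d2).lcm m : ℕ) : ℝ))) = a * b * (c - d / (((d1.lcm d2).lcm m : ℕ) : ℝ)) := by
            intros; ring
          rw [e, abs_mul, abs_mul]
          exact mul_le_of_le_one_right (by positivity) this
      _ = (∑ d ∈ P.divisors, |lm d|) ^ 2 := by rw [sq, sum_mul_sum]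
      _ ≤ _ := by
        have : 0 ≤ ∑ d ∈ P.divisors, |lm d| := sum_nonneg (fun _ _ => abs_nonneg _)
        gcongr

end HH

end

section
open Finset
open scoped ArithmeticFunction.vonMangoldt ArithmeticFunction.Moebius ArithmeticFunction.zeta
namespace HH
local notation "ψ" => Chebyshev.psi

theorem BT : ∃ C : ℝ, 1 ≤ C ∧ ∀ y : ℝ, 1 ≤ y → ∀ h : ℝ, √y ≤ h → h ≤ y → ψ (y + h) - ψ y ≤ C * h := by
  obtain ⟨C, hC, hN⟩ := lemN
  obtain ⟨C', hC'⟩ := Chebyshev.psi_sub_theta_le_mul_sqrt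
  refine ⟨12 * 256 + 32 * C + 32 + 2 * |C'|, ?_, ?_⟩
  · have := abs_nonneg C'; linarith
  intro y hy h hh hhy
  have hsy : 1 ≤ √y := Real.one_le_sqrt.2 hy
  have hh0 : 0 < h := by linarith
  by_cases hyl : y < 256
  · have a := psi_le6 (x := y + h) (by linarith)
    have b := Chebyshev.psi_nonneg y
    have c := abs_nonneg C'
    have : 6 * (y + h) ≤ 12 * 256 * h := by nlinarith
    nlinarith
  push Not at hyl
  set u := y ^ (1/8:ℝ) with hu
  have hu8 : u ^ 8 = y := by
    rw [hu, ← Real.rpow_natCast, ← Real.rpow_mul (by linarith)]; norm_num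
  have hu0 : 0 ≤ u := by positivity
  have hu2 : 2 ≤ u := by
    by_contra hlt
    push Not at hlt
    have : u ^ 8 < 2 ^ 8 := by gcongr
    linarith
  have hs : √y = u ^ 4 := by
    rw [← hu8, show u ^ 8 = (u ^ 4) ^ 2 by ring, Real.sqrt_sq (by positivity)]
  set R := ⌊u⌋₊ with hR
  have hR2 : 2 ≤ R := Nat.le_floor (by exact_mod_cast hu2)
  have hRu : (R:ℝ) ≤ u := Nat.floor_le hu0
  have huR : u < R + 1 := Nat.lt_floor_add_one u
  have hR2' : (2:ℝ) ≤ R := by exact_mod_cast hR2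
  have hlogR : 0 < Real.log R := Real.log_pos (by linarith)
  have hlog : Real.log (2 * y) ≤ 32 * Real.log R := by
    have h1 : 2 * y ≤ (R:ℝ) ^ 32 := by
      have : u ≤ (R:ℝ) ^ 2 := by nlinarith
      have : u ^ 8 ≤ ((R:ℝ) ^ 2) ^ 8 := by gcongr
      calc 2 * y ≤ y * y := by nlinarith
        _ = u ^ 8 * u ^ 8 := by rw [hu8]
        _ ≤ ((R:ℝ) ^ 2) ^ 8 * ((R:ℝ) ^ 2) ^ 8 := by gcongr
        _ = _ := by ring
    calc Real.log (2 * y) ≤ Real.log ((R:ℝ) ^ 32) := Real.log_le_log (by linarith) h1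
      _ = _ := by rw [Real.log_pow]; norm_num
  obtain ⟨ν, q, hν0, hν1, -, hq0, hd, hM⟩ := hN R hR2
  have hq1 : q 1 ≤ C / Real.log R := by
    have := hM R le_rfl
    have h1 : q 1 ≤ ∑ m ∈ Icc 1 R, q m := single_le_sum (fun m hm => hq0 m (mem_Icc.1 hm).1) (by simp; omega)
    calc q 1 ≤ _ := h1.trans this
      _ = _ := by field_simp
  have hs1 := (abs_le.1 (hd 1 le_rfl y (y + h) (by linarith) (by linarith))).2
  simp only [one_dvd, filter_true] at hs1
  have hν : ∑ n ∈ Ioc ⌊y⌋₊ ⌊y + h⌋₊, ν n ≤ h * (C / Real.log R) + u ^ 2 := by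
    have : (y + h - y) * q 1 ≤ h * (C / Real.log R) := by rw [add_sub_cancel_left]; gcongr
    have : (R:ℝ) ^ 2 ≤ u ^ 2 := by gcongr
    linarith
  have hθ : Chebyshev.theta (y + h) - Chebyshev.theta y ≤ Real.log (2 * y) * ∑ n ∈ Ioc ⌊y⌋₊ ⌊y + h⌋₊, ν n := by
    have hfl : ⌊y⌋₊ ≤ ⌊y + h⌋₊ := Nat.floor_le_floor (by linarith)
    have e : Chebyshev.theta (y + h) - Chebyshev.theta y = ∑ p ∈ (Ioc ⌊y⌋₊ ⌊y + h⌋₊).filter Nat.Prime, Real.log p := by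
      unfold Chebyshev.theta
      rw [← Ioc_union_Ioc_eq_Ioc (Nat.zero_le _) hfl, filter_union, sum_union]
      · ring
      · apply disjoint_filter_filter
        rw [disjoint_left]; intro a; simp; omega
    rw [e, mul_sum, sum_filter]
    apply sum_le_sum
    intro n hn
    rw [mem_Ioc] at hn
    have hnz : (n:ℝ) ≤ y + h := (Nat.le_floor_iff (by linarith)).1 hn.2
    have hlog0 : 0 ≤ Real.log (2 * y) := Real.log_nonneg (by linarith)
    split_ifs with hp
    · rw [hν1 n hp.pos]
      · rw [mul_one]
        exact Real.log_le_log (by exact_mod_cast hp.pos) (by linarith)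
      · intro p hpp hpn
        rw [(Nat.prime_dvd_prime_iff_eq hpp hp).1 hpn]
        have : R ≤ ⌊y⌋₊ := Nat.floor_le_floor (by
          rw [← hu8]; exact le_self_pow₀ (by linarith) (by norm_num))
        omega
    · exact mul_nonneg hlog0 (hν0 n)
  have hlogy : Real.log (2 * y) ≤ 32 * u := by
    have : Real.log R ≤ R := (Real.log_le_sub_one_of_pos (by linarith)).trans (by linarith)
    linarith
  have hfin : Real.log (2 * y) * ∑ n ∈ Ioc ⌊y⌋₊ ⌊y + h⌋₊, ν n ≤ 32 * C * h + 32 * h := by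
    have hlog0 : 0 ≤ Real.log (2 * y) := Real.log_nonneg (by linarith)
    calc _ ≤ Real.log (2 * y) * (h * (C / Real.log R) + u ^ 2) := by gcongr
      _ = Real.log (2 * y) * (h * (C / Real.log R)) + Real.log (2 * y) * u ^ 2 := by ring
      _ ≤ (32 * Real.log R) * (h * (C / Real.log R)) + (32 * u) * u ^ 2 := by gcongr
      _ = 32 * C * h + 32 * u ^ 3 := by field_simp
      _ ≤ _ := by
        have : u ^ 3 ≤ u ^ 4 := pow_le_pow_right₀ (by linarith) (by norm_num)
        linarith
  have h1 := hC' (y + h)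
  have h2 : Chebyshev.theta y ≤ ψ y := Chebyshev.theta_le_psi y
  have h3 : C' * √(y + h) ≤ |C'| * (2 * h) := by
    have : √(y + h) ≤ 2 * h := by
      rw [Real.sqrt_le_left (by linarith)]
      have : y = √y ^ 2 := (Real.sq_sqrt (by linarith)).symm
      nlinarith
    calc C' * √(y + h) ≤ |C'| * √(y + h) := by gcongr; exact le_abs_self _
      _ ≤ _ := by gcongr
  nlinarith
end HH

end

section
open Finset
open scoped ArithmeticFunction.vonMangoldt ArithmeticFunction.Moebius ArithmeticFunction.zeta
namespace HH
local notation "ψ" => Chebyshev.psi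

noncomputable def LL (n : ℕ) : ℝ := ∑ p ∈ n.divisorsAntidiagonal, Λ p.1 * Λ p.2

noncomputable def fy (y : ℝ) (n : ℕ) : ℝ := ∑ d ∈ n.divisors, (μ d : ℝ) * (Real.log (y / d)) ^ 2

theorem psi_zero_of {x : ℝ} (hx : x < 1) : ψ x = 0 := by
  rw [Chebyshev.psi, Nat.floor_eq_zero.2 hx]; simp

theorem hyp0 (F : ℕ → ℝ) (x : ℝ) (hx : 0 ≤ x) (N : ℕ) (hN : ⌊x⌋₊ ≤ N) :
    ∑ n ∈ Ioc 0 ⌊x⌋₊, ∑ p ∈ n.divisorsAntidiagonal, F p.1 * Λ p.2 = ∑ a ∈ Ioc 0 N, F a * ψ (x / a) := by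
  rw [← sum_hyper _ (fun a b => F a * Λ b), ← Ioc_union_Ioc_eq_Ioc (Nat.zero_le _) hN, sum_union]
  · have : ∑ a ∈ Ioc ⌊x⌋₊ N, F a * ψ (x / a) = 0 := by
      apply sum_eq_zero
      intro a ha
      rw [mem_Ioc] at ha
      have ha0 : (0:ℝ) < a := by exact_mod_cast (by omega : 0 < a)
      rw [psi_zero_of, mul_zero]
      rw [div_lt_one ha0]
      exact (Nat.floor_lt hx).1 ha.1
    rw [this, add_zero]
    apply sum_congr rfl
    intro a _
    rw [← mul_sum, Chebyshev.psi, floor_div]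
  · rw [disjoint_left]; intro a; simp; omega

theorem sum_Ioc_split (F : ℕ → ℝ) {a b : ℕ} (hab : a ≤ b) : ∑ n ∈ Ioc a b, F n = ∑ n ∈ Ioc 0 b, F n - ∑ n ∈ Ioc 0 a, F n := by
  rw [← Ioc_union_Ioc_eq_Ioc (Nat.zero_le a) hab, sum_union]
  · ring
  · rw [disjoint_left]; intro a; simp; omega

theorem hypF (F : ℕ → ℝ) (y z : ℝ) (hy : 0 ≤ y) (hyz : y ≤ z) (N : ℕ) (hN : ⌊z⌋₊ ≤ N) :
    ∑ n ∈ Ioc ⌊y⌋₊ ⌊z⌋₊, ∑ p ∈ n.divisorsAntidiagonal, F p.1 * Λ p.2 =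
      ∑ a ∈ Ioc 0 N, F a * (ψ (z / a) - ψ (y / a)) := by
  have hfl : ⌊y⌋₊ ≤ ⌊z⌋₊ := Nat.floor_le_floor hyz
  rw [sum_Ioc_split _ hfl, hyp0 F z (hy.trans hyz) N hN, hyp0 F y hy N (hfl.trans hN), ← sum_sub_distrib]
  apply sum_congr rfl
  intros; ring

theorem psi_sub (y z : ℝ) (hyz : y ≤ z) : ψ z - ψ y = ∑ n ∈ Ioc ⌊y⌋₊ ⌊z⌋₊, Λ n := by
  rw [sum_Ioc_split _ (Nat.floor_le_floor hyz), Chebyshev.psi, Chebyshev.psi]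

theorem mu_log_sq (n : ℕ) : ∑ d ∈ n.divisors, (μ d : ℝ) * (Real.log d) ^ 2 = LL n - Λ n * Real.log n := by
  set F : ArithmeticFunction ℝ := ArithmeticFunction.pmul (μ : ArithmeticFunction ℝ) ArithmeticFunction.log with hF
  have h1 : F * (ζ : ArithmeticFunction ℝ) = -Λ := by
    ext m
    rw [ArithmeticFunction.coe_mul_zeta_apply, ArithmeticFunction.neg_apply, ← ArithmeticFunction.sum_moebius_mul_log_eq]
    rfl
  have h2 : F * ArithmeticFunction.log = -(Λ * Λ) := by
    rw [← ArithmeticFunction.zeta_mul_vonMangoldt, ← mul_assoc, h1]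
    ext m
    simp only [ArithmeticFunction.mul_apply, ArithmeticFunction.neg_apply, neg_mul, sum_neg_distrib]
  have h3 : ∑ p ∈ n.divisorsAntidiagonal, (μ p.1 : ℝ) * Real.log p.1 * Real.log p.2 = - LL n := by
    have := congrArg (fun f => f n) h2
    simp only [ArithmeticFunction.neg_apply, ArithmeticFunction.mul_apply] at this
    exact this
  have h4 : ∑ d ∈ n.divisors, (μ d : ℝ) * (Real.log d) ^ 2 = ∑ p ∈ n.divisorsAntidiagonal, (μ p.1 : ℝ) * (Real.log p.1) ^ 2 := by
    rw [Nat.sum_divisorsAntidiagonal (fun i _ => (μ i : ℝ) * (Real.log i) ^ 2)]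
  have h5 : ∑ p ∈ n.divisorsAntidiagonal, (μ p.1 : ℝ) * Real.log p.1 * Real.log n = - Λ n * Real.log n := by
    rw [← sum_mul, Nat.sum_divisorsAntidiagonal (fun i _ => (μ i : ℝ) * (Real.log i))]
    congr 1
    exact ArithmeticFunction.sum_moebius_mul_log_eq
  have h6 : ∑ p ∈ n.divisorsAntidiagonal, (μ p.1 : ℝ) * Real.log p.1 * Real.log n =
      ∑ p ∈ n.divisorsAntidiagonal, (μ p.1 : ℝ) * (Real.log p.1) ^ 2 + 
      ∑ p ∈ n.divisorsAntidiagonal, (μ p.1 : ℝ) * Real.log p.1 * Real.log p.2 := by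
    rw [← sum_add_distrib]
    apply sum_congr rfl
    intro p hp
    rw [Nat.mem_divisorsAntidiagonal] at hp
    have a : (p.1:ℝ) ≠ 0 := by intro h; apply hp.2; rw [← hp.1]; simp at h; simp [h]
    have b : (p.2:ℝ) ≠ 0 := by intro h; apply hp.2; rw [← hp.1]; simp at h; simp [h]
    rw [← hp.1]
    push_cast
    rw [Real.log_mul a b]; ring
  linarith

theorem fy_eq (y : ℝ) (hy : 0 < y) (n : ℕ) (hn : 1 < n) :
    fy y n = Λ n * Real.log y + LL n - Λ n * Real.log (n / y) := by
  have h : fy y n = Real.log y ^ 2 * ∑ d ∈ n.divisors, (μ d : ℝ) - 2 * Real.log y * ∑ d ∈ n.divisors, (μ d : ℝ) * ArithmeticFunction.log d +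
      ∑ d ∈ n.divisors, (μ d : ℝ) * (Real.log d) ^ 2 := by
    rw [fy, mul_sum, mul_sum, ← sum_sub_distrib, ← sum_add_distrib]
    apply sum_congr rfl
    intro d hd
    have := Nat.pos_of_mem_divisors hd
    rw [Real.log_div hy.ne' (by exact_mod_cast this.ne'), ArithmeticFunction.log_apply]; ring
  rw [h, mu_log_sq, sum_mu, if_neg (by omega), ArithmeticFunction.sum_moebius_mul_log_eq, Real.log_div (by exact_mod_cast (by omega)) hy.ne']
  ring

theorem S1 (C : ℝ) (R : ℕ) (hR : 2 ≤ R) (ν q : ℕ → ℝ) (hν0 : ∀ n, 0 ≤ ν n)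
    (hd : ∀ m, 1 ≤ m → ∀ y z : ℝ, 0 ≤ y → y ≤ z →
      |∑ n ∈ (Ioc ⌊y⌋₊ ⌊z⌋₊).filter (fun n => m ∣ n), ν n - (z - y) * q m| ≤ (R:ℝ) ^ 2)
    (hM : ∀ M : ℕ, R ≤ M → ∑ m ∈ Icc 1 M, q m ≤ C * Real.log M / (Real.log R) ^ 2) (hC : 0 < C)
    (y : ℝ) (hy : (R:ℝ) ^ 10 ≤ y) :
    ∃ C1 : ℝ, ∀ z, y ≤ z → z ≤ 2 * y → 
      |∑ n ∈ Ioc ⌊y⌋₊ ⌊z⌋₊, ν n * fy y n - (z - y) * C1| ≤ 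
        1100 * C * (z - y) * Real.log R + (2 * y / (R:ℝ) ^ 8 * (Real.log y) ^ 2 + 200 * (R:ℝ) ^ 12 * (Real.log R) ^ 2) := by
  set M := R ^ 10 with hMd
  have hR' : (2:ℝ) ≤ R := by exact_mod_cast hR
  have hR0 : (0:ℝ) < R := by linarith
  have hMr : (M:ℝ) = (R:ℝ) ^ 10 := by rw [hMd]; push_cast; rfl
  have hM1 : (2:ℝ) ≤ M := by
    rw [hMr]; exact hR'.trans (le_self_pow₀ (by linarith) (by norm_num))
  have hy1 : 1 ≤ y := by linarith
  set D := ⌈y / M⌉₊ with hD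
  have hDy : y / M ≤ D := Nat.le_ceil _
  have hyM : 1 ≤ y / M := by rw [le_div_iff₀ (by linarith)]; linarith
  have hD2 : (D:ℝ) ≤ 2 * y / M := by
    have := Nat.ceil_lt_add_one (show 0 ≤ y / M by positivity)
    rw [mul_div_assoc]; linarith
  have hDy' : (D:ℝ) ≤ y := hD2.trans (by rw [div_le_iff₀ (by linarith)]; nlinarith)
  have hlR : 0 < Real.log R := Real.log_pos (by linarith)
  have hlM : Real.log M = 10 * Real.log R := by rw [hMr, Real.log_pow]; norm_num
  refine ⟨∑ d ∈ Ioc 0 D, (μ d : ℝ) * (Real.log (y / d)) ^ 2 * q d, fun z hyz hz2 => ?_⟩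
  set I := Ioc ⌊y⌋₊ ⌊z⌋₊ with hI
  have hn_of : ∀ n ∈ I, 0 < n ∧ (n:ℝ) ≤ 2 * y := by
    intro n hn
    rw [hI, mem_Ioc] at hn
    have : (n:ℝ) ≤ z := (Nat.le_floor_iff (by linarith)).1 hn.2
    exact ⟨by omega, by linarith⟩
  have hmu : ∀ d : ℕ, |(μ d : ℝ)| ≤ 1 := fun d => by exact_mod_cast ArithmeticFunction.abs_moebius_le_one
  -- split
  have hsplit : ∑ n ∈ I, ν n * fy y n = ∑ n ∈ I, ν n * (∑ d ∈ n.divisors.filter (fun d => d ≤ D), (μ d : ℝ) * (Real.log (y / d)) ^ 2) +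
      ∑ n ∈ I, ν n * (∑ d ∈ n.divisors.filter (fun d => ¬ d ≤ D), (μ d : ℝ) * (Real.log (y / d)) ^ 2) := by
    rw [← sum_add_distrib]
    apply sum_congr rfl
    intro n _
    rw [← mul_add, sum_filter_add_sum_filter_not, fy]
  have hA : ∑ n ∈ I, ν n * (∑ d ∈ n.divisors.filter (fun d => d ≤ D), (μ d : ℝ) * (Real.log (y / d)) ^ 2) =
      ∑ d ∈ Ioc 0 D, (μ d : ℝ) * (Real.log (y / d)) ^ 2 * ∑ n ∈ I.filter (fun n => d ∣ n), ν n := by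
    have e : ∀ n ∈ I, ν n * (∑ d ∈ n.divisors.filter (fun d => d ≤ D), (μ d : ℝ) * (Real.log (y / d)) ^ 2) =
        ∑ d ∈ Ioc 0 D, if d ∣ n then (μ d : ℝ) * (Real.log (y / d)) ^ 2 * ν n else 0 := by
      intro n hn
      have e1 : n.divisors.filter (fun d => d ≤ D) = (Ioc 0 D).filter (fun d => d ∣ n) := by
        ext d
        simp only [mem_filter, Nat.mem_divisors, mem_Ioc]
        constructor
        · rintro ⟨⟨a, b⟩, c⟩; exact ⟨⟨Nat.pos_of_dvd_of_pos a (hn_of n hn).1, c⟩, a⟩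
        · rintro ⟨⟨a, b⟩, c⟩; exact ⟨⟨c, (hn_of n hn).1.ne'⟩, b⟩
      rw [e1, ← sum_filter, mul_sum]
      apply sum_congr rfl; intros; ring
    rw [sum_congr rfl e, sum_comm]
    apply sum_congr rfl
    intro d _
    rw [mul_sum, ← sum_filter]
  have hA2 : |∑ d ∈ Ioc 0 D, (μ d : ℝ) * (Real.log (y / d)) ^ 2 * ∑ n ∈ I.filter (fun n => d ∣ n), ν n -
      (z - y) * ∑ d ∈ Ioc 0 D, (μ d : ℝ) * (Real.log (y / d)) ^ 2 * q d| ≤ 2 * y / (R:ℝ) ^ 8 * (Real.log y) ^ 2 := by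
    rw [mul_sum, ← sum_sub_distrib]
    calc _ ≤ ∑ d ∈ Ioc 0 D, (Real.log y) ^ 2 * (R:ℝ) ^ 2 := by
          refine (abs_sum_le_sum_abs _ _).trans (sum_le_sum fun d hdm => ?_)
          rw [mem_Ioc] at hdm
          have := hd d hdm.1 y z (by linarith) hyz
          have e : (μ d : ℝ) * (Real.log (y / d)) ^ 2 * ∑ n ∈ I.filter (fun n => d ∣ n), ν n - (z - y) * ((μ d : ℝ) * (Real.log (y / d)) ^ 2 * q d)
            = (μ d : ℝ) * (Real.log (y / d)) ^ 2 * (∑ n ∈ I.filter (fun n => d ∣ n), ν n - (z - y) * q d) := by ring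
          have hd1 : (1:ℝ) ≤ d := by exact_mod_cast hdm.1
          have hdy : (d:ℝ) ≤ y := le_trans (by exact_mod_cast hdm.2) hDy'
          have hl0 : 0 ≤ Real.log (y / d) := Real.log_nonneg (by rw [le_div_iff₀ (by linarith)]; linarith)
          have hl1 : Real.log (y / d) ≤ Real.log y := Real.log_le_log (by positivity) (div_le_self (by linarith) hd1)
          rw [e, abs_mul, abs_mul, abs_of_nonneg (sq_nonneg (Real.log (y / d)))]
          calc _ ≤ 1 * (Real.log y) ^ 2 * (R:ℝ) ^ 2 := by
                gcongr
                exact hmu d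
            _ = _ := by ring
      _ = D * ((Real.log y) ^ 2 * (R:ℝ) ^ 2) := by simp
      _ ≤ (2 * y / M) * ((Real.log y) ^ 2 * (R:ℝ) ^ 2) := by gcongr
      _ = _ := by rw [hMr]; field_simp
  have hB : |∑ n ∈ I, ν n * (∑ d ∈ n.divisors.filter (fun d => ¬ d ≤ D), (μ d : ℝ) * (Real.log (y / d)) ^ 2)| ≤
      1100 * C * (z - y) * Real.log R + 200 * (R:ℝ) ^ 12 * (Real.log R) ^ 2 := by
    have hb1 : ∀ n ∈ I, |ν n * (∑ d ∈ n.divisors.filter (fun d => ¬ d ≤ D), (μ d : ℝ) * (Real.log (y / d)) ^ 2)| ≤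
        (Real.log M) ^ 2 * ∑ m ∈ Icc 1 (2 * M), if m ∣ n then ν n else 0 := by
      intro n hn
      obtain ⟨hn0, hn2⟩ := hn_of n hn
      have c1 : |∑ d ∈ n.divisors.filter (fun d => ¬ d ≤ D), (μ d : ℝ) * (Real.log (y / d)) ^ 2| ≤
          (n.divisors.filter (fun d => ¬ d ≤ D)).card * (Real.log M) ^ 2 := by
        rw [← nsmul_eq_mul, ← sum_const]
        refine (abs_sum_le_sum_abs _ _).trans (sum_le_sum fun d hdm => ?_)
        simp only [mem_filter, Nat.mem_divisors, not_le] at hdm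
        have hdD : (D:ℝ) < d := by exact_mod_cast hdm.2
        have hdn : (d:ℝ) ≤ n := by exact_mod_cast Nat.le_of_dvd hn0 hdm.1.1
        have hd0 : (0:ℝ) < d := by linarith
        have u1 : y / d ≤ M := by
          rw [div_le_iff₀ hd0]
          have : y / M ≤ d := by linarith
          rw [div_le_iff₀ (by linarith)] at this; linarith
        have u2 : (M:ℝ)⁻¹ ≤ y / d := by
          have : (M:ℝ)⁻¹ ≤ 2⁻¹ := by gcongr
          refine this.trans ?_
          rw [le_div_iff₀ hd0]; linarith
        have l1 : Real.log (y / d) ≤ Real.log M := Real.log_le_log (by positivity) u1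
        have l2 : - Real.log M ≤ Real.log (y / d) := by
          rw [← Real.log_inv]; exact Real.log_le_log (by positivity) u2
        rw [abs_mul, abs_of_nonneg (sq_nonneg (Real.log (y / d)))]
        calc _ ≤ 1 * (Real.log M) ^ 2 :=
              mul_le_mul (hmu d) (sq_le_sq' l2 l1) (sq_nonneg _) zero_le_one
          _ = _ := one_mul _
      have c2 : (n.divisors.filter (fun d => ¬ d ≤ D)).card ≤ ((Icc 1 (2 * M)).filter (fun m => m ∣ n)).card := by
        apply card_le_card_of_injOn (fun d => n / d)
        · intro d hdm
          simp only [coe_filter, Set.mem_ofPred_eq, Nat.mem_divisors, not_le] at hdm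
          obtain ⟨⟨hdn, -⟩, hdD⟩ := hdm
          simp only [coe_filter, Set.mem_ofPred_eq, mem_Icc]
          have hd0 : 0 < d := by omega
          refine ⟨⟨Nat.div_pos (Nat.le_of_dvd hn0 hdn) hd0, ?_⟩, Nat.div_dvd_of_dvd hdn⟩
          have hdD' : (D:ℝ) < d := by exact_mod_cast hdD
          have : ((n / d : ℕ):ℝ) ≤ 2 * M := by
            rw [Nat.cast_div hdn (by exact_mod_cast hd0.ne'), div_le_iff₀ (by exact_mod_cast hd0)]
            have : y / M ≤ d := by linarith
            rw [div_le_iff₀ (by linarith)] at this; nlinarith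
          exact_mod_cast this
        · intro d hdm e hem hde
          simp only [coe_filter, Set.mem_ofPred_eq, Nat.mem_divisors] at hdm hem
          simp only at hde
          have a := Nat.div_mul_cancel hdm.1.1
          have b := Nat.div_mul_cancel hem.1.1
          rw [hde] at a
          have : 0 < n / e := Nat.div_pos (Nat.le_of_dvd hn0 hem.1.1) (Nat.pos_of_dvd_of_pos hem.1.1 hn0)
          exact Nat.eq_of_mul_eq_mul_left this (a.trans b.symm)
      rw [abs_mul, abs_of_nonneg (hν0 n), ← sum_filter, sum_const, nsmul_eq_mul]
      calc _ ≤ ν n * (((Icc 1 (2 * M)).filter (fun m => m ∣ n)).card * (Real.log M) ^ 2) := by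
            apply mul_le_mul_of_nonneg_left _ (hν0 n)
            refine c1.trans ?_
            gcongr
        _ = _ := by ring
    have hlog2M : Real.log ((2 * M : ℕ):ℝ) ≤ 11 * Real.log R := by
      push_cast
      rw [Real.log_mul (by norm_num) (by linarith), hlM]
      have := Real.log_le_log (by norm_num) hR'
      linarith
    have hRM : R ≤ 2 * M := by
      have : R ≤ R ^ 10 := Nat.le_self_pow (by norm_num) R
      omega
    have hq := hM (2 * M) hRM
    calc _ ≤ ∑ n ∈ I, (Real.log M) ^ 2 * ∑ m ∈ Icc 1 (2 * M), (if m ∣ n then ν n else 0) :=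
          (abs_sum_le_sum_abs _ _).trans (sum_le_sum hb1)
      _ = (Real.log M) ^ 2 * ∑ m ∈ Icc 1 (2 * M), ∑ n ∈ I.filter (fun n => m ∣ n), ν n := by
          rw [← mul_sum, sum_comm]
          simp only [sum_filter]
      _ ≤ (Real.log M) ^ 2 * ∑ m ∈ Icc 1 (2 * M), ((z - y) * q m + (R:ℝ) ^ 2) := by
          gcongr with m hm
          have := (abs_le.1 (hd m (mem_Icc.1 hm).1 y z (by linarith) hyz)).2
          linarith
      _ = (Real.log M) ^ 2 * ((z - y) * ∑ m ∈ Icc 1 (2 * M), q m + 2 * M * (R:ℝ) ^ 2) := by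
          rw [sum_add_distrib, ← mul_sum]; simp
      _ ≤ (Real.log M) ^ 2 * ((z - y) * (C * (11 * Real.log R) / (Real.log R) ^ 2) + 2 * M * (R:ℝ) ^ 2) := by
          have hz0 : 0 ≤ z - y := by linarith
          gcongr
          refine hq.trans ?_
          gcongr
      _ = _ := by rw [hlM, hMr]; field_simp; ring
  rw [hsplit, hA]
  have e : ∀ a b c : ℝ, a + b - c = (a - c) + b := by intros; ring
  rw [e]
  refine (abs_add_le _ _).trans ?_
  linarith
end HH

end

section
open Finset
open scoped ArithmeticFunction.vonMangoldt ArithmeticFunction.Moebius ArithmeticFunction.zeta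
namespace HH
local notation "ψ" => Chebyshev.psi

noncomputable def Bd (R a : ℕ) : ℝ := if a.minFac ≤ R then Λ a else 0

theorem Bd_nonneg (R a : ℕ) : 0 ≤ Bd R a := by
  unfold Bd; split_ifs
  · exact ArithmeticFunction.vonMangoldt_nonneg
  · exact le_rfl

theorem bdsum (R X : ℕ) (w : ℕ → ℝ) (hw : ∀ a, 0 ≤ w a) :
    ∑ a ∈ Ioc 0 X, Bd R a * w a ≤ ∑ p ∈ (R + 1).primesBelow, ∑ k ∈ range (Nat.log 2 X), Real.log p * w (p ^ (k + 1)) := by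
  have h : ∀ a ∈ Ioc 0 X, Bd R a * w a ≤ ∑ p ∈ (R + 1).primesBelow, ∑ k ∈ range (Nat.log 2 X), 
      if p ^ (k + 1) = a then Real.log p * w (p ^ (k + 1)) else 0 := by
    intro a ha
    rw [mem_Ioc] at ha
    have hnn : ∀ p ∈ (R + 1).primesBelow, ∀ k ∈ range (Nat.log 2 X), 0 ≤ if p ^ (k + 1) = a then Real.log p * w (p ^ (k + 1)) else 0 := by
      intro p hp k _
      split_ifs
      · exact mul_nonneg (Real.log_natCast_nonneg p) (hw _)
      · exact le_rfl
    have hnn2 : ∀ p ∈ (R + 1).primesBelow, 0 ≤ ∑ k ∈ range (Nat.log 2 X), if p ^ (k + 1) = a then Real.log p * w (p ^ (k + 1)) else 0 :=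
      fun p hp => sum_nonneg (hnn p hp)
    by_cases hb : a.minFac ≤ R ∧ IsPrimePow a
    · obtain ⟨hm, hpp⟩ := hb
      have hΛ : Λ a = Real.log a.minFac := by rw [ArithmeticFunction.vonMangoldt_apply, if_pos hpp]
      obtain ⟨p, k, hp, hk, rfl⟩ := hpp
      have hp' : p.Prime := hp.nat_prime
      rw [hp'.pow_minFac hk.ne'] at hm hΛ
      obtain ⟨j, rfl⟩ : ∃ j, k = j + 1 := ⟨k - 1, by omega⟩
      have hpm : p ∈ (R + 1).primesBelow := by rw [Nat.mem_primesBelow]; exact ⟨by omega, hp'⟩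
      have hjm : j ∈ range (Nat.log 2 X) := by
        rw [mem_range]
        have : 2 ^ (j + 1) ≤ X := le_trans (Nat.pow_le_pow_left hp'.two_le _) ha.2
        have := Nat.le_log_of_pow_le (by norm_num) this
        omega
      have a1 := single_le_sum (hnn2) hpm
      have a2 := single_le_sum (hnn p hpm) hjm
      rw [if_pos rfl] at a2
      have : Bd R (p ^ (j + 1)) = Real.log p := by
        rw [Bd, hp'.pow_minFac hk.ne', if_pos hm, hΛ]
      rw [this]
      exact a2.trans a1
    · have : Bd R a = 0 := by
        rw [Bd]
        split_ifs with h
        · rw [ArithmeticFunction.vonMangoldt_apply, if_neg (fun h' => hb ⟨h, h'⟩)]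
        · rfl
      rw [this, zero_mul]
      exact sum_nonneg hnn2
  refine (sum_le_sum h).trans ?_
  rw [sum_comm]
  apply sum_le_sum
  intro p hp
  rw [sum_comm]
  apply sum_le_sum
  intro k _
  have : 0 ≤ Real.log p * w (p ^ (k + 1)) := mul_nonneg (Real.log_natCast_nonneg p) (hw _)
  rw [sum_ite_eq]
  split_ifs
  · exact le_rfl
  · exact this

theorem geom_le (x : ℝ) (hx0 : 0 ≤ x) (hx : x ≤ 1 / 2) (K : ℕ) : ∑ k ∈ range K, x ^ (k + 1) ≤ 2 * x := by
  have : ∑ k ∈ range K, x ^ (k + 1) + 2 * x ^ (K + 1) ≤ 2 * x := by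
    induction K with
    | zero => simp
    | succ K ih =>
      rw [sum_range_succ]
      have : 0 ≤ x ^ (K + 1) := by positivity
      have e : x ^ (K + 1 + 1) = x ^ (K + 1) * x := pow_succ _ _
      nlinarith
  have h2 : 0 ≤ x ^ (K + 1) := by positivity
  linarith

theorem bd1 (R X : ℕ) (hR : 2 ≤ R) (hX : 1 ≤ X) : ∑ a ∈ Ioc 0 X, Bd R a ≤ 2 * (R:ℝ) ^ 2 * Real.log X := by
  have h := bdsum R X (fun _ => 1) (fun _ => zero_le_one)
  simp only [mul_one, sum_const, card_range, nsmul_eq_mul] at h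
  refine h.trans ?_
  have hlog : ((Nat.log 2 X : ℕ) : ℝ) ≤ 2 * Real.log X := by
    have : (2:ℝ) ^ Nat.log 2 X ≤ X := by exact_mod_cast Nat.pow_log_le_self 2 (by omega)
    have := Real.log_le_log (by positivity) this
    rw [Real.log_pow] at this
    have l2 := Real.log_two_gt_d9
    have : (0:ℝ) ≤ (Nat.log 2 X : ℕ) := by positivity
    nlinarith
  have hc : (((R + 1).primesBelow).card : ℝ) ≤ R := by
    have : ((R + 1).primesBelow).card ≤ (Ioc 0 R).card := by
      apply card_le_card
      intro p hp
      have := Nat.lt_of_mem_primesBelow hp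
      have := (Nat.prime_of_mem_primesBelow hp).pos
      simp; omega
    rw [Nat.card_Ioc] at this
    exact_mod_cast this
  have hlX : 0 ≤ Real.log X := Real.log_natCast_nonneg X
  calc _ ≤ ∑ p ∈ (R + 1).primesBelow, (2 * Real.log X) * R := by
        apply sum_le_sum
        intro p hp
        have h1 : (p:ℝ) ≤ R := by exact_mod_cast Nat.lt_succ_iff.1 (Nat.lt_of_mem_primesBelow hp)
        have hp0 : (0:ℝ) < p := by exact_mod_cast (Nat.prime_of_mem_primesBelow hp).pos
        have : Real.log p ≤ R := by linarith [Real.log_le_sub_one_of_pos hp0]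
        gcongr
    _ = ((R + 1).primesBelow).card * ((2 * Real.log X) * R) := by rw [sum_const, nsmul_eq_mul]
    _ ≤ R * ((2 * Real.log X) * R) := by gcongr
    _ = _ := by ring

theorem bd2 (R X : ℕ) (hR : 2 ≤ R) : ∑ a ∈ Ioc 0 X, Bd R a * (1 / (a:ℝ)) ≤ 2 * (Real.log R + 8) := by
  have h := bdsum R X (fun a => 1 / (a:ℝ)) (fun _ => by positivity)
  refine h.trans ?_
  have hmert : ∑ p ∈ (R + 1).primesBelow, Real.log p / p ≤ Real.log R + 8 := by
    have := (abs_le.1 (mertens_nat R (by omega))).2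
    have h : ∑ p ∈ (R + 1).primesBelow, Real.log p / p ≤ ∑ n ∈ Ioc 0 R, Λ n / n := by
      have e : ∑ p ∈ (R + 1).primesBelow, Real.log p / p = ∑ p ∈ (R + 1).primesBelow, Λ p / p := by
        apply sum_congr rfl
        intro p hp
        rw [ArithmeticFunction.vonMangoldt_apply_prime (Nat.prime_of_mem_primesBelow hp)]
      rw [e]
      apply sum_le_sum_of_subset_of_nonneg
      · intro p hp
        have := Nat.lt_of_mem_primesBelow hp
        have := (Nat.prime_of_mem_primesBelow hp).pos
        simp; omega
      · intro n _ _
        exact div_nonneg ArithmeticFunction.vonMangoldt_nonneg (by positivity)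
    linarith
  calc _ ≤ ∑ p ∈ (R + 1).primesBelow, 2 * (Real.log p / p) := by
        apply sum_le_sum
        intro p hp
        have hp2 : (2:ℝ) ≤ p := by exact_mod_cast (Nat.prime_of_mem_primesBelow hp).two_le
        rw [← mul_sum]
        have e : ∀ k : ℕ, 1 / ((p ^ (k + 1) : ℕ) : ℝ) = (1 / (p:ℝ)) ^ (k + 1) := by
          intro k; push_cast; rw [div_pow, one_pow]
        simp only [e]
        have := geom_le (1 / (p:ℝ)) (by positivity) (by gcongr) (Nat.log 2 X)
        have hl : 0 ≤ Real.log p := Real.log_natCast_nonneg p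
        calc _ ≤ Real.log p * (2 * (1 / (p:ℝ))) := by gcongr
          _ = _ := by ring
    _ = 2 * ∑ p ∈ (R + 1).primesBelow, Real.log p / p := by rw [mul_sum]
    _ ≤ _ := by gcongr

theorem card_pp {n : ℕ} (h : Λ n ≠ 0) : n.primeFactors.card ≤ 1 := by
  rw [ArithmeticFunction.vonMangoldt_ne_zero_iff] at h
  obtain ⟨p, k, hp, hk, rfl⟩ := h
  rw [Nat.primeFactors_prime_pow hk.ne' hp.nat_prime]; simp

theorem card_LL {n : ℕ} (h : LL n ≠ 0) : n.primeFactors.card ≤ 2 := by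
  obtain ⟨p, hp, hne⟩ := exists_ne_zero_of_sum_ne_zero h
  rw [Nat.mem_divisorsAntidiagonal] at hp
  have a := card_pp (left_ne_zero_of_mul hne)
  have b := card_pp (right_ne_zero_of_mul hne)
  have h1 : p.1 ≠ 0 := by intro h; apply hp.2; rw [← hp.1]; simp [h]
  have h2 : p.2 ≠ 0 := by intro h; apply hp.2; rw [← hp.1]; simp [h]
  rw [← hp.1, Nat.primeFactors_mul h1 h2]
  exact (card_union_le _ _).trans (by omega)

theorem LL_nonneg (n : ℕ) : 0 ≤ LL n := sum_nonneg fun _ _ => mul_nonneg ArithmeticFunction.vonMangoldt_nonneg ArithmeticFunction.vonMangoldt_nonneg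

theorem LL_bad (R n : ℕ) : (if n.minFac ≤ R then LL n else 0) ≤ 2 * ∑ p ∈ n.divisorsAntidiagonal, Bd R p.1 * Λ p.2 := by
  have hnn : ∀ p ∈ n.divisorsAntidiagonal, 0 ≤ Bd R p.1 * Λ p.2 := fun p _ => mul_nonneg (Bd_nonneg _ _) ArithmeticFunction.vonMangoldt_nonneg
  split_ifs with h
  · have hsw : ∑ p ∈ n.divisorsAntidiagonal, Bd R p.1 * Λ p.2 = ∑ p ∈ n.divisorsAntidiagonal, Bd R p.2 * Λ p.1 := by
      refine sum_nbij' Prod.swap Prod.swap ?_ ?_ (fun _ _ => rfl) (fun _ _ => rfl) (fun _ _ => rfl)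
      · intro p hp; simpa [mul_comm] using hp
      · intro p hp; simpa [mul_comm] using hp
    rw [two_mul]
    nth_rewrite 2 [hsw]
    rw [← sum_add_distrib, LL]
    apply sum_le_sum
    intro p hp
    rw [Nat.mem_divisorsAntidiagonal] at hp
    have l1 : 0 ≤ Λ p.1 := ArithmeticFunction.vonMangoldt_nonneg
    have l2 : 0 ≤ Λ p.2 := ArithmeticFunction.vonMangoldt_nonneg
    by_cases hn1 : n = 1
    · have : p.1 = 1 := by
        have := hp.1; rw [hn1] at this; exact Nat.eq_one_of_mul_eq_one_right this
      simp [this]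
      exact mul_nonneg (Bd_nonneg _ _) (by simp)
    have hpr := Nat.minFac_prime hn1
    have hdv : n.minFac ∣ p.1 * p.2 := hp.1 ▸ Nat.minFac_dvd n
    rcases (hpr.dvd_mul).1 hdv with h1 | h1
    · have : p.1.minFac ≤ R := (Nat.minFac_le_of_dvd hpr.two_le h1).trans h
      have e : Bd R p.1 = Λ p.1 := by rw [Bd, if_pos this]
      rw [e]
      linarith [mul_nonneg (Bd_nonneg R p.2) l1]
    · have : p.2.minFac ≤ R := (Nat.minFac_le_of_dvd hpr.two_le h1).trans h
      have e : Bd R p.2 = Λ p.2 := by rw [Bd, if_pos this]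
      rw [e]
      linarith [mul_nonneg (Bd_nonneg R p.1) l2]
  · exact mul_nonneg (by norm_num) (sum_nonneg hnn)

theorem S2 (C0 : ℝ) (hC0 : 1 ≤ C0) (hBT : ∀ y : ℝ, 1 ≤ y → ∀ h : ℝ, √y ≤ h → h ≤ y → ψ (y + h) - ψ y ≤ C0 * h)
    (R : ℕ) (hR : 2 ≤ R) (ν : ℕ → ℝ) (hν0 : ∀ n, 0 ≤ ν n)
    (hν1 : ∀ n, 0 < n → (∀ p : ℕ, p.Prime → p ∣ n → R < p) → ν n = 1)
    (hν2 : ∀ n, 0 < n → n.primeFactors.card ≤ 2 → ν n ≤ 16)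
    (y : ℝ) (hy : 1 ≤ y) (h : ℝ) (hh0 : 0 < h) (hhy : h ≤ y) (hh : y * √y ≤ h ^ 2) :
    |∑ n ∈ Ioc ⌊y⌋₊ ⌊y + h⌋₊, ν n * fy y n - ((ψ (y + h) - ψ y) * Real.log y + ∑ n ∈ Ioc ⌊y⌋₊ ⌊y + h⌋₊, LL n)| ≤
      16 * (C0 * h + 2 * (R:ℝ) ^ 2 * Real.log (2 * y) * Real.log y + 
        2 * (C0 * h * (2 * (Real.log R + 8)) + 12 * √y * (2 * (R:ℝ) ^ 2 * Real.log (2 * y)))) := by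
  set I := Ioc ⌊y⌋₊ ⌊y + h⌋₊ with hI
  have hly : 0 ≤ Real.log y := Real.log_nonneg hy
  have hsy1 : 1 ≤ √y := Real.one_le_sqrt.2 hy
  have hsy : √y * √y = y := Real.mul_self_sqrt (by linarith)
  have hfl1 : 1 ≤ ⌊y⌋₊ := Nat.le_floor (by exact_mod_cast hy)
  have hflz : 1 ≤ ⌊y + h⌋₊ := Nat.le_floor (by push_cast; linarith)
  have hlz : Real.log ⌊y + h⌋₊ ≤ Real.log (2 * y) := 
    Real.log_le_log (by exact_mod_cast hflz) ((Nat.floor_le (by linarith)).trans (by linarith))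
  have hbd1 : ∑ a ∈ Ioc 0 ⌊y + h⌋₊, Bd R a ≤ 2 * (R:ℝ) ^ 2 * Real.log (2 * y) :=
    (bd1 R _ hR hflz).trans (by gcongr)
  have hpsi0 : ψ (y + h) - ψ y ≤ C0 * h := by
    apply hBT y hy h _ hhy
    have : 0 < √y := by linarith
    by_contra hc
    push Not at hc
    have : h ^ 2 < √y ^ 2 := by gcongr
    nlinarith
  -- pointwise
  have hpt : ∀ n ∈ I, |ν n * fy y n - (Λ n * Real.log y + LL n)| ≤ 
      16 * (Λ n + Bd R n * Real.log y + if n.minFac ≤ R then LL n else 0) := by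
    intro n hn
    rw [hI, mem_Ioc] at hn
    have hn1 : 1 < n := by omega
    have hnz : (n:ℝ) ≤ y + h := (Nat.le_floor_iff (by linarith)).1 hn.2
    have hny : y < n := (Nat.floor_lt (by linarith)).1 hn.1
    have hL : 0 ≤ Λ n := ArithmeticFunction.vonMangoldt_nonneg
    have hLL := LL_nonneg n
    have hlg0 : 0 ≤ Real.log (n / y) := Real.log_nonneg (by rw [le_div_iff₀ (by linarith)]; linarith)
    have hlg1 : Real.log (n / y) ≤ 1 := by
      have : Real.log (n / y) ≤ n / y - 1 := Real.log_le_sub_one_of_pos (by positivity)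
      have : n / y ≤ 2 := by rw [div_le_iff₀ (by linarith)]; linarith
      linarith
    rw [fy_eq y (by linarith) n hn1]
    by_cases hz : Λ n = 0 ∧ LL n = 0
    · rw [hz.1, hz.2]
      have := mul_nonneg (Bd_nonneg R n) hly
      simp
      exact this
    have hcard : n.primeFactors.card ≤ 2 := by
      by_cases h1 : Λ n = 0
      · exact card_LL (fun h2 => hz ⟨h1, h2⟩)
      · exact (card_pp h1).trans (by norm_num)
    have hν16 := hν2 n (by omega) hcard
    have hνn := hν0 n
    have e : ν n * (Λ n * Real.log y + LL n - Λ n * Real.log (n / y)) - (Λ n * Real.log y + LL n) =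
        (ν n - 1) * (Λ n * Real.log y + LL n) - ν n * Λ n * Real.log (n / y) := by ring
    rw [e]
    have t1 : 0 ≤ ν n * Λ n * Real.log (n / y) := by positivity
    have t2 : ν n * Λ n * Real.log (n / y) ≤ 16 * Λ n * 1 := by gcongr
    by_cases hm : n.minFac ≤ R
    · rw [if_pos hm, Bd, if_pos hm]
      have t3 : 0 ≤ Λ n * Real.log y + LL n := by positivity
      rw [abs_le]
      constructor <;> nlinarith
    · have hνe : ν n = 1 := by
        apply hν1 n (by omega)
        intro p hp hpn
        have := Nat.minFac_le_of_dvd hp.two_le hpn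
        omega
      rw [if_neg hm, Bd, if_neg hm]
      rw [hνe] at t1 t2 ⊢
      rw [abs_le]; constructor <;> nlinarith
  have hsum : ∑ n ∈ I, ν n * fy y n - ((ψ (y + h) - ψ y) * Real.log y + ∑ n ∈ I, LL n) = 
      ∑ n ∈ I, (ν n * fy y n - (Λ n * Real.log y + LL n)) := by
    rw [psi_sub _ _ (by linarith), sum_sub_distrib, sum_add_distrib, sum_mul]
  rw [hsum]
  have hQ : ∑ n ∈ I, (if n.minFac ≤ R then LL n else 0) ≤ 
      2 * (C0 * h * (2 * (Real.log R + 8)) + 12 * √y * (2 * (R:ℝ) ^ 2 * Real.log (2 * y))) := by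
    calc _ ≤ ∑ n ∈ I, 2 * ∑ p ∈ n.divisorsAntidiagonal, Bd R p.1 * Λ p.2 := sum_le_sum fun n _ => LL_bad R n
      _ = 2 * ∑ a ∈ Ioc 0 ⌊y + h⌋₊, Bd R a * (ψ ((y + h) / a) - ψ (y / a)) := by
        rw [← mul_sum, hI, hypF (Bd R) y (y + h) (by linarith) (by linarith) _ le_rfl]
      _ ≤ 2 * ∑ a ∈ Ioc 0 ⌊y + h⌋₊, (C0 * h * (Bd R a * (1 / (a:ℝ))) + 12 * √y * Bd R a) := by
        gcongr with a ha
        rw [mem_Ioc] at ha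
        have hb := Bd_nonneg R a
        have ha1 : (1:ℝ) ≤ a := by exact_mod_cast ha.1
        have ha0 : (0:ℝ) < a := by linarith
        have key : ψ ((y + h) / a) - ψ (y / a) ≤ C0 * h * (1 / (a:ℝ)) + 12 * √y := by
          by_cases has : (a:ℝ) ≤ √y
          · have : ψ (y / a + h / a) - ψ (y / a) ≤ C0 * (h / a) := by
              apply hBT
              · rw [le_div_iff₀ ha0]; nlinarith
              · rw [Real.sqrt_le_left (by positivity), div_pow, div_le_div_iff₀ ha0 (by positivity)]
                have : y * a ≤ h ^ 2 := le_trans (by gcongr) hh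
                nlinarith
              · gcongr
            rw [add_div]
            have e : C0 * h * (1 / (a:ℝ)) = C0 * (h / a) := by ring
            rw [e]; linarith
          · push Not at has
            have h1 := psi_le6 (x := (y + h) / a) (by positivity)
            have h2 := Chebyshev.psi_nonneg (y / a)
            have h3 : (y + h) / a ≤ 2 * √y := by
              rw [div_le_iff₀ ha0]; nlinarith
            have : 0 ≤ C0 * h * (1 / (a:ℝ)) := by positivity
            linarith
        calc _ ≤ Bd R a * (C0 * h * (1 / (a:ℝ)) + 12 * √y) := by gcongr
          _ = _ := by ring
      _ = 2 * (C0 * h * ∑ a ∈ Ioc 0 ⌊y + h⌋₊, (Bd R a * (1 / (a:ℝ))) + 12 * √y * ∑ a ∈ Ioc 0 ⌊y + h⌋₊, Bd R a) := by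
        rw [sum_add_distrib, ← mul_sum, ← mul_sum]
      _ ≤ _ := by
        gcongr
        exact bd2 R _ hR
  calc _ ≤ ∑ n ∈ I, 16 * (Λ n + Bd R n * Real.log y + if n.minFac ≤ R then LL n else 0) :=
        (abs_sum_le_sum_abs _ _).trans (sum_le_sum hpt)
    _ = 16 * (∑ n ∈ I, Λ n + (∑ n ∈ I, Bd R n) * Real.log y + ∑ n ∈ I, (if n.minFac ≤ R then LL n else 0)) := by
        rw [← mul_sum, sum_add_distrib, sum_add_distrib, sum_mul]
    _ ≤ _ := by
        gcongr
        · rw [← psi_sub _ _ (by linarith)]; exact hpsi0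
        · refine le_trans (sum_le_sum_of_subset_of_nonneg ?_ (fun i _ _ => Bd_nonneg R i)) hbd1
          intro n; simp [hI]; omega
end HH

end

section
open Finset
open scoped ArithmeticFunction.vonMangoldt ArithmeticFunction.Moebius ArithmeticFunction.zeta
namespace HH
local notation "ψ" => Chebyshev.psi

noncomputable def EE (y h : ℝ) : ℝ := (ψ (y + h) - ψ y) * Real.log y + ∑ n ∈ Ioc ⌊y⌋₊ ⌊y + h⌋₊, LL n

theorem EEbase (y : ℝ) (hy : 1 ≤ y) : |EE y y - 2 * y * Real.log y| ≤ 400 * y := by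
  have s1 := selberg hy
  have s2 := selberg (show 1 ≤ y + y by linarith)
  have e1 := hyp0 (fun a => Λ a) y (by linarith) _ le_rfl
  have e2 := hyp0 (fun a => Λ a) (y + y) (by linarith) _ le_rfl
  rw [← e1] at s1
  rw [← e2] at s2
  rw [EE, sum_Ioc_split _ (Nat.floor_le_floor (by linarith : y ≤ y + y))]
  unfold LL
  have hl : Real.log (y + y) = Real.log 2 + Real.log y := by
    rw [← two_mul, Real.log_mul (by norm_num) (by linarith)]
  rw [hl] at s2
  have p0 := Chebyshev.psi_nonneg (y + y)
  have p1 := psi_le6 (x := y + y) (by linarith)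
  have l1 := Real.log_two_gt_d9
  have l2 := Real.log_two_lt_d9
  have q0 : 0 ≤ ψ (y + y) * Real.log 2 := by positivity
  have q1 : ψ (y + y) * Real.log 2 ≤ 6 * (y + y) * 1 := by gcongr; linarith
  have q2 : 0 ≤ y * Real.log 2 := by positivity
  have q3 : y * Real.log 2 ≤ y * 1 := by gcongr; linarith
  rw [abs_le] at *
  constructor <;> nlinarith

set_option maxHeartbeats 1000000 in
theorem SSa : ∃ K : ℝ, 1 ≤ K ∧ ∀ R : ℕ, 2 ≤ R → ∀ y h : ℝ, (R:ℝ) ^ 10 ≤ y → 0 < h → h ≤ y → y * √y ≤ h ^ 2 → 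
    |EE y h - 2 * h * Real.log y| ≤ K * (h * (Real.log R + 1) + y / (R:ℝ) ^ 8 * (Real.log (2 * y)) ^ 2 +
      (R:ℝ) ^ 12 * √y * (Real.log (2 * y)) ^ 2) := by
  obtain ⟨C, hC, hN⟩ := lemN
  obtain ⟨C0, hC0, hBT⟩ := BT
  refine ⟨2200 * C + 3000 * C0 + 10000, by nlinarith, ?_⟩
  intro R hR y h hy hh0 hhy hh
  obtain ⟨ν, q, hν0, hν1, hν2, hq0, hd, hM⟩ := hN R hR
  have hR2 : (2:ℝ) ≤ R := by exact_mod_cast hR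
  have hy1024 : 1024 ≤ y := by
    have : (2:ℝ) ^ 10 ≤ (R:ℝ) ^ 10 := by gcongr
    norm_num at this; linarith
  have hRy : (R:ℝ) ≤ y := (le_self_pow₀ (by linarith) (by norm_num)).trans hy
  have hy1 : 1 ≤ y := by linarith
  have hsy1 : 1 ≤ √y := Real.one_le_sqrt.2 hy1
  have hsy : √y * √y = y := Real.mul_self_sqrt (by linarith)
  obtain ⟨C1, hC1⟩ := S1 C R hR ν q hν0 hd hM hC y hy
  have a1 := hC1 (y + h) (by linarith) (by linarith)
  have a2 := hC1 (y + y) (by linarith) (by linarith)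
  have b1 := S2 C0 hC0 hBT R hR ν hν0 hν1 hν2 y hy1 h hh0 hhy hh
  have b2 := S2 C0 hC0 hBT R hR ν hν0 hν1 hν2 y hy1 y (by linarith) le_rfl (by nlinarith)
  have c := EEbase y hy1
  rw [← EE] at b1 b2
  rw [add_sub_cancel_left] at a1 a2
  set SI := ∑ n ∈ Ioc ⌊y⌋₊ ⌊y + h⌋₊, ν n * fy y n
  set SJ := ∑ n ∈ Ioc ⌊y⌋₊ ⌊y + y⌋₊, ν n * fy y n
  set lR := Real.log R with hlR
  set ly := Real.log y with hly
  set L := Real.log (2 * y) with hL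
  have hlR0 : 0 ≤ lR := Real.log_nonneg (by linarith)
  have hly0 : 0 ≤ ly := Real.log_nonneg (by linarith)
  have hlyL : ly ≤ L := Real.log_le_log (by linarith) (by linarith)
  have hlRL : lR ≤ L := Real.log_le_log (by linarith) (by linarith)
  have hL1 : 1 ≤ L := by
    rw [hL, Real.le_log_iff_exp_le (by linarith)]
    linarith [Real.exp_one_lt_d9]
  set E1 := y / (R:ℝ) ^ 8 * L ^ 2 with hE1
  set E2 := (R:ℝ) ^ 12 * √y * L ^ 2 with hE2
  have hE10 : 0 ≤ E1 := by positivity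
  have hE20 : 0 ≤ E2 := by positivity
  have r0 : 2 * y / (R:ℝ) ^ 8 * ly ^ 2 ≤ 2 * E1 := by
    calc 2 * y / (R:ℝ) ^ 8 * ly ^ 2 ≤ 2 * y / (R:ℝ) ^ 8 * L ^ 2 := by gcongr
      _ = _ := by rw [hE1]; ring
  have r1 : 200 * (R:ℝ) ^ 12 * lR ^ 2 ≤ 200 * E2 := by
    calc 200 * (R:ℝ) ^ 12 * lR ^ 2 = 200 * ((R:ℝ) ^ 12 * 1 * lR ^ 2) := by ring
      _ ≤ 200 * ((R:ℝ) ^ 12 * √y * L ^ 2) := by gcongr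
  have r2 : 2 * (R:ℝ) ^ 2 * L * ly ≤ 2 * E2 := by
    calc 2 * (R:ℝ) ^ 2 * L * ly ≤ 2 * (R:ℝ) ^ 2 * L * L := by gcongr
      _ = 2 * ((R:ℝ) ^ 2 * 1 * L ^ 2) := by ring
      _ ≤ 2 * ((R:ℝ) ^ 12 * √y * L ^ 2) := by gcongr <;> first | linarith | norm_num
  have r3 : 12 * √y * (2 * (R:ℝ) ^ 2 * L) ≤ 24 * E2 := by
    calc 12 * √y * (2 * (R:ℝ) ^ 2 * L) = 24 * ((R:ℝ) ^ 2 * √y * (L * 1)) := by ring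
      _ ≤ 24 * ((R:ℝ) ^ 12 * √y * (L * L)) := by gcongr <;> first | linarith | norm_num
      _ = _ := by rw [hE2]; ring
  -- error bounds
  have A1 : |SI - h * C1| ≤ 1100 * C * h * lR + (2 * E1 + 200 * E2) := a1.trans (by linarith)
  have A2 : |SJ - y * C1| ≤ 1100 * C * y * lR + (2 * E1 + 200 * E2) := a2.trans (by linarith)
  have B1 : |SI - EE y h| ≤ 16 * (C0 * h + 4 * C0 * h * (lR + 8) + 50 * E2) := b1.trans (by linarith)
  have B2 : |SJ - EE y y| ≤ 16 * (C0 * y + 4 * C0 * y * (lR + 8) + 50 * E2) := b2.trans (by linarith)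
  have hhy1 : h / y ≤ 1 := by rw [div_le_one (by linarith)]; exact hhy
  have hhy0 : 0 ≤ h / y := by positivity
  have hhy2 : h / y * y = h := by field_simp
  -- scale by h / y
  have sc : ∀ X B : ℝ, |X| ≤ B → |h / y * X| ≤ h / y * B := fun X B hX => by
    rw [abs_mul, abs_of_nonneg hhy0]; gcongr
  have A2' : |h / y * (SJ - y * C1)| ≤ 1100 * C * h * lR + (2 * E1 + 200 * E2) := by
    refine (sc _ _ A2).trans ?_
    calc h / y * (1100 * C * y * lR + (2 * E1 + 200 * E2)) = 1100 * C * (h / y * y) * lR + (h / y) * (2 * E1 + 200 * E2) := by ring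
      _ ≤ 1100 * C * h * lR + 1 * (2 * E1 + 200 * E2) := by rw [hhy2]; gcongr
      _ = _ := by ring
  have B2' : |h / y * (SJ - EE y y)| ≤ 16 * (C0 * h + 4 * C0 * h * (lR + 8) + 50 * E2) := by
    refine (sc _ _ B2).trans ?_
    calc h / y * (16 * (C0 * y + 4 * C0 * y * (lR + 8) + 50 * E2)) = 16 * (C0 * (h / y * y) + 4 * C0 * (h / y * y) * (lR + 8) + (h / y) * (50 * E2)) := by ring
      _ ≤ 16 * (C0 * h + 4 * C0 * h * (lR + 8) + 1 * (50 * E2)) := by rw [hhy2]; gcongr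
      _ = _ := by ring
  have c' : |h / y * (EE y y - 2 * y * ly)| ≤ 400 * h := by
    refine (sc _ _ c).trans ?_
    rw [show h / y * (400 * y) = 400 * (h / y * y) by ring, hhy2]
  have id : EE y h - 2 * h * ly = -(SI - EE y h) + (SI - h * C1) - h / y * (SJ - y * C1) + h / y * (SJ - EE y y) + h / y * (EE y y - 2 * y * ly) := by
    have w1 : h / y * (2 * y * ly) = 2 * h * ly := by rw [show h / y * (2 * y * ly) = 2 * (h / y * y) * ly by ring, hhy2]
    have : h / y * (y * C1) = h * C1 := by rw [← mul_assoc, hhy2]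
    linear_combination w1 - this
  have tot : |EE y h - 2 * h * ly| ≤ 2 * (1100 * C * h * lR + (2 * E1 + 200 * E2)) + 2 * (16 * (C0 * h + 4 * C0 * h * (lR + 8) + 50 * E2)) + 400 * h := by
    rw [id]
    rw [abs_le] at A1 A2' B1 B2' c' ⊢
    constructor <;> linarith [A1.1, A1.2, A2'.1, A2'.2, B1.1, B1.2, B2'.1, B2'.2, c'.1, c'.2]
  refine tot.trans ?_
  have z1 : 0 ≤ C * h * lR := by positivity
  have z2 : 0 ≤ C0 * h * lR := by positivity
  have z3 : 0 ≤ C0 * h := by positivity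
  have z4 : 0 ≤ C * h := by positivity
  have z5 : 0 ≤ h * lR := by positivity
  have z6 : 0 ≤ C * E1 := by positivity
  have z7 : 0 ≤ C * E2 := by positivity
  have z8 : 0 ≤ C0 * E1 := by positivity
  have z9 : 0 ≤ C0 * E2 := by positivity
  linarith

theorem SS (δ : ℝ) (hδ : 0 < δ) : ∃ ε : ℝ, 0 < ε ∧ ε ≤ 7 / 40 ∧ ∃ Y0 : ℝ, 1 ≤ Y0 ∧ ∀ y, Y0 ≤ y → ∀ h, y ^ (1 - ε) ≤ h → h ≤ y → 
    |EE y h - 2 * h * Real.log y| ≤ δ * h * Real.log y := by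
  obtain ⟨K, hK, hSS⟩ := SSa
  set ε := min (1 / 40) (δ / (2 * K)) with hε
  have hε0 : 0 < ε := by positivity
  have hε1 : ε ≤ 1 / 40 := min_le_left _ _
  have hε2 : K * ε ≤ δ / 2 := by
    calc K * ε ≤ K * (δ / (2 * K)) := by gcongr; exact min_le_right _ _
      _ = δ / 2 := by field_simp
  have ev1 : ∀ᶠ y : ℝ in Filter.atTop, Real.log y ≤ (1 / 40) * y ^ (ε / 2) := by
    have := (isLittleO_log_rpow_atTop (show 0 < ε / 2 by positivity)).bound (show (0:ℝ) < 1 / 40 by norm_num)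
    filter_upwards [this, Filter.eventually_ge_atTop (1:ℝ)] with y hy hy1
    rw [Real.norm_of_nonneg (Real.log_nonneg hy1), Real.norm_of_nonneg (by positivity)] at hy
    exact hy
  have ev2 : ∀ᶠ y : ℝ in Filter.atTop, 2 ≤ y ^ ε := (tendsto_rpow_atTop hε0).eventually_ge_atTop 2
  have ev3 : ∀ᶠ y : ℝ in Filter.atTop, 4 * K / δ ≤ Real.log y := Real.tendsto_log_atTop.eventually_ge_atTop _
  obtain ⟨Y0, hY0⟩ := Filter.eventually_atTop.1 ((ev1.and ev2).and ev3)
  refine ⟨7 * ε, by positivity, by linarith, max Y0 2, le_max_of_le_right (by norm_num), ?_⟩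
  intro y hy h hhl hhy
  obtain ⟨⟨h1, h2⟩, h3⟩ := hY0 y (le_of_max_le_left hy)
  have hy2 : 2 ≤ y := le_of_max_le_right hy
  have hy0 : 0 < y := by linarith
  set u := y ^ ε with hu
  have hu0 : 0 < u := by positivity
  set R := ⌊u⌋₊ with hR
  have hRu : (R:ℝ) ≤ u := Nat.floor_le hu0.le
  have hRl : u / 2 ≤ R := by
    have := Nat.lt_floor_add_one u
    have : (1:ℝ) ≤ R := by exact_mod_cast Nat.le_floor (by push_cast; linarith)
    linarith
  have hR2 : 2 ≤ R := Nat.le_floor (by exact_mod_cast h2)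
  have hR0 : (0:ℝ) < R := by linarith
  have hun : ∀ n : ℕ, u ^ n = y ^ (ε * n) := fun n => by
    rw [hu, ← Real.rpow_natCast, ← Real.rpow_mul hy0.le]
  have hmono : ∀ a b : ℝ, a ≤ b → y ^ a ≤ y ^ b := fun a b hab => Real.rpow_le_rpow_of_exponent_le (by linarith) hab
  have hh0 : 0 < h := lt_of_lt_of_le (by positivity) hhl
  have hL2 : (Real.log (2 * y)) ^ 2 ≤ u / 400 := by
    have : Real.log (2 * y) ≤ 2 * Real.log y := by
      rw [Real.log_mul (by norm_num) hy0.ne']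
      have := Real.log_le_log (by norm_num) hy2
      linarith
    have : Real.log (2 * y) ≤ (1 / 20) * y ^ (ε / 2) := by linarith
    have h0 : 0 ≤ Real.log (2 * y) := Real.log_nonneg (by linarith)
    have e : y ^ (ε / 2) * y ^ (ε / 2) = u := by rw [← Real.rpow_add hy0, hu]; congr 1; ring
    have : (Real.log (2 * y)) ^ 2 ≤ ((1 / 20) * y ^ (ε / 2)) ^ 2 := by gcongr
    nlinarith
  have hlow : y / u ^ 7 ≤ h := by
    refine le_trans (le_of_eq ?_) hhl
    rw [hun, Real.rpow_sub hy0, Real.rpow_one]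
    congr 2; push_cast; ring
  have key := hSS R hR2 y h ?_ hh0 hhy ?_
  · have hlR : Real.log R ≤ ε * Real.log y := by
      rw [← Real.log_rpow hy0]; exact Real.log_le_log hR0 hRu
    have t1 : y / (R:ℝ) ^ 8 * (Real.log (2 * y)) ^ 2 ≤ 256 / 400 * h := by
      calc y / (R:ℝ) ^ 8 * (Real.log (2 * y)) ^ 2 ≤ y / (u / 2) ^ 8 * (u / 400) := by gcongr
        _ = 256 / 400 * (y / u ^ 7) := by field_simp; norm_num
        _ ≤ _ := by gcongr
    have t2 : (R:ℝ) ^ 12 * √y * (Real.log (2 * y)) ^ 2 ≤ 1 / 400 * h := by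
      calc (R:ℝ) ^ 12 * √y * (Real.log (2 * y)) ^ 2 ≤ u ^ 12 * √y * (u / 400) := by gcongr
        _ = 1 / 400 * (u ^ 13 * √y) := by ring
        _ ≤ 1 / 400 * h := by
          gcongr
          refine le_trans ?_ hhl
          rw [hun, Real.sqrt_eq_rpow, ← Real.rpow_add hy0]
          apply hmono; push_cast; linarith
    refine key.trans ?_
    have hly : 4 * K ≤ Real.log y * δ := by rwa [div_le_iff₀ hδ] at h3
    have hly0 : 0 ≤ Real.log y := Real.log_nonneg (by linarith)
    calc _ ≤ K * (h * (ε * Real.log y + 1) + 256 / 400 * h + 1 / 400 * h) := by gcongr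
      _ ≤ h * ((K * ε) * Real.log y + 2 * K) := by nlinarith
      _ ≤ h * ((δ / 2) * Real.log y + Real.log y * δ / 2) := by gcongr; linarith
      _ = _ := by ring
  · calc (R:ℝ) ^ 10 ≤ u ^ 10 := by gcongr
      _ = y ^ (ε * (10:ℕ)) := hun 10
      _ ≤ y ^ (1:ℝ) := hmono _ _ (by push_cast; linarith)
      _ = y := Real.rpow_one y
  · calc y * √y = y ^ (3 / 2 : ℝ) := by
          rw [Real.sqrt_eq_rpow]; nth_rewrite 1 [← Real.rpow_one y]; rw [← Real.rpow_add hy0]; norm_num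
      _ ≤ y ^ ((1 - 7 * ε) * (2:ℕ)) := hmono _ _ (by push_cast; linarith)
      _ = (y ^ (1 - 7 * ε)) ^ 2 := by rw [Real.rpow_mul hy0.le, Real.rpow_natCast]
      _ ≤ h ^ 2 := by gcongr

/-- two-fold Brun-Titchmarsh in short intervals -/
theorem BT2 (δ : ℝ) (hδ : 0 < δ) : ∃ ε : ℝ, 0 < ε ∧ ε ≤ 7 / 40 ∧ ∃ Y0 : ℝ, 1 ≤ Y0 ∧ ∀ y, Y0 ≤ y → ∀ h, y ^ (1 - ε) ≤ h → h ≤ y → 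
    |EE y h - 2 * h * Real.log y| ≤ δ * h * Real.log y ∧ ψ (y + h) - ψ y ≤ (2 + δ) * h := by
  obtain ⟨ε, h1, h2, Y0, h3, h4⟩ := SS δ hδ
  refine ⟨ε, h1, h2, max Y0 2, le_max_of_le_left h3, fun y hy h hl hu => ?_⟩
  have k := h4 y (le_of_max_le_left hy) h hl hu
  refine ⟨k, ?_⟩
  have hy2 : 2 ≤ y := le_of_max_le_right hy
  have hl : 0 < Real.log y := Real.log_pos (by linarith)
  have hE := (abs_le.1 k).2
  rw [EE] at hE
  have : 0 ≤ ∑ n ∈ Ioc ⌊y⌋₊ ⌊y + h⌋₊, LL n := sum_nonneg fun n _ => LL_nonneg n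
  have : (ψ (y + h) - ψ y) * Real.log y ≤ ((2 + δ) * h) * Real.log y := by nlinarith
  exact le_of_mul_le_mul_right this hl
end HH

end

section
namespace HH
open Finset

/-- combinatorial lemma -/
theorem disc_aux (a b q : ℝ) (ha : |a| ≤ 1) (hb : |b| ≤ 1) (hq : |q| ≤ 1) :
    1 - a * b ≤ 2 * (1 + a * q) + 2 * (1 + b * q) := by
  rw [abs_le] at ha hb hq
  have h1 : 0 ≤ (1 - a) * (1 - b) := mul_nonneg (by linarith) (by linarith)
  have h2 : 0 ≤ (1 + a) * (1 + b) := mul_nonneg (by linarith) (by linarith)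
  -- affine in q
  have e1 : 0 ≤ 3 + 2 * (a + b) + a * b := by nlinarith
  have e2 : 0 ≤ 3 - 2 * (a + b) + a * b := by nlinarith
  have h3 : 0 ≤ (1 + q) * (3 + 2 * (a + b) + a * b) := mul_nonneg (by linarith) e1
  have h4 : 0 ≤ (1 - q) * (3 - 2 * (a + b) + a * b) := mul_nonneg (by linarith) e2
  nlinarith

theorem disc (N : ℕ) (hN : 1000 ≤ N) (δ : ℝ) (hδ0 : 0 < δ) (hδ : δ ≤ 1 / 200) (f g : ℕ → ℝ)
    (hf : ∀ j, |f j| ≤ 1) (hg : ∀ j, |g j| ≤ 1)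
    (hrel : ∀ j ≤ N, |(j : ℝ) * f j + ∑ i ∈ range (j + 1), g i * f (j - i)| ≤ δ * N)
    (hend : f N ≤ -1 + δ)
    (hsum : |∑ j ∈ range (N + 1), f j| ≤ δ * N)
    (halt : |∑ j ∈ range (N + 1), (-1 : ℝ) ^ j * f j| ≤ δ * N) : False := by
  have hNr : (1000 : ℝ) ≤ N := by exact_mod_cast hN
  -- step 1
  have h1 : (N : ℝ) * (1 - 2 * δ) ≤ ∑ i ∈ range (N + 1), g i * f (N - i) := by
    have := (abs_le.1 (hrel N le_rfl)).1
    nlinarith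
  have h1b : ∑ i ∈ range (N + 1), g i * f (N - i) ≤ ∑ j ∈ range (N + 1), |f j| := by
    rw [← Finset.sum_range_reflect (fun j => |f j|)]
    apply sum_le_sum
    intro i hi
    simp only [Nat.add_sub_cancel]
    calc g i * f (N - i) ≤ |g i * f (N - i)| := le_abs_self _
      _ = |g i| * |f (N - i)| := abs_mul _ _
      _ ≤ 1 * |f (N - i)| := by gcongr; exact hg i
      _ = |f (N + 1 - 1 - i)| := by simp
  have h1c : (N : ℝ) * (1 - 4 * δ) - 1 ≤ ∑ j ∈ range (N + 1), f j ^ 2 := by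
    have : ∑ j ∈ range (N + 1), (2 * |f j| - 1) ≤ ∑ j ∈ range (N + 1), f j ^ 2 := by
      apply sum_le_sum
      intro j _
      rw [← sq_abs (f j)]
      nlinarith [sq_nonneg (|f j| - 1)]
    rw [sum_sub_distrib, ← mul_sum] at this
    simp at this
    nlinarith
  have hfsq : ∀ j, f j ^ 2 ≤ 1 := fun j => by rw [← sq_abs]; nlinarith [hf j, abs_nonneg (f j)]
  -- step 2
  have gauss : ∑ j ∈ range (N + 1), (j : ℝ) = N * (N + 1) / 2 := by
    clear * -
    induction N with
    | zero => simp
    | succ n ih => rw [sum_range_succ, ih]; push_cast; ring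
  have h2a : (N : ℝ) * (N + 1) / 2 - N * (4 * δ * N + 2) ≤ ∑ j ∈ range (N + 1), (j : ℝ) * f j ^ 2 := by
    have : ∑ j ∈ range (N + 1), (j : ℝ) * (1 - f j ^ 2) ≤ ∑ j ∈ range (N + 1), (N : ℝ) * (1 - f j ^ 2) := by
      apply sum_le_sum
      intro j hj
      have : (j : ℝ) ≤ N := by exact_mod_cast Nat.lt_succ_iff.1 (mem_range.1 hj)
      exact mul_le_mul_of_nonneg_right this (by linarith [hfsq j])
    rw [← mul_sum] at this
    simp only [mul_sub, mul_one, sum_sub_distrib] at this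
    rw [gauss] at this
    simp at this
    nlinarith
  set T : ℝ := 6 * δ * N ^ 2 + 3 * N + 1 with hT
  have h2 : ∑ j ∈ range (N + 1), ∑ i ∈ range (j + 1), (1 + f j * g i * f (j - i)) ≤ T := by
    have e : ∀ j ∈ range (N + 1), ∑ i ∈ range (j + 1), (1 + f j * g i * f (j - i))
        ≤ (j + 1) - j * f j ^ 2 + δ * N := by
      intro j hj
      have hj' : j ≤ N := Nat.lt_succ_iff.1 (mem_range.1 hj)
      rw [sum_add_distrib]
      simp only [mul_assoc, ← mul_sum]
      simp
      have hr := hrel j hj'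
      set S := ∑ i ∈ range (j + 1), g i * f (j - i)
      have : f j * (j * f j + S) ≤ δ * N := by
        calc f j * (j * f j + S) ≤ |f j * (j * f j + S)| := le_abs_self _
          _ = |f j| * |j * f j + S| := abs_mul _ _
          _ ≤ 1 * (δ * N) := by gcongr; exact hf j
          _ = _ := one_mul _
      nlinarith
    refine (sum_le_sum e).trans ?_
    simp only [sum_add_distrib, sum_sub_distrib, gauss]
    simp
    rw [hT]
    have hdd : δ * N ≤ δ * N ^ 2 := by
      have : (N:ℝ) ≤ N ^ 2 := by nlinarith
      gcongr
    nlinarith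
  -- nonneg
  have hnn : ∀ i j k, 0 ≤ 1 + f j * g i * f k := by
    intro i j k
    have : |f j * g i * f k| ≤ 1 := by
      rw [abs_mul, abs_mul]
      have := mul_le_mul (mul_le_mul (hf j) (hg i) (abs_nonneg _) (by norm_num)) (hf k) (abs_nonneg _) (by norm_num)
      simpa using this
    linarith [(abs_le.1 this).1]
  let P : Finset (ℕ × ℕ) := (range (N + 1) ×ˢ range (N + 1)).filter (fun p => p.1 ≤ p.2)
  have h2' : ∑ p ∈ P, (1 + f p.2 * g p.1 * f (p.2 - p.1)) ≤ T := by
    refine le_trans (le_of_eq ?_) h2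
    rw [sum_filter, sum_product_right]
    apply sum_congr rfl
    intro j hj
    rw [← sum_filter]
    apply sum_congr _ (fun _ _ => rfl)
    ext i
    simp at hj ⊢
    omega
  let D : Finset (ℕ × ℕ) := (range (N + 1) ×ˢ range (N + 1)).filter (fun p => p.1 + 2 * p.2 ≤ N)
  have hx : ∑ p ∈ D, (1 + f p.1 * (g p.2 * f (p.1 + p.2))) ≤ T := by
    refine le_trans ?_ h2'
    have : ∑ p ∈ D, (1 + f p.1 * (g p.2 * f (p.1 + p.2))) =
        ∑ p ∈ D.image (fun p => (p.2, p.1 + p.2)), (1 + f p.2 * g p.1 * f (p.2 - p.1)) := by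
      rw [sum_image]
      · apply sum_congr rfl
        intro p _
        simp
        ring
      · rintro ⟨a, b⟩ _ ⟨c, d⟩ _ h
        simp at h ⊢; omega
    rw [this]
    apply sum_le_sum_of_subset_of_nonneg
    · intro p hp
      simp only [D, P, mem_image, mem_filter, mem_product, mem_range, Prod.exists] at hp ⊢
      obtain ⟨a, b, h, rfl⟩ := hp
      simp; omega
    · intro p _ _; exact hnn _ _ _
  have hy : ∑ p ∈ D, (1 + f (p.1 + 2 * p.2) * (g p.2 * f (p.1 + p.2))) ≤ T := by
    refine le_trans ?_ h2'
    have : ∑ p ∈ D, (1 + f (p.1 + 2 * p.2) * (g p.2 * f (p.1 + p.2))) =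
        ∑ p ∈ D.image (fun p => (p.2, p.1 + 2 * p.2)), (1 + f p.2 * g p.1 * f (p.2 - p.1)) := by
      rw [sum_image]
      · apply sum_congr rfl
        intro p _
        have : p.1 + 2 * p.2 - p.2 = p.1 + p.2 := by omega
        simp only [this]
        ring
      · rintro ⟨a, b⟩ _ ⟨c, d⟩ _ h
        simp at h ⊢; omega
    rw [this]
    apply sum_le_sum_of_subset_of_nonneg
    · intro p hp
      simp only [D, P, mem_image, mem_filter, mem_product, mem_range, Prod.exists] at hp ⊢
      obtain ⟨a, b, h, rfl⟩ := hp
      simp; omega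
    · intro p _ _; exact hnn _ _ _
  have hD : ∑ p ∈ D, (1 - f p.1 * f (p.1 + 2 * p.2)) ≤ 4 * T := by
    have : ∑ p ∈ D, (1 - f p.1 * f (p.1 + 2 * p.2)) ≤
        ∑ p ∈ D, (2 * (1 + f p.1 * (g p.2 * f (p.1 + p.2))) +
          2 * (1 + f (p.1 + 2 * p.2) * (g p.2 * f (p.1 + p.2)))) := by
      apply sum_le_sum
      intro p _
      apply disc_aux _ _ _ (hf _) (hf _)
      rw [abs_mul]
      have := mul_le_mul (hg p.2) (hf (p.1 + p.2)) (abs_nonneg _) (by norm_num)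
      simpa using this
    rw [sum_add_distrib, ← mul_sum, ← mul_sum] at this
    linarith
  have hcard : (N : ℝ) ^ 2 / 4 ≤ ∑ p ∈ D, (1 : ℝ) := by
    -- count
    have : (N : ℝ) ^ 2 / 4 ≤ ∑ s ∈ range (N / 2 + 1), ((N : ℝ) - 2 * s + 1) := by
      have e : ∀ n : ℕ, ∑ s ∈ range (n + 1), ((N : ℝ) - 2 * s + 1) = (n + 1) * (N + 1 - n) := by
        intro n
        induction n with
        | zero => simp
        | succ n ih => rw [sum_range_succ, ih]; push_cast; ring
      rw [e]
      have h1 : ((N / 2 : ℕ) : ℝ) ≤ N / 2 := Nat.cast_div_le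
      have h2 : (N : ℝ) / 2 - 1 / 2 ≤ ((N / 2 : ℕ) : ℝ) := by
        have : N ≤ 2 * (N / 2) + 1 := by omega
        have : (N : ℝ) ≤ 2 * ((N / 2 : ℕ) : ℝ) + 1 := by exact_mod_cast this
        linarith
      nlinarith
    refine this.trans ?_
    have hsub : ((range (N / 2 + 1)).sigma (fun s => range (N - 2 * s + 1))).image (fun q => (q.2, q.1)) ⊆ D := by
      intro p hp
      simp only [D, mem_image, mem_sigma, mem_filter, mem_product, mem_range] at hp ⊢
      obtain ⟨⟨a, b⟩, h, rfl⟩ := hp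
      simp at h ⊢; omega
    refine le_trans ?_ (sum_le_sum_of_subset_of_nonneg hsub (fun _ _ _ => by norm_num))
    rw [sum_image, sum_sigma]
    · apply sum_le_sum
      intro s hs
      simp at hs ⊢
      rw [Nat.cast_sub (by omega)]
      push_cast; linarith
    · rintro ⟨a, b⟩ _ ⟨c, d⟩ _ h
      simp at h ⊢; tauto
  have h4 : ∑ p ∈ D, f p.1 * f (p.1 + 2 * p.2) ≤ (δ ^ 2 * N ^ 2 + N + 1) / 2 := by
    let Q : Finset (ℕ × ℕ) := (range (N + 1) ×ˢ range (N + 1)).filter (fun p => p.1 ≤ p.2 ∧ p.1 % 2 = p.2 % 2)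
    have e1 : ∑ p ∈ D, f p.1 * f (p.1 + 2 * p.2) = ∑ p ∈ Q, f p.1 * f p.2 := by
      have : Q = D.image (fun p => (p.1, p.1 + 2 * p.2)) := by
        ext ⟨a, b⟩
        simp only [D, Q, mem_image, mem_filter, mem_product, mem_range, Prod.exists, Prod.mk.injEq]
        constructor
        · intro h
          exact ⟨a, (b - a) / 2, by omega, rfl, by omega⟩
        · rintro ⟨c, d, h, rfl, rfl⟩
          omega
      rw [this, sum_image]
      rintro ⟨a, b⟩ _ ⟨c, d⟩ _ h
      simp at h ⊢; omega
    have e2 : 2 * ∑ p ∈ Q, f p.1 * f p.2 =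
        (∑ u ∈ range (N + 1), ∑ w ∈ range (N + 1), if u % 2 = w % 2 then f u * f w else 0)
          + ∑ u ∈ range (N + 1), f u ^ 2 := by
      have a1 : ∑ p ∈ Q, f p.1 * f p.2 = ∑ u ∈ range (N + 1), ∑ w ∈ range (N + 1),
          if u ≤ w ∧ u % 2 = w % 2 then f u * f w else 0 := by
        rw [sum_filter, sum_product]
      have a2 : ∑ p ∈ Q, f p.1 * f p.2 = ∑ u ∈ range (N + 1), ∑ w ∈ range (N + 1),
          if w ≤ u ∧ u % 2 = w % 2 then f u * f w else 0 := by
        rw [a1, sum_comm]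
        apply sum_congr rfl; intro u _; apply sum_congr rfl; intro w _
        simp only [mul_comm (f w), eq_comm (a := w % 2)]
      rw [two_mul]
      nth_rewrite 1 [a1]
      rw [a2, ← sum_add_distrib, ← sum_add_distrib]
      apply sum_congr rfl; intro u hu
      rw [← sum_add_distrib]
      have : f u ^ 2 = ∑ w ∈ range (N + 1), if u = w then f u * f w else 0 := by
        rw [sum_ite_eq, if_pos hu, sq]
      rw [this, ← sum_add_distrib]
      apply sum_congr rfl; intro w _
      rcases lt_trichotomy u w with h | h | h
      · simp [h.le, h.ne, not_le.2 h]
      · subst h; simp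
      · simp [h.le, h.ne', not_le.2 h]
    have e3 : (∑ u ∈ range (N + 1), ∑ w ∈ range (N + 1), if u % 2 = w % 2 then f u * f w else 0)
        = ((∑ j ∈ range (N + 1), f j) ^ 2 + (∑ j ∈ range (N + 1), (-1 : ℝ) ^ j * f j) ^ 2) / 2 := by
      rw [sq, sq, sum_mul_sum, sum_mul_sum, ← sum_add_distrib, sum_div]
      apply sum_congr rfl; intro u _
      rw [← sum_add_distrib, sum_div]
      apply sum_congr rfl; intro w _
      rcases Nat.even_or_odd u with hu | hu <;> rcases Nat.even_or_odd w with hw | hw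
      · rw [if_pos (by rw [Nat.even_iff.1 hu, Nat.even_iff.1 hw]), hu.neg_one_pow, hw.neg_one_pow]; ring
      · rw [if_neg (by rw [Nat.even_iff.1 hu, Nat.odd_iff.1 hw]; norm_num), hu.neg_one_pow, hw.neg_one_pow]; ring
      · rw [if_neg (by rw [Nat.odd_iff.1 hu, Nat.even_iff.1 hw]; norm_num), hu.neg_one_pow, hw.neg_one_pow]; ring
      · rw [if_pos (by rw [Nat.odd_iff.1 hu, Nat.odd_iff.1 hw]), hu.neg_one_pow, hw.neg_one_pow]; ring
    have e4 : ∑ u ∈ range (N + 1), f u ^ 2 ≤ N + 1 := by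
      calc _ ≤ ∑ u ∈ range (N + 1), (1 : ℝ) := sum_le_sum (fun u _ => hfsq u)
        _ = _ := by simp
    have e5 : (∑ j ∈ range (N + 1), f j) ^ 2 ≤ (δ * N) ^ 2 := by
      rw [← sq_abs]; gcongr
    have e6 : (∑ j ∈ range (N + 1), (-1 : ℝ) ^ j * f j) ^ 2 ≤ (δ * N) ^ 2 := by
      rw [← sq_abs]; gcongr
    rw [e1]
    nlinarith
  rw [sum_sub_distrib] at hD
  have hδN : δ * N ^ 2 ≤ 1 / 200 * N ^ 2 := by gcongr
  have hδN2 : δ ^ 2 * N ^ 2 ≤ (1 / 200) ^ 2 * N ^ 2 := by gcongr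
  rw [hT] at hD
  nlinarith
end HH

end

section
open Finset
open scoped ArithmeticFunction.vonMangoldt ArithmeticFunction.Moebius ArithmeticFunction.zeta
namespace HH
local notation "ψ" => Chebyshev.psi

noncomputable def gE (τ : ℝ) (j : ℕ) : ℝ := Real.exp (j * τ)
noncomputable def gP (τ : ℝ) (j : ℕ) : ℝ := ψ (gE τ j)
noncomputable def gc (τ : ℝ) (K : ℕ) : ℝ := gE τ K - 1
noncomputable def gF (K : ℕ) (τ : ℝ) (j : ℕ) : ℝ := (gP τ (j + K) - gP τ j) / (gc τ K * gE τ j)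

theorem gE_pos (τ : ℝ) (j : ℕ) : 0 < gE τ j := Real.exp_pos _
theorem gE_add (τ : ℝ) (i j : ℕ) : gE τ (i + j) = gE τ i * gE τ j := by
  rw [gE, gE, gE, ← Real.exp_add]; push_cast; ring_nf
theorem gE_one_le {τ : ℝ} (hτ : 0 < τ) (j : ℕ) : 1 ≤ gE τ j := Real.one_le_exp (by positivity)
theorem gE_mono {τ : ℝ} (hτ : 0 < τ) {i j : ℕ} (h : i ≤ j) : gE τ i ≤ gE τ j := by
  apply Real.exp_le_exp.2; gcongr
theorem gP_mono {τ : ℝ} (hτ : 0 < τ) {i j : ℕ} (h : i ≤ j) : gP τ i ≤ gP τ j := Chebyshev.psi_mono (gE_mono hτ h)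
theorem gE_log (τ : ℝ) (j : ℕ) : Real.log (gE τ j) = j * τ := Real.log_exp _
theorem gc_pos {τ : ℝ} (hτ : 0 < τ) {K : ℕ} (hK : 1 ≤ K) : 0 < gc τ K := by
  rw [gc, gE, sub_pos]; apply Real.one_lt_exp_iff.2; positivity
theorem gc_ge {τ : ℝ} (K : ℕ) : K * τ ≤ gc τ K := by
  rw [gc, gE]; linarith [Real.add_one_le_exp (K * τ)]
theorem gF_nonneg {τ : ℝ} (hτ : 0 < τ) {K : ℕ} (hK : 1 ≤ K) (j : ℕ) : 0 ≤ gF K τ j :=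
  div_nonneg (sub_nonneg.2 (gP_mono hτ (by omega))) (mul_nonneg (gc_pos hτ hK).le (gE_pos _ _).le)
theorem gb_eq {τ : ℝ} (hτ : 0 < τ) (j : ℕ) : gP τ (j + 1) - gP τ j = gF 1 τ j * (gc τ 1 * gE τ j) := by
  rw [gF]
  have := gc_pos hτ (le_refl 1)
  have := gE_pos τ j
  field_simp
theorem gF_eq {τ : ℝ} (hτ : 0 < τ) {K : ℕ} (hK : 1 ≤ K) (j : ℕ) : gP τ (j + K) - gP τ j = gF K τ j * (gc τ K * gE τ j) := by
  rw [gF]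
  have := gc_pos hτ hK
  have := gE_pos τ j
  field_simp

theorem gF_avg {τ : ℝ} (hτ : 0 < τ) {K : ℕ} (hK : 1 ≤ K) : ∃ w : ℕ → ℝ, (∀ k, 0 ≤ w k) ∧ ∑ k ∈ range K, w k = 1 ∧ 
    ∀ j, gF K τ j = ∑ k ∈ range K, w k * gF 1 τ (j + k) := by
  have hc := gc_pos hτ hK
  have hc1 := gc_pos hτ (le_refl 1)
  refine ⟨fun k => gc τ 1 * gE τ k / gc τ K, fun k => by have := gE_pos τ k; positivity, ?_, ?_⟩
  · rw [← sum_div, div_eq_one_iff_eq hc.ne']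
    have : ∀ k ∈ range K, gc τ 1 * gE τ k = gE τ (k + 1) - gE τ k := by
      intro k _; rw [gE_add, gc]; ring
    rw [sum_congr rfl this, sum_range_sub, gc]
    simp [gE]
  · intro j
    have h1 : gP τ (j + K) - gP τ j = ∑ k ∈ range K, gF 1 τ (j + k) * (gc τ 1 * gE τ (j + k)) := by
      rw [← sum_congr rfl (fun k _ => gb_eq hτ (j + k))]
      have := sum_range_sub (fun k => gP τ (j + k)) K
      simp only [add_zero] at this
      rw [← this]; rfl
    have hE := gE_pos τ j
    rw [gF, h1, sum_div]
    apply sum_congr rfl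
    intro k _
    rw [gE_add]; field_simp

theorem gF_le {τ : ℝ} (hτ : 0 < τ) {K : ℕ} (hK : 1 ≤ K) {j0 : ℕ} {B : ℝ} (h : ∀ i, j0 ≤ i → gF 1 τ i ≤ B) (j : ℕ) (hj : j0 ≤ j) : gF K τ j ≤ B := by
  obtain ⟨w, hw0, hw1, hw⟩ := gF_avg hτ hK
  rw [hw]
  calc _ ≤ ∑ k ∈ range K, w k * B := by
        apply sum_le_sum
        intro k _
        exact mul_le_mul_of_nonneg_left (h _ (by omega)) (hw0 k)
    _ = B := by rw [← sum_mul, hw1, one_mul]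

theorem exp_bounds {τ : ℝ} (hτ : 0 < τ) (hτ1 : τ ≤ 1) : τ ≤ gc τ 1 ∧ gc τ 1 ≤ τ + τ ^ 2 ∧ τ - τ ^ 2 ≤ gc τ 1 / gE τ 1 := by
  have h1 := Real.abs_exp_sub_one_sub_id_le (x := τ) (by rw [abs_of_pos hτ]; exact hτ1)
  have h2 := Real.abs_exp_sub_one_sub_id_le (x := -τ) (by rw [abs_neg, abs_of_pos hτ]; exact hτ1)
  have e : gc τ 1 / gE τ 1 = 1 - Real.exp (-τ) := by
    rw [gc, sub_div, div_self (gE_pos _ _).ne', gE, Real.exp_neg]; simp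
  rw [e]
  have e2 : gc τ 1 = Real.exp τ - 1 := by rw [gc, gE]; simp
  rw [e2]
  rw [abs_le] at h1 h2
  refine ⟨by linarith [Real.add_one_le_exp τ], by linarith, by nlinarith⟩

theorem sum_blocks (u : ℕ → ℕ) (hu : Monotone u) (f : ℕ → ℝ) {A B : ℕ} (hAB : A ≤ B) :
    ∑ n ∈ Ioc (u A) (u B), f n = ∑ i ∈ Ico A B, ∑ n ∈ Ioc (u i) (u (i + 1)), f n := by
  induction B, hAB using Nat.le_induction with
  | base => simp
  | succ B hB ih =>
    rw [sum_Ico_succ_top hB, ← ih, sum_Ioc_consecutive f (hu hB) (hu (Nat.le_succ B))]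

theorem mono_floor {τ : ℝ} (hτ : 0 < τ) : Monotone (fun i => ⌊gE τ i⌋₊) := fun _ _ h => Nat.floor_le_floor (gE_mono hτ h)

theorem block_sum {τ : ℝ} (hτ : 0 < τ) (i : ℕ) : ∑ n ∈ Ioc ⌊gE τ i⌋₊ ⌊gE τ (i + 1)⌋₊, Λ n = gP τ (i + 1) - gP τ i := by
  rw [gP, gP, psi_sub _ _ (gE_mono hτ (Nat.le_succ i))]

theorem mert_sum {τ : ℝ} (hτ : 0 < τ) (hτ1 : τ ≤ 1) {A B : ℕ} (hAB : A ≤ B) (hG : ∀ i, A ≤ i → gF 1 τ i ≤ 3) :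
    |τ * ∑ i ∈ Ico A B, (gF 1 τ i - 1)| ≤ 16 + 3 * ((B:ℝ) - A) * τ ^ 2 := by
  obtain ⟨c1, c2, c3⟩ := exp_bounds hτ hτ1
  set S := ∑ i ∈ Ico A B, gF 1 τ i with hS
  have hS0 : 0 ≤ S := sum_nonneg fun i _ => gF_nonneg hτ le_rfl i
  have hS3 : S ≤ 3 * ((B:ℝ) - A) := by
    calc S ≤ ∑ i ∈ Ico A B, (3:ℝ) := sum_le_sum fun i hi => hG i (mem_Ico.1 hi).1
      _ = _ := by simp [Nat.cast_sub hAB]; ring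
  have hM : |∑ n ∈ Ioc ⌊gE τ A⌋₊ ⌊gE τ B⌋₊, Λ n / n - ((B:ℝ) - A) * τ| ≤ 16 := by
    have a1 := mertens (gE_one_le hτ A)
    have a2 := mertens (gE_one_le hτ B)
    rw [gE_log] at a1 a2
    rw [sum_Ioc_split _ (mono_floor hτ hAB)]
    rw [abs_le] at *
    constructor <;> linarith
  rw [sum_blocks _ (mono_floor hτ) _ hAB] at hM
  have hin : ∀ i, ∀ n ∈ Ioc ⌊gE τ i⌋₊ ⌊gE τ (i + 1)⌋₊, gE τ i < n ∧ (n:ℝ) ≤ gE τ (i + 1) := by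
    intro i n hn
    rw [mem_Ioc] at hn
    exact ⟨(Nat.floor_lt (gE_pos _ _).le).1 hn.1, (Nat.le_floor_iff (gE_pos _ _).le).1 hn.2⟩
  have up : ∑ i ∈ Ico A B, ∑ n ∈ Ioc ⌊gE τ i⌋₊ ⌊gE τ (i + 1)⌋₊, Λ n / n ≤ gc τ 1 * S := by
    rw [hS, mul_sum]
    apply sum_le_sum
    intro i _
    have hE := gE_pos τ i
    calc _ ≤ ∑ n ∈ Ioc ⌊gE τ i⌋₊ ⌊gE τ (i + 1)⌋₊, Λ n / gE τ i := by
          apply sum_le_sum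
          intro n hn
          exact div_le_div_of_nonneg_left ArithmeticFunction.vonMangoldt_nonneg hE (hin i n hn).1.le
      _ = _ := by rw [← sum_div, block_sum hτ, gb_eq hτ]; field_simp
  have lo : gc τ 1 / gE τ 1 * S ≤ ∑ i ∈ Ico A B, ∑ n ∈ Ioc ⌊gE τ i⌋₊ ⌊gE τ (i + 1)⌋₊, Λ n / n := by
    rw [hS, mul_sum]
    apply sum_le_sum
    intro i _
    have hE := gE_pos τ i
    have hE1 := gE_pos τ 1
    calc _ = ∑ n ∈ Ioc ⌊gE τ i⌋₊ ⌊gE τ (i + 1)⌋₊, Λ n / gE τ (i + 1) := by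
          rw [← sum_div, block_sum hτ, gb_eq hτ, gE_add]; field_simp
      _ ≤ _ := by
          apply sum_le_sum
          intro n hn
          exact div_le_div_of_nonneg_left ArithmeticFunction.vonMangoldt_nonneg (hE.trans (hin i n hn).1) (hin i n hn).2
  have e : ∑ i ∈ Ico A B, (gF 1 τ i - 1) = S - ((B:ℝ) - A) := by
    rw [sum_sub_distrib, hS]; simp [Nat.cast_sub hAB]
  rw [e]
  rw [abs_le] at hM ⊢
  have p1 : gc τ 1 * S ≤ (τ + τ ^ 2) * S := by gcongr
  have p2 : (τ - τ ^ 2) * S ≤ gc τ 1 / gE τ 1 * S := by gcongr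
  have p3 : τ ^ 2 * S ≤ τ ^ 2 * (3 * ((B:ℝ) - A)) := by gcongr
  constructor <;> nlinarith [hM.1, hM.2]

theorem mert_sumF {τ : ℝ} (hτ : 0 < τ) (hτ1 : τ ≤ 1) {K : ℕ} (hK : 1 ≤ K) {A B : ℕ} (hAB : A ≤ B) (hG : ∀ i, A ≤ i → gF 1 τ i ≤ 3) :
    |τ * ∑ i ∈ Ico A B, (gF K τ i - 1)| ≤ 16 + 3 * ((B:ℝ) - A) * τ ^ 2 := by
  obtain ⟨w, hw0, hw1, hw⟩ := gF_avg hτ hK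
  have e : τ * ∑ i ∈ Ico A B, (gF K τ i - 1) = ∑ k ∈ range K, w k * (τ * ∑ i ∈ Ico (A + k) (B + k), (gF 1 τ i - 1)) := by
    have : ∀ i ∈ Ico A B, gF K τ i - 1 = ∑ k ∈ range K, w k * (gF 1 τ (i + k) - 1) := by
      intro i _
      simp only [mul_sub, sum_sub_distrib, mul_one, hw1, hw]
    rw [sum_congr rfl this, sum_comm, mul_sum]
    apply sum_congr rfl
    intro k _
    rw [← mul_sum, ← sum_Ico_add' (fun i => gF 1 τ i - 1)]
    ring
  rw [e]
  calc _ ≤ ∑ k ∈ range K, w k * (16 + 3 * ((B:ℝ) - A) * τ ^ 2) := by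
        refine (abs_sum_le_sum_abs _ _).trans (sum_le_sum fun k _ => ?_)
        rw [abs_mul, abs_of_nonneg (hw0 k)]
        have := mert_sum hτ hτ1 (A := A + k) (B := B + k) (by omega) (fun i hi => hG i (by omega))
        push_cast at this
        rw [add_sub_add_right_eq_sub] at this
        exact mul_le_mul_of_nonneg_left this (hw0 k)
    _ = _ := by rw [← sum_mul, hw1, one_mul]

theorem gc_ratio {τ : ℝ} (hτ : 0 < τ) (K : ℕ) : K * gc τ 1 ≤ gc τ K := by
  have e : gc τ K = ∑ k ∈ range K, gc τ 1 * gE τ k := by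
    have : ∀ k ∈ range K, gc τ 1 * gE τ k = gE τ (k + 1) - gE τ k := by
      intro k _; rw [gE_add, gc]; ring
    rw [sum_congr rfl this, sum_range_sub, gc]
    simp [gE]
  rw [e]
  have hc := gc_pos hτ (le_refl 1)
  calc (K:ℝ) * gc τ 1 = ∑ k ∈ range K, gc τ 1 * 1 := by simp
    _ ≤ _ := by
      apply sum_le_sum
      intro k _
      have := gE_one_le hτ k
      gcongr

/-- one block is small with respect to K blocks -/
theorem block_small {τ : ℝ} (hτ : 0 < τ) {K : ℕ} (hK : 1 ≤ K) (hK2 : gE τ K ≤ 2) {j i : ℕ} (hi : gF 1 τ i ≤ 3) (hij : i ≤ j + K) :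
    gP τ (i + 1) - gP τ i ≤ 6 / K * (gc τ K * gE τ j) := by
  rw [gb_eq hτ]
  have hE : gE τ i ≤ 2 * gE τ j := by
    calc gE τ i ≤ gE τ (j + K) := gE_mono hτ hij
      _ = gE τ j * gE τ K := gE_add _ _ _
      _ ≤ gE τ j * 2 := by have := gE_pos τ j; gcongr
      _ = _ := by ring
  have hc := gc_pos hτ (le_refl 1)
  have hK0 : (0:ℝ) < K := by exact_mod_cast hK
  have hcK : gc τ 1 ≤ gc τ K / K := by rw [le_div_iff₀ hK0]; linarith [gc_ratio hτ K]
  have := gE_pos τ i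
  have := gE_pos τ j
  have := gc_pos hτ hK
  calc _ ≤ 3 * (gc τ K / K * (2 * gE τ j)) := by gcongr
    _ = _ := by ring

theorem slow {τ : ℝ} (hτ : 0 < τ) (hτ1 : τ ≤ 1) {K : ℕ} (hK : 1 ≤ K) (hK2 : gE τ K ≤ 2) {j0 : ℕ} (hG : ∀ i, j0 ≤ i → gF 1 τ i ≤ 3) (j : ℕ) (hj : j0 ≤ j) :
    |gF K τ j - gF K τ (j + 1)| ≤ 6 / K + 6 * τ := by
  have hc := gc_pos hτ hK
  have hE := gE_pos τ j
  have b1 := block_small hτ hK hK2 (j := j) (hG j hj) (by omega)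
  have b2 := block_small hτ hK hK2 (j := j) (hG (j + K) (by omega)) le_rfl
  have m1 := gP_mono hτ (Nat.le_succ j)
  have m2 := gP_mono hτ (Nat.le_succ (j + K))
  have f0 := gF_nonneg hτ hK (j + 1)
  have f3 := gF_le hτ hK hG (j + 1) (by omega)
  obtain ⟨c1, c2, c3⟩ := exp_bounds hτ hτ1
  have e1 := gF_eq hτ hK j
  have e2 := gF_eq hτ hK (j + 1)
  rw [gE_add, show gE τ 1 = gc τ 1 + 1 by rw [gc]; ring, show j + 1 + K = j + K + 1 by ring] at e2
  have hX : 0 < gc τ K * gE τ j := by positivity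
  have k1 : |(gF K τ j - gF K τ (j + 1) - gF K τ (j + 1) * gc τ 1) * (gc τ K * gE τ j)| ≤ 6 / K * (gc τ K * gE τ j) := by
    have : (gF K τ j - gF K τ (j + 1) - gF K τ (j + 1) * gc τ 1) * (gc τ K * gE τ j) = (gP τ (j + 1) - gP τ j) - (gP τ (j + K + 1) - gP τ (j + K)) := by
      linear_combination -e1 + e2
    rw [this, abs_le]
    simp only [Nat.succ_eq_add_one] at m1 m2
    constructor <;> linarith
  rw [abs_mul, abs_of_pos hX] at k1
  have k2 := le_of_mul_le_mul_right k1 hX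
  have k3 : gF K τ (j + 1) * gc τ 1 ≤ 6 * τ := by
    calc _ ≤ 3 * (τ + τ ^ 2) := by gcongr; exact (gc_pos hτ (le_refl 1)).le
      _ ≤ _ := by nlinarith
  have k4 : 0 ≤ gF K τ (j + 1) * gc τ 1 := mul_nonneg f0 (gc_pos hτ (le_refl 1)).le
  rw [abs_le] at *
  constructor <;> linarith
end HH

end

section
open Finset
open scoped ArithmeticFunction.vonMangoldt ArithmeticFunction.Moebius ArithmeticFunction.zeta
namespace HH
local notation "ψ" => Chebyshev.psi

theorem edge1 {C : ℝ} (hBT : ∀ y : ℝ, 1 ≤ y → ∀ h, √y ≤ h → h ≤ y → ψ (y + h) - ψ y ≤ C * h) (hC : 0 ≤ C)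
    {y h T : ℝ} (hh : 0 < h) (hT : 1 ≤ T) (hTy : T ≤ y) (hhy : h ≤ y) (hT2 : y * T ≤ h ^ 2) :
    ∑ a ∈ Ioc 0 ⌊T⌋₊, Λ a * (ψ ((y + h) / a) - ψ (y / a)) ≤ C * h * (Real.log T + 8) := by
  have hm := mertens hT
  rw [abs_le] at hm
  calc _ ≤ ∑ a ∈ Ioc 0 ⌊T⌋₊, Λ a * (C * (h / a)) := by
        apply sum_le_sum
        intro a ha
        rw [mem_Ioc] at ha
        have ha0 : (0:ℝ) < a := by exact_mod_cast ha.1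
        have haT : (a:ℝ) ≤ T := (Nat.le_floor_iff (by linarith)).1 ha.2
        apply mul_le_mul_of_nonneg_left _ ArithmeticFunction.vonMangoldt_nonneg
        rw [add_div]
        apply hBT
        · rw [le_div_iff₀ ha0]; linarith
        · rw [Real.sqrt_le_left (by positivity), div_pow, div_le_div_iff₀ ha0 (by positivity)]
          have : y * a ≤ h ^ 2 := le_trans (by gcongr; linarith) hT2
          nlinarith
        · gcongr
    _ = C * h * ∑ a ∈ Ioc 0 ⌊T⌋₊, Λ a / a := by
        rw [mul_sum]; apply sum_congr rfl; intro a _; ring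
    _ ≤ _ := by gcongr; linarith

theorem edges {C : ℝ} (hBT : ∀ y : ℝ, 1 ≤ y → ∀ h, √y ≤ h → h ≤ y → ψ (y + h) - ψ y ≤ C * h) (hC : 0 ≤ C)
    {y h T T' V : ℝ} (hh : 0 < h) (hT : 1 ≤ T) (hTT : T ≤ T') (hTV : T ≤ V) (hV : V ≤ y + h) (hVT : y + h ≤ V * T')
    (hTy : T' ≤ y) (hhy : h ≤ y) (hT2 : y * T' ≤ h ^ 2) :
    0 ≤ ∑ n ∈ Ioc ⌊y⌋₊ ⌊y + h⌋₊, LL n - ∑ a ∈ Ioc ⌊T⌋₊ ⌊V⌋₊, Λ a * (ψ ((y + h) / a) - ψ (y / a)) ∧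
    ∑ n ∈ Ioc ⌊y⌋₊ ⌊y + h⌋₊, LL n - ∑ a ∈ Ioc ⌊T⌋₊ ⌊V⌋₊, Λ a * (ψ ((y + h) / a) - ψ (y / a)) ≤ 2 * C * h * (Real.log T' + 8) := by
  have hy0 : 0 ≤ y := by linarith
  have hT'1 : 1 ≤ T' := by linarith
  have hV0 : 0 < V := by linarith
  have hD : ∀ a : ℕ, 0 ≤ Λ a * (ψ ((y + h) / a) - ψ (y / a)) := by
    intro a
    apply mul_nonneg ArithmeticFunction.vonMangoldt_nonneg
    rw [sub_nonneg]
    apply Chebyshev.psi_mono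
    gcongr; linarith
  have hz : y ≤ y + h := by linarith
  have f1 : ⌊T⌋₊ ≤ ⌊V⌋₊ := Nat.floor_le_floor hTV
  have f2 : ⌊V⌋₊ ≤ ⌊y + h⌋₊ := Nat.floor_le_floor hV
  have e := hypF (fun a => Λ a) y (y + h) hy0 hz _ le_rfl
  have eLL : ∑ n ∈ Ioc ⌊y⌋₊ ⌊y + h⌋₊, LL n = ∑ a ∈ Ioc 0 ⌊y + h⌋₊, Λ a * (ψ ((y + h) / a) - ψ (y / a)) := by
    rw [← e]; rfl
  have s1 := sum_Ioc_consecutive (fun a : ℕ => Λ a * (ψ ((y + h) / a) - ψ (y / a))) (Nat.zero_le ⌊T⌋₊) f1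
  have s2 := sum_Ioc_consecutive (fun a : ℕ => Λ a * (ψ ((y + h) / a) - ψ (y / a))) (Nat.zero_le ⌊V⌋₊) f2
  have l1 := edge1 hBT hC hh hT (hTT.trans hTy) hhy (le_trans (by gcongr) hT2)
  have l2 : C * h * (Real.log T + 8) ≤ C * h * (Real.log T' + 8) := by
    gcongr
  have l3 := edge1 hBT hC hh hT'1 hTy hhy hT2
  have hi : ∑ a ∈ Ioc ⌊V⌋₊ ⌊y + h⌋₊, Λ a * (ψ ((y + h) / a) - ψ (y / a)) ≤ ∑ a ∈ Ioc 0 ⌊T'⌋₊, Λ a * (ψ ((y + h) / a) - ψ (y / a)) := by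
    have e1 := hypF (fun a => if ⌊V⌋₊ < a then Λ a else 0) y (y + h) hy0 hz _ le_rfl
    have e2 := hypF (fun a => if a ≤ ⌊T'⌋₊ then Λ a else 0) y (y + h) hy0 hz _ le_rfl
    have g1 : ∑ a ∈ Ioc ⌊V⌋₊ ⌊y + h⌋₊, Λ a * (ψ ((y + h) / a) - ψ (y / a)) ≤ ∑ a ∈ Ioc 0 ⌊y + h⌋₊, (if ⌊V⌋₊ < a then Λ a else 0) * (ψ ((y + h) / a) - ψ (y / a)) := by
      rw [← sum_Ioc_consecutive _ (Nat.zero_le ⌊V⌋₊) f2]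
      have : ∑ a ∈ Ioc 0 ⌊V⌋₊, (if ⌊V⌋₊ < a then Λ a else 0) * (ψ ((y + h) / a) - ψ (y / a)) = 0 := by
        apply sum_eq_zero
        intro a ha
        rw [mem_Ioc] at ha
        rw [if_neg (by omega), zero_mul]
      rw [this, zero_add]
      apply le_of_eq
      apply sum_congr rfl
      intro a ha
      rw [mem_Ioc] at ha
      rw [if_pos ha.1]
    have g2 : ∑ a ∈ Ioc 0 ⌊y + h⌋₊, (if a ≤ ⌊T'⌋₊ then Λ a else 0) * (ψ ((y + h) / a) - ψ (y / a)) ≤ ∑ a ∈ Ioc 0 ⌊T'⌋₊, Λ a * (ψ ((y + h) / a) - ψ (y / a)) := by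
      simp only [ite_mul, zero_mul]
      rw [← sum_filter]
      apply sum_le_sum_of_subset_of_nonneg
      · intro a ha
        simp only [mem_filter, mem_Ioc] at ha ⊢
        exact ⟨ha.1.1, ha.2⟩
      · intro a _ _
        exact hD a
    refine g1.trans (le_trans ?_ g2)
    rw [← e1, ← e2]
    apply sum_le_sum
    intro n hn
    rw [mem_Ioc] at hn
    have hnz : (n:ℝ) ≤ y + h := (Nat.le_floor_iff (by linarith)).1 hn.2
    calc ∑ p ∈ n.divisorsAntidiagonal, (if ⌊V⌋₊ < p.1 then Λ p.1 else 0) * Λ p.2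
        ≤ ∑ p ∈ n.divisorsAntidiagonal, (if p.2 ≤ ⌊T'⌋₊ then Λ p.2 else 0) * Λ p.1 := by
          apply sum_le_sum
          intro p hp
          have hp' := Nat.mem_divisorsAntidiagonal.1 hp
          split_ifs with h1 h2 h2
          · rw [mul_comm]
          · exfalso
            apply h2
            apply Nat.le_floor
            have hv : V < p.1 := (Nat.floor_lt hV0.le).1 h1
            have hpn : (p.1:ℝ) * p.2 = n := by exact_mod_cast hp'.1
            by_contra hcon
            push Not at hcon
            have : V * T' < p.1 * p.2 := by
              apply mul_lt_mul'' hv hcon hV0.le (by linarith)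
            linarith
          · rw [zero_mul]; exact mul_nonneg ArithmeticFunction.vonMangoldt_nonneg ArithmeticFunction.vonMangoldt_nonneg
          · simp
      _ = _ := by
          refine sum_nbij' Prod.swap Prod.swap ?_ ?_ (fun _ _ => rfl) (fun _ _ => rfl) (fun _ _ => rfl)
          · intro p hp; simpa [mul_comm] using hp
          · intro p hp; simpa [mul_comm] using hp
  rw [eLL]
  have n1 : 0 ≤ ∑ a ∈ Ioc 0 ⌊T⌋₊, Λ a * (ψ ((y + h) / a) - ψ (y / a)) := sum_nonneg fun a _ => hD a
  have n2 : 0 ≤ ∑ a ∈ Ioc ⌊V⌋₊ ⌊y + h⌋₊, Λ a * (ψ ((y + h) / a) - ψ (y / a)) := sum_nonneg fun a _ => hD a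
  constructor <;> linarith

/-- middle part -/
theorem middle {τ : ℝ} (hτ : 0 < τ) {K : ℕ} (hK : 1 ≤ K) (hK2 : gE τ K ≤ 2) {j0 j : ℕ}
    (hG : ∀ i, j0 ≤ i → gF 1 τ i ≤ 3) (hj : 2 * j0 + 1 ≤ j) :
    |∑ a ∈ Ioc ⌊gE τ j0⌋₊ ⌊gE τ (j - j0 - 1)⌋₊, Λ a * (ψ (gE τ (j + K) / a) - ψ (gE τ j / a))
      - gc τ 1 * (gc τ K * gE τ j) * ∑ i ∈ Ico j0 (j - j0 - 1), gF 1 τ i * gF K τ (j - i)|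
      ≤ gc τ 1 * (gc τ K * gE τ j) * (18 / K) * (j:ℝ) := by
  have hc1 := gc_pos hτ (le_refl 1)
  have hcK := gc_pos hτ hK
  have hEj := gE_pos τ j
  have hK0 : (0:ℝ) < K := by exact_mod_cast hK
  rw [sum_blocks _ (mono_floor hτ) _ (by omega : j0 ≤ j - j0 - 1), mul_sum, ← sum_sub_distrib]
  refine (abs_sum_le_sum_abs _ _).trans ?_
  calc _ ≤ ∑ i ∈ Ico j0 (j - j0 - 1), gc τ 1 * (gc τ K * gE τ j) * (18 / K) := by
        apply sum_le_sum
        intro i hi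
        rw [mem_Ico] at hi
        set r := j - i with hr
        have hji : j = i + r := by omega
        have hEi := gE_pos τ i
        have hEr := gE_pos τ r
        have hsum := block_sum hτ i
        rw [gb_eq hτ] at hsum
        have key : gc τ 1 * (gc τ K * gE τ j) * (gF 1 τ i * gF K τ r) = ∑ n ∈ Ioc ⌊gE τ i⌋₊ ⌊gE τ (i + 1)⌋₊, Λ n * (gP τ (r + K) - gP τ r) := by
          rw [← sum_mul, hsum, gF_eq hτ hK, hji, gE_add]; ring
        rw [key, ← sum_sub_distrib]
        refine (abs_sum_le_sum_abs _ _).trans ?_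
        calc _ ≤ ∑ n ∈ Ioc ⌊gE τ i⌋₊ ⌊gE τ (i + 1)⌋₊, Λ n * (6 / K * (gc τ K * gE τ r)) := by
              apply sum_le_sum
              intro n hn
              rw [mem_Ioc] at hn
              have n1 : gE τ i < n := (Nat.floor_lt (gE_pos _ _).le).1 hn.1
              have n2 : (n:ℝ) ≤ gE τ (i + 1) := (Nat.le_floor_iff (gE_pos _ _).le).1 hn.2
              have n0 : (0:ℝ) < n := hEi.trans n1
              rw [← mul_sub, abs_mul, abs_of_nonneg ArithmeticFunction.vonMangoldt_nonneg]
              apply mul_le_mul_of_nonneg_left _ ArithmeticFunction.vonMangoldt_nonneg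
              have q1 : ψ (gE τ (j + K) / n) ≤ gP τ (r + K) := by
                apply Chebyshev.psi_mono
                rw [div_le_iff₀ n0, show j + K = (r + K) + i by omega, gE_add]
                have := gE_pos τ (r + K)
                gcongr
              have q2 : gP τ (r + K - 1) ≤ ψ (gE τ (j + K) / n) := by
                apply Chebyshev.psi_mono
                rw [le_div_iff₀ n0, show j + K = (r + K - 1) + (i + 1) by omega, gE_add]
                have := gE_pos τ (r + K - 1)
                gcongr
              have q3 : ψ (gE τ j / n) ≤ gP τ r := by
                apply Chebyshev.psi_mono
                rw [div_le_iff₀ n0, show j = r + i by omega, gE_add]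
                gcongr
              have q4 : gP τ (r - 1) ≤ ψ (gE τ j / n) := by
                apply Chebyshev.psi_mono
                rw [le_div_iff₀ n0, show j = (r - 1) + (i + 1) by omega, gE_add]
                have := gE_pos τ (r - 1)
                gcongr
              have b1 := block_small hτ hK hK2 (j := r) (i := r - 1) (hG _ (by omega)) (by omega)
              have b2 := block_small hτ hK hK2 (j := r) (i := r + K - 1) (hG _ (by omega)) (by omega)
              rw [show r - 1 + 1 = r by omega] at b1
              rw [show r + K - 1 + 1 = r + K by omega] at b2
              rw [abs_le]
              constructor <;> linarith
          _ = gF 1 τ i * (gc τ 1 * gE τ i) * (6 / K * (gc τ K * gE τ r)) := by rw [← sum_mul, hsum]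
          _ ≤ 3 * (gc τ 1 * gE τ i) * (6 / K * (gc τ K * gE τ r)) := by
              have := hG i hi.1
              gcongr
          _ = _ := by rw [hji, gE_add]; ring
    _ = ((j - j0 - 1 - j0 : ℕ):ℝ) * (gc τ 1 * (gc τ K * gE τ j) * (18 / K)) := by simp
    _ ≤ _ := by
        rw [mul_comm]
        have : ((j - j0 - 1 - j0 : ℕ):ℝ) ≤ j := by exact_mod_cast (by omega)
        gcongr
end HH

end

section
open Finset
open scoped ArithmeticFunction.vonMangoldt ArithmeticFunction.Moebius ArithmeticFunction.zeta
namespace HH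
local notation "ψ" => Chebyshev.psi

set_option maxHeartbeats 1000000 in
theorem rel {C : ℝ} (hBT : ∀ y : ℝ, 1 ≤ y → ∀ h, √y ≤ h → h ≤ y → ψ (y + h) - ψ y ≤ C * h) (hC : 0 ≤ C)
    {τ δ : ℝ} (hτ : 0 < τ) (hτ1 : τ ≤ 1) {K : ℕ} (hK : 1 ≤ K) (hK2 : gE τ K ≤ 2) {j0 j : ℕ}
    (hG : ∀ i, j0 ≤ i → gF 1 τ i ≤ 3) (hj : 2 * j0 + 1 + K ≤ j)
    (hEE : |EE (gE τ j) (gc τ K * gE τ j) - 2 * (gc τ K * gE τ j) * Real.log (gE τ j)| ≤ δ * (gc τ K * gE τ j) * Real.log (gE τ j))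
    (hsq : gE τ (j0 + K + 1) ≤ (gc τ K) ^ 2 * gE τ j) :
    τ * |(j:ℝ) * (gF K τ j - 1) + ∑ i ∈ Ico j0 (j - j0 - 1), (gF 1 τ i - 1) * (gF K τ (j - i) - 1)|
     ≤ δ * (j * τ) + 36 * τ * j / K + 2 * C * ((j0 + K + 1) * τ + 8) + 15 * j * τ ^ 2 + 32 + (2 * j0 + 1) * τ := by
  obtain ⟨c1, c2, c3⟩ := exp_bounds hτ hτ1
  have hc1 := gc_pos hτ (le_refl 1)
  have hcK := gc_pos hτ hK
  have hEj := gE_pos τ j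
  have hK0 : (0:ℝ) < K := by exact_mod_cast hK
  have hcK1 : gc τ K ≤ 1 := by rw [gc]; linarith
  set h := gc τ K * gE τ j with hh
  have hh0 : 0 < h := by positivity
  have hyh : gE τ j + h = gE τ (j + K) := by rw [hh, gE_add, gc]; ring
  have hed := edges hBT hC (y := gE τ j) (h := h) (T := gE τ j0) (T' := gE τ (j0 + K + 1)) (V := gE τ (j - j0 - 1))
    hh0 (gE_one_le hτ _) (gE_mono hτ (by omega)) (gE_mono hτ (by omega)) (by rw [hyh]; exact gE_mono hτ (by omega))
    (by rw [hyh, ← gE_add]; exact gE_mono hτ (by omega)) (gE_mono hτ (by omega)) (by rw [hh]; nlinarith)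
    (by rw [hh]; nlinarith)
  have hmid := middle hτ hK hK2 hG (by omega : 2 * j0 + 1 ≤ j)
  rw [EE, gE_log] at hEE
  rw [gE_log] at hed
  rw [hyh] at hed hEE
  rw [show ψ (gE τ (j + K)) - ψ (gE τ j) = gF K τ j * h from gF_eq hτ hK j] at hEE
  set S := ∑ n ∈ Ioc ⌊gE τ j⌋₊ ⌊gE τ (j + K)⌋₊, LL n
  set M := ∑ a ∈ Ioc ⌊gE τ j0⌋₊ ⌊gE τ (j - j0 - 1)⌋₊, Λ a * (ψ (gE τ (j + K) / a) - ψ (gE τ j / a))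
  set P := ∑ i ∈ Ico j0 (j - j0 - 1), gF 1 τ i * gF K τ (j - i) with hP
  set F := gF K τ j
  push_cast at hed
  -- divide by h
  have k1 : |F * (j * τ) + gc τ 1 * P - 2 * (j * τ)| ≤ δ * (j * τ) + gc τ 1 * (18 / K) * j + 2 * C * ((j0 + K + 1) * τ + 8) := by
    apply le_of_mul_le_mul_right _ hh0
    rw [← abs_of_pos hh0, ← abs_mul, abs_of_pos hh0]
    have : (F * (j * τ) + gc τ 1 * P - 2 * (j * τ)) * h = (F * h * (j * τ) + S - 2 * h * (j * τ)) - (S - M) - (M - gc τ 1 * h * P) := by ring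
    rw [this]
    rw [abs_le] at hEE hmid ⊢
    constructor <;> nlinarith [hEE.1, hEE.2, hmid.1, hmid.2, hed.1, hed.2]
  have hF3 := gF_le hτ hK hG
  have hcard : ((j - j0 - 1 - j0 : ℕ):ℝ) = (j:ℝ) - 2 * j0 - 1 := by
    rw [show j - j0 - 1 - j0 = j - (2 * j0 + 1) by omega, Nat.cast_sub (by omega)]; push_cast; ring
  have hP0 : 0 ≤ P := sum_nonneg fun i _ => mul_nonneg (gF_nonneg hτ le_rfl i) (gF_nonneg hτ hK _)
  have hP9 : P ≤ 9 * j := by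
    calc P ≤ ∑ i ∈ Ico j0 (j - j0 - 1), (9:ℝ) := by
          apply sum_le_sum
          intro i hi
          rw [mem_Ico] at hi
          have := hG i hi.1
          have := hF3 (j - i) (by omega)
          have := gF_nonneg hτ le_rfl i
          have := gF_nonneg hτ hK (j - i)
          nlinarith
      _ = 9 * ((j:ℝ) - 2 * j0 - 1) := by rw [← hcard]; simp; ring
      _ ≤ _ := by have : (0:ℝ) ≤ j0 := by positivity
                  linarith
  have m1 := mert_sum hτ hτ1 (A := j0) (B := j - j0 - 1) (by omega) hG
  have m2 := mert_sumF hτ hτ1 hK (A := j0 + 2) (B := j - j0 + 1) (by omega) (fun i hi => hG i (by omega))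
  have r2 : ∑ i ∈ Ico (j0 + 2) (j - j0 + 1), (gF K τ i - 1) = ∑ i ∈ Ico j0 (j - j0 - 1), (gF K τ (j - i) - 1) := by
    refine sum_nbij' (fun i => j - i) (fun i => j - i) ?_ ?_ ?_ ?_ ?_
    · intro i hi; rw [mem_Ico] at *; omega
    · intro i hi; rw [mem_Ico] at *; omega
    · intro i hi; rw [mem_Ico] at *; omega
    · intro i hi; rw [mem_Ico] at *; omega
    · intro i hi; rw [mem_Ico] at *; rw [show j - (j - i) = i by omega]
  rw [r2] at m2
  have eP : ∑ i ∈ Ico j0 (j - j0 - 1), (gF 1 τ i - 1) * (gF K τ (j - i) - 1) = P - ∑ i ∈ Ico j0 (j - j0 - 1), (gF 1 τ i - 1) - ∑ i ∈ Ico j0 (j - j0 - 1), (gF K τ (j - i) - 1) - ((j:ℝ) - 2 * j0 - 1) := by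
    rw [← hcard, hP, ← sum_sub_distrib, ← sum_sub_distrib]
    have : ((j - j0 - 1 - j0 : ℕ):ℝ) = ∑ i ∈ Ico j0 (j - j0 - 1), (1:ℝ) := by simp
    rw [this, ← sum_sub_distrib]
    apply sum_congr rfl
    intro i _; ring
  rw [eP]
  set X := ∑ i ∈ Ico j0 (j - j0 - 1), (gF 1 τ i - 1)
  set Y := ∑ i ∈ Ico j0 (j - j0 - 1), (gF K τ (j - i) - 1)
  rw [show ((j - j0 - 1 : ℕ):ℝ) = (j:ℝ) - j0 - 1 by rw [Nat.cast_sub (by omega), Nat.cast_sub (by omega)]; simp] at m1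
  rw [show ((j - j0 + 1 : ℕ):ℝ) = (j:ℝ) - j0 + 1 by rw [Nat.cast_add, Nat.cast_sub (by omega)]; simp] at m2
  push_cast at m2
  have hj00 : (0:ℝ) ≤ j0 := by positivity
  have hτ2 : 0 ≤ τ ^ 2 := by positivity
  have hb1 : ((j:ℝ) - j0 - 1 - j0) * τ ^ 2 ≤ j * τ ^ 2 := by gcongr; linarith
  have hb2 : ((j:ℝ) - j0 + 1 - (j0 + 2)) * τ ^ 2 ≤ j * τ ^ 2 := by gcongr; linarith
  rw [← abs_of_pos hτ, ← abs_mul, abs_of_pos hτ]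
  have q1 : gc τ 1 * (18 / K) * j ≤ 36 * τ * j / K := by
    have : gc τ 1 ≤ 2 * τ := by nlinarith
    calc _ ≤ 2 * τ * (18 / K) * j := by gcongr
      _ = _ := by ring
  have q2 : (gc τ 1 - τ) * P ≤ τ ^ 2 * (9 * j) := by
    gcongr
    linarith
  have q3 : 0 ≤ (gc τ 1 - τ) * P := mul_nonneg (by linarith) hP0
  have q4 : τ * (j * (F - 1) + (P - X - Y - (j - 2 * j0 - 1))) = (F * (j * τ) + gc τ 1 * P - 2 * (j * τ)) - (gc τ 1 - τ) * P - τ * X - τ * Y + (2 * j0 + 1) * τ := by ring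
  rw [q4]
  have q5 : 0 ≤ (2 * j0 + 1) * τ := by positivity
  rw [abs_le] at k1 m1 m2 ⊢
  constructor <;> linarith [k1.1, k1.2, m1.1, m1.2, m2.1, m2.2]
end HH

end

section
open Finset
open scoped ArithmeticFunction.vonMangoldt ArithmeticFunction.Moebius ArithmeticFunction.zeta
namespace HH
local notation "ψ" => Chebyshev.psi

theorem alt_id (u : ℕ → ℝ) (n : ℕ) : 2 * ∑ j ∈ range (n + 1), (-1) ^ j * u j = u 0 + (-1) ^ n * u n + ∑ j ∈ range n, (-1) ^ j * (u j - u (j + 1)) := by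
  induction n with
  | zero => simp; ring
  | succ n ih => rw [sum_range_succ, mul_add, ih, sum_range_succ _ n, pow_succ]; ring

theorem alt_bound (u : ℕ → ℝ) (hu : ∀ j, |u j| ≤ 1) (n j0 : ℕ) (e : ℝ) (he : 0 ≤ e) (h : ∀ j, j + 1 ≠ j0 → |u j - u (j + 1)| ≤ e) :
    |∑ j ∈ range (n + 1), (-1) ^ j * u j| ≤ 2 + n * e := by
  have h1 : |2 * ∑ j ∈ range (n + 1), (-1) ^ j * u j| ≤ 4 + n * e := by
    rw [alt_id]
    have a1 : |(-1) ^ n * u n| ≤ 1 := by rw [abs_mul, abs_pow, abs_neg, abs_one, one_pow, one_mul]; exact hu n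
    have a2 : |∑ j ∈ range n, (-1) ^ j * (u j - u (j + 1))| ≤ 2 + n * e := by
      refine (abs_sum_le_sum_abs _ _).trans ?_
      calc _ ≤ ∑ j ∈ range n, (e + if j = j0 - 1 then 2 else 0) := by
            apply sum_le_sum
            intro j _
            rw [abs_mul, abs_pow, abs_neg, abs_one, one_pow, one_mul]
            split_ifs with hj
            · have := abs_sub (u j) (u (j + 1))
              linarith [hu j, hu (j + 1)]
            · rw [add_zero]; exact h j (by omega)
        _ ≤ _ := by
            rw [sum_add_distrib, sum_ite_eq']
            simp only [sum_const, card_range, nsmul_eq_mul]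
            split_ifs <;> linarith
    calc _ ≤ |u 0| + |(-1) ^ n * u n| + |∑ j ∈ range n, (-1) ^ j * (u j - u (j + 1))| := abs_add_three _ _ _
      _ ≤ _ := by linarith [hu 0]
  rw [abs_mul, abs_of_pos (by norm_num : (0:ℝ) < 2)] at h1
  have : 0 ≤ n * e := by positivity
  linarith

set_option maxHeartbeats 1000000 in
theorem core {τ : ℝ} (hτ : 0 < τ) (hτ1 : τ ≤ 1 / 10000) {K : ℕ} (hK : 72000 ≤ K) (hK2 : gE τ K ≤ 2) {j0 N : ℕ} (hj0 : 1 ≤ j0)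
    (hN : 10000 ≤ N)
    (hG : ∀ i, j0 ≤ i → gF 1 τ i ≤ 2 + 1 / 2000)
    (hrel : ∀ j, 3 * j0 + K + 1 ≤ j → j ≤ N → |(j:ℝ) * (gF K τ j - 1) + ∑ i ∈ Ico j0 (j - j0 - 1), (gF 1 τ i - 1) * (gF K τ (j - i) - 1)| ≤ N / 500)
    (hsmall : 6 * (3 * (j0:ℝ) + K + 1) + 8 ≤ N / 400)
    (hmert : 16 + 3 * N * τ ^ 2 ≤ τ * (N / 400))
    (hend : gF K τ N ≤ 1 / 2000) : False := by
  have hK1 : 1 ≤ K := by omega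
  have hNr : (10000:ℝ) ≤ N := by exact_mod_cast hN
  have hF := gF_le hτ hK1 hG
  have hG3 : ∀ i, j0 ≤ i → gF 1 τ i ≤ 3 := fun i hi => (hG i hi).trans (by norm_num)
  have hj0N : 3 * j0 + K + 1 ≤ N := by
    have : (3 * (j0:ℝ) + K + 1) ≤ N := by
      have : 0 ≤ (3 * (j0:ℝ) + K + 1) := by positivity
      linarith
    exact_mod_cast this
  let f : ℕ → ℝ := fun j => if j0 ≤ j then (gF K τ j - 1) * (2000 / 2001) else 0
  let g : ℕ → ℝ := fun j => if j0 ≤ j then (gF 1 τ j - 1) * (2000 / 2001) else 0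
  have hf : ∀ j, |f j| ≤ 1 := by
    intro j
    simp only [f]
    split_ifs with h
    · have := hF j h
      have := gF_nonneg hτ hK1 j
      rw [abs_le]; constructor <;> linarith
    · simp
  have hg : ∀ j, |g j| ≤ 1 := by
    intro j
    simp only [g]
    split_ifs with h
    · have := hG j h
      have := gF_nonneg hτ le_rfl j
      rw [abs_le]; constructor <;> linarith
    · simp
  have hgf : ∀ i r, |g i * f r| ≤ 1 := by
    intro i r
    rw [abs_mul]
    exact mul_le_one₀ (hg i) (abs_nonneg _) (hf r)
  refine disc N (by omega) (1 / 200) (by norm_num) (by norm_num) f g hf hg ?_ ?_ ?_ ?_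
  · intro j hjN
    by_cases hj : 3 * j0 + K + 1 ≤ j
    · have e1 : ∑ i ∈ range (j + 1), g i * f (j - i) = ∑ i ∈ Ico j0 (j - j0 - 1), g i * f (j - i) + ∑ i ∈ Ico (j - j0 - 1) (j - j0 + 1), g i * f (j - i) := by
        rw [range_eq_Ico, ← sum_Ico_consecutive _ (Nat.zero_le j0) (by omega : j0 ≤ j + 1),
          ← sum_Ico_consecutive _ (by omega : j0 ≤ j - j0 - 1) (by omega : j - j0 - 1 ≤ j + 1),
          ← sum_Ico_consecutive _ (by omega : j - j0 - 1 ≤ j - j0 + 1) (by omega : j - j0 + 1 ≤ j + 1)]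
        rw [sum_eq_zero (s := Ico 0 j0), sum_eq_zero (s := Ico (j - j0 + 1) (j + 1))]
        · ring
        · intro i hi
          rw [mem_Ico] at hi
          simp only [f]
          rw [if_neg (show ¬ j0 ≤ j - i by omega), mul_zero]
        · intro i hi
          rw [mem_Ico] at hi
          simp only [g]
          rw [if_neg (show ¬ j0 ≤ i by omega), zero_mul]
      have e2 : ∑ i ∈ Ico j0 (j - j0 - 1), g i * f (j - i) = (2000 / 2001) ^ 2 * ∑ i ∈ Ico j0 (j - j0 - 1), (gF 1 τ i - 1) * (gF K τ (j - i) - 1) := by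
        rw [mul_sum]
        apply sum_congr rfl
        intro i hi
        rw [mem_Ico] at hi
        simp only [f, g]
        rw [if_pos (show j0 ≤ j - i by omega), if_pos hi.1]
        ring
      have e3 : |∑ i ∈ Ico (j - j0 - 1) (j - j0 + 1), g i * f (j - i)| ≤ 2 := by
        refine (abs_sum_le_sum_abs _ _).trans ?_
        calc _ ≤ ∑ i ∈ Ico (j - j0 - 1) (j - j0 + 1), (1:ℝ) := sum_le_sum fun i _ => hgf _ _
          _ = 2 := by
            rw [sum_const, Nat.card_Ico, show j - j0 + 1 - (j - j0 - 1) = 2 by omega]; norm_num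
      have e4 : f j = (gF K τ j - 1) * (2000 / 2001) := if_pos (by omega)
      have e5 := hrel j hj hjN
      rw [e1, e2]
      have hfj := hf j
      have hjr : (j:ℝ) ≤ N := by exact_mod_cast hjN
      have e6 : |(j:ℝ) * f j| ≤ N := by
        rw [abs_mul, Nat.abs_cast]
        calc _ ≤ (j:ℝ) * 1 := by gcongr
          _ ≤ _ := by linarith
      set S := ∑ i ∈ Ico j0 (j - j0 - 1), (gF 1 τ i - 1) * (gF K τ (j - i) - 1)
      set Z := ∑ i ∈ Ico (j - j0 - 1) (j - j0 + 1), g i * f (j - i)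
      have e7 : (j:ℝ) * f j + ((2000 / 2001) ^ 2 * S + Z) = (2000 / 2001) ^ 2 * (j * (gF K τ j - 1) + S) + 1 / 2001 * (j * f j) + Z := by
        rw [e4]; ring
      rw [e7]
      set W := (j:ℝ) * (gF K τ j - 1) + S
      set V := (j:ℝ) * f j
      rw [abs_le] at e3 e5 e6 ⊢
      constructor <;> linarith
    · have hjr : (j:ℝ) ≤ 3 * j0 + K + 1 := by exact_mod_cast (by omega : j ≤ 3 * j0 + K + 1)
      have e1 : |∑ i ∈ range (j + 1), g i * f (j - i)| ≤ j + 1 := by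
        refine (abs_sum_le_sum_abs _ _).trans ?_
        calc _ ≤ ∑ i ∈ range (j + 1), (1:ℝ) := sum_le_sum fun i _ => hgf _ _
          _ = _ := by simp
      have e6 : |(j:ℝ) * f j| ≤ j := by
        rw [abs_mul, Nat.abs_cast]
        calc _ ≤ (j:ℝ) * 1 := by have := hf j; gcongr
          _ ≤ _ := by linarith
      refine (abs_add_le _ _).trans ?_
      have : (0:ℝ) ≤ 3 * j0 + K + 1 := by positivity
      linarith
  · have : f N = (gF K τ N - 1) * (2000 / 2001) := if_pos (by omega)
    rw [this]; linarith
  · have e1 : ∑ j ∈ range (N + 1), f j = (2000 / 2001) * ∑ j ∈ Ico j0 (N + 1), (gF K τ j - 1) := by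
      rw [range_eq_Ico, ← sum_Ico_consecutive _ (Nat.zero_le j0) (by omega : j0 ≤ N + 1), sum_eq_zero (s := Ico 0 j0), zero_add, mul_sum]
      · apply sum_congr rfl
        intro i hi
        rw [mem_Ico] at hi
        simp only [f]
        rw [if_pos hi.1]; ring
      · intro i hi
        rw [mem_Ico] at hi
        exact if_neg (by omega)
    have m := mert_sumF hτ (by linarith) hK1 (A := j0) (B := N + 1) (by omega) hG3
    have m2 : 16 + 3 * (((N + 1 : ℕ):ℝ) - j0) * τ ^ 2 ≤ τ * (N / 400) := by
      refine le_trans ?_ hmert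
      have : (1:ℝ) ≤ j0 := by exact_mod_cast hj0
      gcongr
      push_cast; linarith
    have m3 := m.trans m2
    rw [abs_mul, abs_of_pos hτ] at m3
    have m4 := le_of_mul_le_mul_left m3 hτ
    rw [e1]
    rw [abs_le] at m4 ⊢
    constructor <;> linarith
  · have hKr : (72000:ℝ) ≤ K := by exact_mod_cast hK
    have hKe : 6 / (K:ℝ) ≤ 1 / 12000 := by
      rw [div_le_div_iff₀ (by linarith) (by norm_num)]; linarith
    have := alt_bound f hf N j0 (1 / 1000) (by norm_num) (by
      intro j hj
      by_cases hjj : j0 ≤ j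
      · have s := slow hτ (by linarith) hK1 hK2 hG3 j hjj
        have : f j - f (j + 1) = (gF K τ j - gF K τ (j + 1)) * (2000 / 2001) := by
          simp only [f]; rw [if_pos hjj, if_pos (by omega)]; ring
        rw [this, abs_mul, abs_of_pos (by norm_num : (0:ℝ) < 2000 / 2001)]
        linarith [abs_nonneg (gF K τ j - gF K τ (j + 1))]
      · simp only [f]; rw [if_neg hjj, if_neg (by omega)]; norm_num)
    linarith
end HH

end

section
open Finset
open scoped ArithmeticFunction.vonMangoldt ArithmeticFunction.Moebius ArithmeticFunction.zeta
namespace HH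
local notation "ψ" => Chebyshev.psi

theorem theta_eq_of_no_primes {x z : ℝ} (hx : 0 ≤ x) (hxz : x ≤ z) (h : ∀ p : ℕ, p.Prime → x < p → ¬ (p:ℝ) ≤ z) :
    Chebyshev.theta z = Chebyshev.theta x := by
  unfold Chebyshev.theta
  symm
  apply sum_subset
  · intro p hp
    simp only [mem_filter, mem_Ioc] at *
    exact ⟨⟨hp.1.1, hp.1.2.trans (Nat.floor_le_floor hxz)⟩, hp.2⟩
  · intro p hp hp'
    exfalso
    simp only [mem_filter, mem_Ioc] at *
    have h1 : (p:ℝ) ≤ z := (Nat.le_floor_iff (hx.trans hxz)).1 hp.1.2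
    apply h p hp.2 _ h1
    by_contra hc
    push Not at hc
    exact hp' ⟨⟨hp.1.1, Nat.le_floor hc⟩, hp.2⟩

set_option maxHeartbeats 4000000 in
theorem hoheisel : ∃ ε : ℝ, 0 < ε ∧ ε ≤ 1 / 2 ∧ ∃ x0 : ℝ, 1 ≤ x0 ∧ ∀ x, x0 ≤ x → ∃ p : ℕ, p.Prime ∧ x < p ∧ (p:ℝ) ≤ x + x ^ (1 - ε) := by
  obtain ⟨C, hC1, hBT⟩ := BT
  obtain ⟨ε, hε0, hε1, Y0, hY0, hB2⟩ := BT2 (1 / 2000) (by norm_num)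
  obtain ⟨C', hC'⟩ := Chebyshev.psi_sub_theta_le_mul_sqrt
  obtain ⟨a, ha⟩ : ∃ a : ℝ, a = 1 / (8000 * (C + 1)) := ⟨_, rfl⟩
  have hC0 : 0 ≤ C := by linarith
  have ha0 : 0 < a := by rw [ha]; positivity
  have ha1 : a ≤ 1 / 16000 := by rw [ha]; apply div_le_div_of_nonneg_left <;> linarith
  have haC : (2 * C + 2) * a = 1 / 4000 := by rw [ha]; field_simp; norm_num
  set α := a * ε with hα
  have hα0 : 0 < α := by positivity
  have hα1 : α ≤ 1 / 16000 := by nlinarith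
  obtain ⟨K, hKdef⟩ : ∃ K : ℕ, K = 72000 := ⟨_, rfl⟩
  have hKr : (K:ℝ) = 72000 := by rw [hKdef]; norm_num
  refine ⟨α / 2, by positivity, by linarith, ?_⟩
  have t1 : ∀ᶠ x : ℝ in Filter.atTop, 20000 * (16 * C + 32) ≤ Real.log x := Real.tendsto_log_atTop.eventually_ge_atTop _
  have t2 : ∀ᶠ x : ℝ in Filter.atTop, 10 ^ 12 * (C + 1) ≤ x ^ α := (tendsto_rpow_atTop hα0).eventually_ge_atTop _
  have t3 : ∀ᶠ x : ℝ in Filter.atTop, 8000 * (|C'| + 1) ≤ x ^ (1 / 4 : ℝ) := (tendsto_rpow_atTop (by norm_num)).eventually_ge_atTop _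
  have t4 : ∀ᶠ x : ℝ in Filter.atTop, Y0 ≤ x ^ a := (tendsto_rpow_atTop ha0).eventually_ge_atTop _
  obtain ⟨x0, hx0⟩ := Filter.eventually_atTop.1 (t1.and (t2.and (t3.and t4)))
  refine ⟨max x0 1, le_max_right _ _, fun x hx => ?_⟩
  obtain ⟨u1, u2, u3, u4⟩ := hx0 x ((le_max_left _ _).trans hx)
  have hx1 : 1 ≤ x := (le_max_right _ _).trans hx
  have hxp : 0 < x := by linarith
  by_contra hno
  push Not at hno
  set L := Real.log x with hL
  set s := x ^ α with hs
  have hs0 : 10 ^ 12 ≤ s := by linarith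
  have hL0 : 640000 ≤ L := by linarith
  set N := ⌊s * L⌋₊ with hN
  have hN1 : (N:ℝ) ≤ s * L := Nat.floor_le (by positivity)
  have hN2 : s * L < N + 1 := Nat.lt_floor_add_one _
  have hsL : s * 640000 ≤ s * L := by gcongr
  have hN3 : s * L / 2 ≤ N := by linarith
  have hNs : s ≤ N := by linarith
  have hN0 : (0:ℝ) < N := by linarith
  set τ := L / N with hτd
  have hτ : 0 < τ := by positivity
  have hNτ : N * τ = L := by rw [hτd]; field_simp
  have hsτ1 : 1 ≤ s * τ := by
    rw [hτd, ← mul_div_assoc, le_div_iff₀ hN0]; linarith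
  have hsτ2 : s * τ ≤ 2 := by
    rw [hτd, ← mul_div_assoc, div_le_iff₀ hN0]; linarith
  have hτs : τ ≤ 2 / s := by rw [le_div_iff₀ (by linarith)]; linarith
  have hτ1 : τ ≤ 2 / 10 ^ 12 := hτs.trans (by gcongr)
  have hEN : gE τ N = x := by rw [gE, hNτ, hL, Real.exp_log hxp]
  set j0 := ⌈a * N⌉₊ with hj0
  have j01 : a * N ≤ j0 := Nat.le_ceil _
  have j02 : (j0:ℝ) < a * N + 1 := Nat.ceil_lt_add_one (by positivity)
  have j03 : 1 ≤ j0 := Nat.ceil_pos.2 (by positivity)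
  have hK1 : 1 ≤ K := by omega
  have hKτ : K * τ ≤ 1 / 2 := by rw [hKr]; linarith
  have hK2 : gE τ K ≤ 2 := by
    rw [gE]
    calc _ ≤ Real.exp (Real.log 2) := Real.exp_le_exp.2 (by linarith [Real.log_two_gt_d9])
      _ = 2 := Real.exp_log (by norm_num)
  have hEi : ∀ i, j0 ≤ i → x ^ a ≤ gE τ i := by
    intro i hi
    refine le_trans ?_ (gE_mono hτ hi)
    rw [gE, Real.rpow_def_of_pos hxp, ← hL]
    apply Real.exp_le_exp.2
    calc L * a = (a * N) * τ := by rw [← hNτ]; ring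
      _ ≤ _ := by gcongr
  have hEY : ∀ i, j0 ≤ i → Y0 ≤ gE τ i := fun i hi => u4.trans (hEi i hi)
  have hEε : ∀ i, j0 ≤ i → (gE τ i) ^ (1 - ε) ≤ τ * gE τ i := by
    intro i hi
    have hE := gE_pos τ i
    rw [Real.rpow_sub hE, Real.rpow_one, div_le_iff₀ (by positivity)]
    have : s ≤ (gE τ i) ^ ε := by
      calc s = (x ^ a) ^ ε := by rw [← Real.rpow_mul hxp.le]
        _ ≤ _ := by gcongr; exact hEi i hi
    calc gE τ i = 1 * gE τ i := by ring
      _ ≤ (s * τ) * gE τ i := by gcongr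
      _ ≤ ((gE τ i) ^ ε * τ) * gE τ i := by gcongr
      _ = _ := by ring
  have hB : ∀ k, 1 ≤ k → k ≤ K → ∀ i, j0 ≤ i → |EE (gE τ i) (gc τ k * gE τ i) - 2 * (gc τ k * gE τ i) * Real.log (gE τ i)| ≤ (1 / 2000) * (gc τ k * gE τ i) * Real.log (gE τ i) ∧ 
      ψ (gE τ i + gc τ k * gE τ i) - ψ (gE τ i) ≤ (2 + 1 / 2000) * (gc τ k * gE τ i) := by
    intro k hk hkK i hi
    have hE := gE_pos τ i
    apply hB2 _ (hEY i hi)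
    · refine (hEε i hi).trans ?_
      gcongr
      refine le_trans ?_ (gc_ge k)
      have : (1:ℝ) ≤ k := by exact_mod_cast hk
      exact le_mul_of_one_le_left hτ.le this
    · have : gc τ k ≤ 1 := by rw [gc]; linarith [gE_mono hτ hkK]
      exact mul_le_of_le_one_left hE.le this
  have hG : ∀ i, j0 ≤ i → gF 1 τ i ≤ 2 + 1 / 2000 := by
    intro i hi
    have := (hB 1 le_rfl hK1 i hi).2
    have hE := gE_pos τ i
    have hc := gc_pos hτ (le_refl 1)
    rw [gF, div_le_iff₀ (by positivity)]
    refine le_trans (le_of_eq ?_) this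
    rw [gP, gP, show gE τ i + gc τ 1 * gE τ i = gE τ (i + 1) by rw [gE_add, gc]; ring]
  have hcK := gc_pos hτ hK1
  have hcτ : τ ≤ gc τ K := by
    refine le_trans ?_ (gc_ge K)
    rw [hKr]; linarith
  refine core hτ (by linarith) (K := K) (by omega) hK2 (j0 := j0) (N := N) j03 ?_ hG ?_ ?_ ?_ ?_
  · have : (10000:ℝ) ≤ N := by linarith
    exact_mod_cast this
  · intro j hj hjN
    have hsq : gE τ (j0 + K + 1) ≤ (gc τ K) ^ 2 * gE τ j := by
      have h1 : gE τ (j0 + K + 1) * (gE τ j0 * gE τ j0) ≤ gE τ j := by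
        rw [← gE_add, ← gE_add]; exact gE_mono hτ (by omega)
      have h2 : 1 ≤ τ * gE τ j0 := by
        have h3 : s ≤ gE τ j0 := by
          refine le_trans ?_ (hEi j0 le_rfl)
          apply Real.rpow_le_rpow_of_exponent_le hx1
          rw [hα]; exact mul_le_of_le_one_right ha0.le (by linarith)
        refine hsτ1.trans ?_
        rw [mul_comm]
        gcongr
      have h4 : 1 ≤ gc τ K * gE τ j0 := h2.trans (by have := gE_pos τ j0; gcongr)
      have hE := gE_pos τ (j0 + K + 1)
      calc gE τ (j0 + K + 1) = gE τ (j0 + K + 1) * (1 * 1) := by ring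
        _ ≤ gE τ (j0 + K + 1) * ((gc τ K * gE τ j0) * (gc τ K * gE τ j0)) := by gcongr
        _ = gc τ K ^ 2 * (gE τ (j0 + K + 1) * (gE τ j0 * gE τ j0)) := by ring
        _ ≤ _ := by gcongr
    have r := rel hBT hC0 hτ (by linarith) hK1 hK2 (j0 := j0) (j := j) (δ := 1 / 2000) (fun i hi => (hG i hi).trans (by norm_num)) (by omega)
      (hB K hK1 le_rfl j (by omega)).1 hsq
    set W := |(j:ℝ) * (gF K τ j - 1) + ∑ i ∈ Ico j0 (j - j0 - 1), (gF 1 τ i - 1) * (gF K τ (j - i) - 1)|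
    apply le_of_mul_le_mul_left _ hτ
    refine r.trans ?_
    have hjr : (j:ℝ) ≤ N := by exact_mod_cast hjN
    have hjτ : j * τ ≤ L := by rw [← hNτ]; gcongr
    rw [show τ * ((N:ℝ) / 500) = L / 500 by rw [← hNτ]; ring, hKr]
    have hj0τ : j0 * τ ≤ a * L + τ := by
      calc j0 * τ ≤ (a * N + 1) * τ := by gcongr
        _ = a * L + τ := by rw [← hNτ]; ring
    have q1 : 36 * τ * j / 72000 ≤ L / 2000 := by linarith
    have q2 : 15 * j * τ ^ 2 ≤ L / 20000 := by
      calc 15 * j * τ ^ 2 = 15 * (j * τ) * τ := by ring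
        _ ≤ 15 * L * (2 / 10 ^ 12) := by gcongr
        _ ≤ _ := by linarith
    have q3 : 2 * C * ((j0 + 72000 + 1) * τ + 8) + (2 * j0 + 1) * τ ≤ (2 * C + 2) * (a * L + 100000 * τ) + 16 * C := by
      have : 2 * C * ((j0 + 72000 + 1) * τ + 8) ≤ 2 * C * (a * L + 100000 * τ + 8) := by gcongr; linarith
      linarith
    have q4 : (2 * C + 2) * (100000 * τ) ≤ 1 := by
      have : (C + 1) * τ * 10 ^ 12 ≤ 2 := by
        calc (C + 1) * τ * 10 ^ 12 = (10 ^ 12 * (C + 1)) * τ := by ring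
          _ ≤ s * τ := by gcongr
          _ ≤ 2 := hsτ2
      linarith
    have q5 : (2 * C + 2) * (a * L) = L / 4000 := by rw [← mul_assoc, haC]; ring
    linarith
  · rw [hKr]
    have : a * N ≤ 1 / 16000 * N := by gcongr
    linarith
  · rw [show τ * ((N:ℝ) / 400) = L / 400 by rw [← hNτ]; ring]
    have : 3 * N * τ ^ 2 ≤ L / 1000 := by
      calc 3 * N * τ ^ 2 = 3 * (N * τ) * τ := by ring
        _ ≤ 3 * L * (2 / 10 ^ 12) := by rw [hNτ]; gcongr
        _ ≤ _ := by linarith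
    linarith
  · have hz : gE τ (N + K) = x + gc τ K * x := by rw [gE_add, hEN, gc]; ring
    have hcK' : gc τ K ≤ x ^ (-(α / 2)) := by
      have h1 : gc τ K ≤ 2 * (K * τ) := by
        have := Real.abs_exp_sub_one_sub_id_le (x := K * τ) (by rw [abs_of_pos (by positivity)]; linarith)
        rw [abs_le] at this
        rw [gc, gE]
        have h0 : 0 < K * τ := by positivity
        nlinarith [this.2]
      have hsq : x ^ (α / 2) * x ^ (α / 2) = s := by rw [← Real.rpow_add hxp, hs]; congr 1; ring
      have hp : 0 < x ^ (α / 2) := by positivity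
      rw [Real.rpow_neg hxp.le, ← one_div, le_div_iff₀ hp]
      have hbig : 10 ^ 6 ≤ x ^ (α / 2) := by
        by_contra hc
        rw [not_le] at hc
        have := mul_lt_mul'' hc hc hp.le hp.le
        rw [hsq] at this
        linarith
      have : 2 * (K * τ) ≤ 288000 / s := by
        rw [hKr]
        calc 2 * (72000 * τ) ≤ 2 * (72000 * (2 / s)) := by gcongr
          _ = _ := by ring
      calc gc τ K * x ^ (α / 2) ≤ 288000 / s * x ^ (α / 2) := by gcongr; linarith
        _ ≤ 1 := by
          rw [← hsq, div_mul_eq_mul_div, div_le_one (by positivity)]; gcongr; linarith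
    have hth : Chebyshev.theta (gE τ (N + K)) = Chebyshev.theta x := by
      apply theta_eq_of_no_primes hxp.le (by rw [hz]; have := mul_pos hcK hxp; linarith)
      intro p hp hxp'
      rw [not_le]
      refine lt_of_le_of_lt ?_ (hno p hp hxp')
      rw [hz, sub_eq_add_neg 1, Real.rpow_add hxp, Real.rpow_one, mul_comm x]
      gcongr
    have hz2 : gE τ (N + K) ≤ 4 * x := by
      have : gc τ K ≤ 1 := by rw [gc]; linarith
      have := mul_le_mul_of_nonneg_right this hxp.le
      rw [hz]; linarith
    have hsz : √(gE τ (N + K)) ≤ 2 * √x := by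
      rw [show (2:ℝ) = √4 by rw [show (4:ℝ) = 2 ^ 2 by norm_num]; simp, ← Real.sqrt_mul (by norm_num)]
      exact Real.sqrt_le_sqrt hz2
    have hd : gP τ (N + K) - gP τ N ≤ 2 * |C'| * √x := by
      have h1 := hC' (gE τ (N + K))
      have h2 := Chebyshev.theta_le_psi x
      rw [gP, gP, hEN]
      have : C' * √(gE τ (N + K)) ≤ |C'| * (2 * √x) := by
        calc _ ≤ |C'| * √(gE τ (N + K)) := by gcongr; exact le_abs_self _
          _ ≤ _ := by gcongr
      linarith
    rw [gF, hEN, div_le_iff₀ (by positivity)]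
    refine hd.trans ?_
    have v1 : √x = x ^ (1 / 4 : ℝ) * x ^ (1 / 4 : ℝ) := by
      rw [Real.sqrt_eq_rpow, ← Real.rpow_add hxp]; norm_num
    have v2 : s ≤ x ^ (1 / 4 : ℝ) := Real.rpow_le_rpow_of_exponent_le hx1 (by linarith)
    have v3 : √x * √x = x := Real.mul_self_sqrt hxp.le
    set q := x ^ (1 / 4 : ℝ) with hq
    have hq0 : 0 < q := by positivity
    have v4 : x = q ^ 4 := by rw [← v3, v1]; ring
    rw [v1, v4]
    have v5 : 1 ≤ q * gc τ K := by
      calc 1 ≤ s * τ := hsτ1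
        _ ≤ q * gc τ K := by gcongr
    calc 2 * |C'| * (q * q) ≤ 1 / 2000 * q * (q * q) * 1 := by
          have : 2 * |C'| ≤ 1 / 2000 * q := by linarith [abs_nonneg C']
          rw [mul_one]; gcongr
      _ ≤ 1 / 2000 * q * (q * q) * (q * gc τ K) := by gcongr
      _ = _ := by ring
end HH

end

namespace HH

theorem tower_step : ∃ J0 : ℕ, 1 ≤ J0 ∧ ∀ j, J0 ≤ j → ∀ q : ℕ, 2 ≤ q → ∃ q' : ℕ, q'.Prime ∧ q ^ (j + 1) < q' ∧ q' ≤ q ^ (j + 1) + q ^ j := by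
  obtain ⟨ε, hε, hε2, x0, hx0, H⟩ := hoheisel
  refine ⟨⌈1 / ε⌉₊ + ⌈x0⌉₊ + 1, by omega, fun j hj q hq => ?_⟩
  have hj1 : 1 / ε ≤ j := (Nat.le_ceil _).trans (by exact_mod_cast (by omega))
  have hj2 : x0 ≤ j := (Nat.le_ceil _).trans (by exact_mod_cast (by omega))
  have hq1 : (1:ℝ) ≤ q := by exact_mod_cast (by omega)
  have hjq : (j:ℝ) ≤ (q:ℝ) ^ (j + 1) := by
    have : j < q ^ (j + 1) := (Nat.lt_two_pow_self).trans_le ((Nat.pow_le_pow_right (by norm_num) (Nat.le_succ j)).trans (Nat.pow_le_pow_left hq _))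
    exact_mod_cast this.le
  obtain ⟨p, hp, h1, h2⟩ := H ((q:ℝ) ^ (j + 1)) (hj2.trans hjq)
  refine ⟨p, hp, by exact_mod_cast h1, ?_⟩
  have : ((q:ℝ) ^ (j + 1)) ^ (1 - ε) ≤ (q:ℝ) ^ j := by
    rw [← Real.rpow_natCast, ← Real.rpow_mul (by linarith), ← Real.rpow_natCast]
    apply Real.rpow_le_rpow_of_exponent_le hq1
    rw [div_le_iff₀ hε] at hj1
    push_cast
    nlinarith
  have := h2.trans (add_le_add_right this _)
  exact_mod_cast this

theorem pow_gap (q j q' : ℕ) (hj : 1 ≤ j) (hq : 2 ≤ q) (h : q' ≤ q ^ (j + 1) + q ^ j) : q' + 1 < (q + 1) ^ (j + 1) := by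
  obtain ⟨i, rfl⟩ : ∃ i, j = i + 1 := ⟨j - 1, by omega⟩
  have h1 : q ^ (i + 1) + 1 ≤ (q + 1) ^ (i + 1) := by
    have : q ^ (i + 1) < (q + 1) ^ (i + 1) := Nat.pow_lt_pow_left (by omega) (by omega)
    omega
  have h2 : (q + 1) ^ (i + 1 + 1) = (q + 1) ^ (i + 1) * (q + 1) := pow_succ _ _
  have h3 : (q ^ (i + 1) + 1) * (q + 1) ≤ (q + 1) ^ (i + 1) * (q + 1) := Nat.mul_le_mul_right _ h1
  have h4 : q ^ (i + 1 + 1) = q ^ (i + 1) * q := pow_succ _ _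
  nlinarith

theorem tower {J0 : ℕ} (hJ0 : 1 ≤ J0) (H : ∀ j, J0 ≤ j → ∀ q : ℕ, 2 ≤ q → ∃ q' : ℕ, q'.Prime ∧ q ^ (j + 1) < q' ∧ q' ≤ q ^ (j + 1) + q ^ j)
    {k : ℕ} (hk : J0 ≤ k) (q : ℕ) (hq : q.Prime) : 
    ∃ A : ℝ, 1 < A ∧ ((q:ℝ) ≤ A ^ Nat.factorial k ∧ A ^ Nat.factorial k < (q:ℝ) + 1) ∧ ∀ j, k ≤ j → Prime ⌊A ^ Nat.factorial j⌋ := by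
  classical
  have H' : ∀ j q : ℕ, ∃ q' : ℕ, J0 ≤ j → 2 ≤ q → (q'.Prime ∧ q ^ (j + 1) < q' ∧ q' ≤ q ^ (j + 1) + q ^ j) := by
    intro j q
    by_cases h1 : J0 ≤ j
    · by_cases h2 : 2 ≤ q
      · obtain ⟨q', h⟩ := H j h1 q h2
        exact ⟨q', fun _ _ => h⟩
      · exact ⟨0, fun _ h => absurd h h2⟩
    · exact ⟨0, fun h => absurd h h1⟩
  choose F hF using H'
  obtain ⟨s, s0, ss⟩ : ∃ s : ℕ → ℕ, s 0 = q ∧ ∀ i, s (i + 1) = F (k + i) (s i) :=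
    ⟨fun i => Nat.rec q (fun i r => F (k + i) r) i, rfl, fun i => rfl⟩
  have sp : ∀ i, (s i).Prime := by
    intro i
    induction i with
    | zero => rw [s0]; exact hq
    | succ i ih => rw [ss]; exact (hF (k + i) (s i) (by omega) ih.two_le).1
  have s1 : ∀ i, (s i) ^ (k + i + 1) < s (i + 1) := fun i => by
    rw [ss]; exact (hF (k + i) (s i) (by omega) (sp i).two_le).2.1
  have s2 : ∀ i, s (i + 1) + 1 < (s i + 1) ^ (k + i + 1) := fun i => by
    rw [ss]
    exact pow_gap _ _ _ (by omega) (sp i).two_le (hF (k + i) (s i) (by omega) (sp i).two_le).2.2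
  let e : ℕ → ℕ := fun i => Nat.factorial (k + i)
  have epos : ∀ i, e i ≠ 0 := fun i => (Nat.factorial_pos _).ne'
  have esucc : ∀ i, e (i + 1) = (k + i + 1) * e i := fun i => Nat.factorial_succ _
  let l : ℕ → ℝ := fun i => ((s i : ℕ) : ℝ) ^ ((e i : ℝ)⁻¹)
  let u : ℕ → ℝ := fun i => ((s i : ℝ) + 1) ^ ((e i : ℝ)⁻¹)
  have lp : ∀ i, l i ^ e i = s i := fun i => Real.rpow_inv_natCast_pow (by positivity) (epos i)
  have up : ∀ i, u i ^ e i = s i + 1 := fun i => Real.rpow_inv_natCast_pow (by positivity) (epos i)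
  have l0 : ∀ i, 0 ≤ l i := fun i => by positivity
  have u0 : ∀ i, 0 ≤ u i := fun i => by positivity
  have lmono : Monotone l := by
    apply monotone_nat_of_le_succ
    intro i
    apply le_of_pow_le_pow_left₀ (epos (i + 1)) (l0 _)
    rw [lp, esucc, mul_comm, pow_mul, lp]
    exact_mod_cast (s1 i).le
  have ustrict : ∀ i, u (i + 1) < u i := by
    intro i
    apply lt_of_pow_lt_pow_left₀ (e (i + 1)) (u0 _)
    rw [up, esucc, mul_comm, pow_mul, up]
    exact_mod_cast s2 i
  have uanti : Antitone u := antitone_nat_of_succ_le fun i => (ustrict i).le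
  have lu : l ≤ u := by
    intro i
    apply le_of_pow_le_pow_left₀ (epos i) (u0 _)
    rw [lp, up]; linarith
  have hA := Monotone.ciSup_mem_iInter_Icc_of_antitone lmono uanti lu
  set A := ⨆ n, l n
  rw [Set.mem_iInter] at hA
  have A1 : ∀ i, (s i : ℝ) ≤ A ^ e i := by
    intro i
    rw [← lp]
    exact pow_le_pow_left₀ (l0 i) (hA i).1 _
  have A0 : 0 ≤ A := (l0 0).trans (hA 0).1
  have A2 : ∀ i, A ^ e i < (s i : ℝ) + 1 := by
    intro i
    rw [← up]
    exact pow_lt_pow_left₀ ((hA (i + 1)).2.trans_lt (ustrict i)) A0 (epos i)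
  refine ⟨A, ?_, ⟨s0 ▸ A1 0, s0 ▸ A2 0⟩, ?_⟩
  · by_contra hc
    push Not at hc
    have := pow_le_one₀ (n := e 0) A0 hc
    have h2 : (2:ℝ) ≤ s 0 := by exact_mod_cast (sp 0).two_le
    linarith [A1 0]
  · intro j hj
    obtain ⟨i, rfl⟩ := Nat.exists_eq_add_of_le hj
    have : ⌊A ^ Nat.factorial (k + i)⌋ = ((s i : ℕ) : ℤ) := by
      rw [Int.floor_eq_iff]
      exact ⟨by exact_mod_cast A1 i, by exact_mod_cast A2 i⟩
    rw [this]
    exact Nat.prime_iff_prime_int.1 (sp i)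

theorem W_nat {A : ℝ} (hA : A ∈ Wfact) {k : ℕ} (hk : 1 ≤ k) : ∃ p : ℕ, p.Prime ∧ (p:ℝ) ≤ A ^ Nat.factorial k ∧ A ^ Nat.factorial k < p + 1 := by
  obtain ⟨h1, h2⟩ := hA
  have hp := h2 k hk
  have h0 : 0 ≤ ⌊A ^ Nat.factorial k⌋ := Int.floor_nonneg.2 (by positivity)
  obtain ⟨p, hpe⟩ := Int.eq_ofNat_of_zero_le h0
  rw [hpe] at hp
  refine ⟨p, Nat.prime_iff_prime_int.2 hp, ?_⟩
  have := Int.floor_eq_iff.1 hpe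
  exact_mod_cast this

/-- extension lemma -/
theorem ext {J0 : ℕ} (hJ0 : 1 ≤ J0) (H : ∀ j, J0 ≤ j → ∀ q : ℕ, 2 ≤ q → ∃ q' : ℕ, q'.Prime ∧ q ^ (j + 1) < q' ∧ q' ≤ q ^ (j + 1) + q ^ j)
    {k : ℕ} (hk : J0 ≤ k) {A : ℝ} (hA : A ∈ Wfact) {P : ℕ} (hP1 : (P:ℝ) ≤ A ^ Nat.factorial k) (hP2 : A ^ Nat.factorial k < P + 1)
    {q : ℕ} (hq : q.Prime) (hq1 : P ^ (k + 1) ≤ q) (hq2 : q + 1 ≤ (P + 1) ^ (k + 1)) :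
    ∃ B ∈ Wfact, (q:ℝ) ≤ B ^ Nat.factorial (k + 1) ∧ B ^ Nat.factorial (k + 1) < (q:ℝ) + 1 ∧ (P:ℝ) ≤ B ^ Nat.factorial k ∧ B ^ Nat.factorial k < P + 1 := by
  obtain ⟨B, hB1, ⟨hB2, hB3⟩, hB4⟩ := tower hJ0 H (k := k + 1) (by omega) q hq
  have hA1 := hA.1
  have key : ∀ j, j ≤ k → ∀ p : ℕ, (p:ℝ) ≤ A ^ Nat.factorial j → A ^ Nat.factorial j < p + 1 → (p:ℝ) ≤ B ^ Nat.factorial j ∧ B ^ Nat.factorial j < p + 1 := by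
    intro j hj p hp1 hp2
    obtain ⟨r, hr⟩ := Nat.factorial_dvd_factorial hj
    have hr0 : r ≠ 0 := by rintro rfl; exact (Nat.factorial_pos k).ne' (by simpa using hr)
    have e1 : Nat.factorial (k + 1) = Nat.factorial j * (r * (k + 1)) := by rw [Nat.factorial_succ, hr]; ring
    have a1 : p ^ r ≤ P := by
      have : (p:ℝ) ^ r < P + 1 := by
        refine lt_of_le_of_lt ?_ hP2
        rw [hr, pow_mul]; gcongr
      have : p ^ r < P + 1 := by exact_mod_cast this
      omega
    have a2 : P + 1 ≤ (p + 1) ^ r := by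
      have : (P:ℝ) < (p + 1) ^ r := by
        refine lt_of_le_of_lt hP1 ?_
        rw [hr, pow_mul]
        exact pow_lt_pow_left₀ hp2 (by positivity) hr0
      have : P < (p + 1) ^ r := by exact_mod_cast this
      omega
    rw [e1, pow_mul] at hB2 hB3
    constructor
    · apply le_of_pow_le_pow_left₀ (n := r * (k + 1)) (by positivity) (by positivity)
      refine le_trans ?_ hB2
      have : p ^ (r * (k + 1)) ≤ q := by rw [pow_mul]; exact (Nat.pow_le_pow_left a1 _).trans hq1
      exact_mod_cast this
    · apply lt_of_pow_lt_pow_left₀ (r * (k + 1)) (by positivity)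
      refine lt_of_lt_of_le hB3 ?_
      have : q + 1 ≤ (p + 1) ^ (r * (k + 1)) := by rw [pow_mul]; exact hq2.trans (Nat.pow_le_pow_left a2 _)
      exact_mod_cast this
  refine ⟨B, ⟨hB1, ?_⟩, hB2, hB3, key k le_rfl P hP1 hP2⟩
  intro j hj
  by_cases hjk : k + 1 ≤ j
  · exact hB4 j hjk
  · obtain ⟨p, hp, hp1, hp2⟩ := W_nat hA hj
    obtain ⟨b1, b2⟩ := key j (by omega) p hp1 hp2
    have : ⌊B ^ Nat.factorial j⌋ = (p : ℤ) := by
      rw [Int.floor_eq_iff]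
      exact ⟨by exact_mod_cast b1, by exact_mod_cast b2⟩
    rw [this]
    exact Nat.prime_iff_prime_int.1 hp
end HH

namespace HH

theorem W_two_le {A : ℝ} (hA : A ∈ Wfact) : 2 ≤ A := by
  obtain ⟨p, hp, h1, -⟩ := W_nat hA le_rfl
  rw [Nat.factorial_one, pow_one] at h1
  have : (2:ℝ) ≤ p := by exact_mod_cast hp.two_le
  linarith

theorem right_open {A : ℝ} (hA : A ∉ Wfact) : ∃ e > 0, ∀ B, A ≤ B → B < A + e → B ∉ Wfact := by
  by_cases h2 : A < 2
  · refine ⟨2 - A, by linarith, fun B _ hB hW => ?_⟩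
    have := W_two_le hW
    linarith
  · push Not at h2
    have : ∃ k, 1 ≤ k ∧ ¬ Prime ⌊A ^ Nat.factorial k⌋ := by
      by_contra hc
      push Not at hc
      exact hA ⟨by linarith, hc⟩
    obtain ⟨k, hk, hnp⟩ := this
    have hcont : ContinuousAt (fun B : ℝ => B ^ Nat.factorial k) A := by fun_prop
    have hlt : A ^ Nat.factorial k < ⌊A ^ Nat.factorial k⌋ + 1 := Int.lt_floor_add_one _
    have hev := hcont.eventually (gt_mem_nhds hlt)
    obtain ⟨e, he, hb⟩ := Metric.eventually_nhds_iff.1 hev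
    refine ⟨e, he, fun B h1 h3 hW => hnp ?_⟩
    have h4 := hb (y := B) (by rw [Real.dist_eq, abs_of_nonneg (by linarith)]; linarith)
    have h5 : A ^ Nat.factorial k ≤ B ^ Nat.factorial k := by gcongr
    have : ⌊B ^ Nat.factorial k⌋ = ⌊A ^ Nat.factorial k⌋ := by
      rw [Int.floor_eq_iff]
      exact ⟨(Int.floor_le _).trans h5, h4⟩
    rw [← this]
    exact hW.2 k hk

theorem left_acc {A : ℝ} (h : ∀ b < A, ∃ w ∈ Wfact, b < w ∧ w < A) : A ∈ Wfact := by
  have hA2 : 2 < A := by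
    obtain ⟨w, hw, h1, h2⟩ := h (A - 1) (by linarith)
    have := W_two_le hw
    linarith
  have key : ∀ k, 1 ≤ k → Prime (⌈A ^ Nat.factorial k⌉ - 1) := by
    intro k hk
    have hcont : ContinuousAt (fun B : ℝ => B ^ Nat.factorial k) A := by fun_prop
    have hlt : ((⌈A ^ Nat.factorial k⌉ - 1 : ℤ) : ℝ) < A ^ Nat.factorial k := by
      push_cast
      linarith [Int.ceil_lt_add_one (A ^ Nat.factorial k)]
    have hev := hcont.eventually (lt_mem_nhds hlt)
    obtain ⟨e, he, hb⟩ := Metric.eventually_nhds_iff.1 hev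
    obtain ⟨w, hw, h1, h2⟩ := h (A - e) (by linarith)
    have h4 := hb (y := w) (by rw [Real.dist_eq, abs_lt]; constructor <;> linarith)
    have hw2 := W_two_le hw
    have h5 : w ^ Nat.factorial k < A ^ Nat.factorial k := pow_lt_pow_left₀ h2 (by linarith) (Nat.factorial_pos k).ne'
    have : ⌊w ^ Nat.factorial k⌋ = ⌈A ^ Nat.factorial k⌉ - 1 := by
      rw [Int.floor_eq_iff]
      refine ⟨h4.le, ?_⟩
      push_cast
      linarith [Int.le_ceil (A ^ Nat.factorial k)]
    rw [← this]
    exact hw.2 k hk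
  refine ⟨by linarith, fun k hk => ?_⟩
  by_cases hi : ((⌈A ^ Nat.factorial k⌉ : ℤ) : ℝ) = A ^ Nat.factorial k
  · exfalso
    set n := ⌈A ^ Nat.factorial k⌉ with hn
    have hn3 : 3 ≤ n := by
      have : A ≤ A ^ Nat.factorial k := le_self_pow₀ (by linarith) (Nat.factorial_pos k).ne'
      have : (2:ℝ) < n := by linarith
      have : 2 < n := by exact_mod_cast this
      omega
    have hkk := key (k + 2) (by omega)
    obtain ⟨t, ht⟩ : ∃ t, (k + 1) * (k + 2) = t + t := Nat.even_mul_succ_self (k + 1)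
    have ht0 : t ≠ 0 := by rintro rfl; simp at ht
    have he : A ^ Nat.factorial (k + 2) = ((n ^ (t + t) : ℤ) : ℝ) := by
      push_cast
      rw [hi, ← ht, ← pow_mul]
      congr 1
      rw [Nat.factorial_succ, Nat.factorial_succ]; ring
    rw [he, Int.ceil_intCast] at hkk
    have h1 : 3 ≤ n ^ t := hn3.trans (le_self_pow₀ (by omega) ht0)
    have : n ^ (t + t) - 1 = (n ^ t - 1) * (n ^ t + 1) := by rw [pow_add]; ring
    rw [this] at hkk
    rcases hkk.irreducible.isUnit_or_isUnit rfl with hu | hu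
    · rw [Int.isUnit_iff] at hu; omega
    · rw [Int.isUnit_iff] at hu; omega
  · have h1 := key k hk
    have : ⌊A ^ Nat.factorial k⌋ = ⌈A ^ Nat.factorial k⌉ - 1 := by
      rw [Int.floor_eq_iff]
      push_cast
      refine ⟨by linarith [Int.ceil_lt_add_one (A ^ Nat.factorial k)], ?_⟩
      have := lt_of_le_of_ne (Int.le_ceil (A ^ Nat.factorial k)) (Ne.symm hi)
      linarith
    rw [this]; exact h1

theorem sub_struct {A : ℝ} (hA : A ∈ subB Wfact) : A ∈ Wfact ∧
    ((∃ b < A, ∀ B ∈ Wfact, b < B → ¬ B < A) ∨ (∃ b > A, ∀ B ∈ Wfact, A < B → ¬ B < b)) := by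
  rcases hA with ⟨U, ⟨x, hx, hU⟩, hb, hs⟩ | ⟨U, ⟨x, hx, hU⟩, hb, hs⟩
  · have hxU : x ∈ U := by rw [hU]; exact mem_connectedComponentIn hx
    have hUW : U ⊆ Wfactᶜ := by rw [hU]; exact connectedComponentIn_subset _ _
    have hoc : U.OrdConnected := by rw [hU]; exact isPreconnected_connectedComponentIn.ordConnected
    have hxA : x ≤ A := by rw [hs]; exact le_csSup hb hxU
    have hin : ∀ y, x ≤ y → y < A → y ∈ U := by
      intro y h1 h2
      rw [hs] at h2
      obtain ⟨z, hz, hyz⟩ := exists_lt_of_lt_csSup ⟨x, hxU⟩ h2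
      exact hoc.out hxU hz ⟨h1, hyz.le⟩
    have hAW : A ∈ Wfact := by
      by_contra hc
      obtain ⟨e, he, h⟩ := right_open hc
      have hsub : Set.Icc x (A + e / 2) ⊆ Wfactᶜ := by
        intro y hy
        by_cases hyA : y < A
        · exact hUW (hin y hy.1 hyA)
        · exact h y (not_lt.1 hyA) (by linarith [hy.2])
      have := isPreconnected_Icc.subset_connectedComponentIn (x := x) ⟨le_rfl, by linarith⟩ hsub
      rw [← hU] at this
      have := le_csSup hb (this ⟨by linarith, le_rfl⟩)
      linarith
    refine ⟨hAW, Or.inl ⟨x, lt_of_le_of_ne hxA ?_, fun B hB h1 h2 => hUW (hin B h1.le h2) hB⟩⟩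
    rintro rfl; exact hx hAW
  · have hxU : x ∈ U := by rw [hU]; exact mem_connectedComponentIn hx
    have hUW : U ⊆ Wfactᶜ := by rw [hU]; exact connectedComponentIn_subset _ _
    have hoc : U.OrdConnected := by rw [hU]; exact isPreconnected_connectedComponentIn.ordConnected
    have hxA : A ≤ x := by rw [hs]; exact csInf_le hb hxU
    have hin : ∀ y, y ≤ x → A < y → y ∈ U := by
      intro y h1 h2
      rw [hs] at h2
      obtain ⟨z, hz, hyz⟩ := exists_lt_of_csInf_lt ⟨x, hxU⟩ h2
      exact hoc.out hz hxU ⟨hyz.le, h1⟩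
    have hAW : A ∈ Wfact := by
      by_contra hc
      apply hc
      apply left_acc
      intro b hbA
      by_contra hcon
      push Not at hcon
      have hsub : Set.Icc ((b + A) / 2) x ⊆ Wfactᶜ := by
        intro y hy
        rcases lt_trichotomy y A with h1 | h1 | h1
        · intro hyW
          have := hcon y hyW (by linarith [hy.1])
          linarith
        · rw [h1]; exact hc
        · exact hUW (hin y hy.2 h1)
      have := isPreconnected_Icc.subset_connectedComponentIn (x := x) ⟨by linarith, le_rfl⟩ hsub
      rw [← hU] at this
      have := csInf_le hb (this ⟨le_rfl, by linarith⟩)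
      linarith
    refine ⟨hAW, Or.inr ⟨x, lt_of_le_of_ne hxA ?_, fun B hB h1 h2 => hUW (hin B h2.le h1) hB⟩⟩
    rintro rfl; exact hx hAW
end HH

namespace HH

theorem pow_diff {A B : ℝ} (hB : 1 ≤ B) (hAB : B ≤ A) (n : ℕ) : n * (A - B) ≤ A ^ n - B ^ n := by
  induction n with
  | zero => simp
  | succ n ih =>
    have h1 : (1:ℝ) ≤ B ^ n := one_le_pow₀ hB
    have h2 : B ^ n ≤ A ^ n := by gcongr
    have : A ^ (n + 1) - B ^ (n + 1) = A * (A ^ n - B ^ n) + B ^ n * (A - B) := by ring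
    rw [this]; push_cast
    nlinarith

theorem rpow_conv {R ε : ℝ} (hR : 0 < R) (k : ℕ) : (R ^ (k + 1)) ^ (1 - ε) = R ^ (1 - ε * (k + 1)) * R ^ k := by
  rw [← Real.rpow_natCast, ← Real.rpow_mul hR.le, ← Real.rpow_natCast, ← Real.rpow_add hR]
  congr 1; push_cast; ring

theorem approx {A : ℝ} (hA : A ∈ subB Wfact) : ∃ ε : ℝ, 0 < ε ∧ ∃ k0 : ℕ, ∀ k, k0 ≤ k → ∃ P R : ℕ, P.Prime ∧ (R = P ∨ R = P + 1) ∧ 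
    2 ^ Nat.factorial k ≤ R ∧ |A ^ Nat.factorial k - R| ≤ 2 * (R:ℝ) ^ (1 - ε * (k + 1)) := by
  obtain ⟨hAW, hcase⟩ := sub_struct hA
  obtain ⟨J0, hJ0, H⟩ := tower_step
  obtain ⟨ε, hε, hε2, x0, hx0, Hh⟩ := hoheisel
  have hA2 := W_two_le hAW
  have common : ∀ k, J0 + ⌈2 / ε⌉₊ + ⌈x0⌉₊ ≤ k → ∃ P : ℕ, P.Prime ∧ (P:ℝ) ≤ A ^ Nat.factorial k ∧ A ^ Nat.factorial k < P + 1 ∧ 2 ^ Nat.factorial k ≤ P ∧ 2 ≤ ε * k ∧ x0 ≤ k := by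
    intro k hk
    obtain ⟨P, hP, h1, h2⟩ := W_nat hAW (by omega : 1 ≤ k)
    refine ⟨P, hP, h1, h2, ?_, ?_, ?_⟩
    · have : (2:ℝ) ^ Nat.factorial k < P + 1 := lt_of_le_of_lt (by gcongr) h2
      have : 2 ^ Nat.factorial k < P + 1 := by exact_mod_cast this
      omega
    · have : 2 / ε ≤ k := (Nat.le_ceil _).trans (by exact_mod_cast (by omega))
      rw [div_le_iff₀ hε] at this; linarith
    · exact (Nat.le_ceil _).trans (by exact_mod_cast (by omega))
  refine ⟨ε, hε, ?_⟩
  rcases hcase with ⟨b, hbA, hb⟩ | ⟨b, hbA, hb⟩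
  · refine ⟨J0 + ⌈2 / ε⌉₊ + ⌈x0⌉₊ + ⌈1 / (A - b)⌉₊, fun k hk => ?_⟩
    obtain ⟨P, hP, h1, h2, h3, hεk, hxk⟩ := common k (by omega)
    have hkb : 1 ≤ Nat.factorial k * (A - b) := by
      have : 1 / (A - b) ≤ Nat.factorial k := (Nat.le_ceil _).trans (by exact_mod_cast (by have := Nat.self_le_factorial k; omega))
      rwa [div_le_iff₀ (by linarith)] at this
    refine ⟨P, P, hP, Or.inl rfl, h3, ?_⟩
    have hP2 : (2:ℝ) ≤ P := by exact_mod_cast hP.two_le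
    have hx : x0 ≤ (P:ℝ) ^ (k + 1) := by
      have : k < P ^ (k + 1) := (Nat.lt_two_pow_self).trans_le ((Nat.pow_le_pow_right (by norm_num) (Nat.le_succ k)).trans (Nat.pow_le_pow_left hP.two_le _))
      have : (k:ℝ) ≤ (P:ℝ) ^ (k + 1) := by exact_mod_cast this.le
      linarith
    obtain ⟨q, hq, q1, q2⟩ := Hh _ hx
    have hPk : (0:ℝ) < (P:ℝ) ^ k := by positivity
    have hw1 : (1:ℝ) ≤ ((P:ℝ) ^ (k + 1)) ^ (1 - ε) := Real.one_le_rpow (one_le_pow₀ (by linarith)) (by linarith)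
    rw [rpow_conv (by linarith)] at q2 hw1
    have he : (P:ℝ) ^ (1 - ε * (k + 1)) ≤ 1 := Real.rpow_le_one_of_one_le_of_nonpos (by linarith) (by linarith)
    have q3 : q ≤ P ^ (k + 1) + P ^ k := by
      have : (q:ℝ) ≤ P ^ (k + 1) + P ^ k := by nlinarith
      exact_mod_cast this
    have q4 := pow_gap P k q (by omega) hP.two_le q3
    obtain ⟨B, hBW, b1, b2, b3, b4⟩ := ext hJ0 H (k := k) (by omega) hAW h1 h2 hq (by exact_mod_cast q1.le) q4.le
    have hB2 := W_two_le hBW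
    have hbB : b < B := by
      by_contra hc
      push Not at hc
      have := pow_diff (by linarith : 1 ≤ B) (by linarith : B ≤ A) (Nat.factorial k)
      have : (Nat.factorial k : ℝ) * (A - b) ≤ Nat.factorial k * (A - B) := by gcongr
      linarith
    have hAB := not_lt.1 (hb B hBW hbB)
    have hlt : (A ^ Nat.factorial k) ^ (k + 1) < q + 1 := by
      refine lt_of_le_of_lt ?_ b2
      rw [← pow_mul, mul_comm, ← Nat.factorial_succ]
      gcongr
    set y := A ^ Nat.factorial k
    have hy : (P:ℝ) ^ k * y ≤ y ^ (k + 1) := by rw [pow_succ]; gcongr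
    rw [abs_of_nonneg (by linarith)]
    apply le_of_mul_le_mul_right _ hPk
    rw [pow_succ] at q2
    linarith
  · refine ⟨J0 + ⌈2 / ε⌉₊ + ⌈x0⌉₊ + ⌈1 / (b - A)⌉₊, fun k hk => ?_⟩
    obtain ⟨P, hP, h1, h2, h3, hεk, hxk⟩ := common k (by omega)
    have hkb : 1 ≤ Nat.factorial k * (b - A) := by
      have : 1 / (b - A) ≤ Nat.factorial k := (Nat.le_ceil _).trans (by exact_mod_cast (by have := Nat.self_le_factorial k; omega))
      rwa [div_le_iff₀ (by linarith)] at this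
    refine ⟨P, P + 1, hP, Or.inr rfl, by omega, ?_⟩
    have hP2 : (2:ℝ) ≤ P := by exact_mod_cast hP.two_le
    obtain ⟨Q, hQ⟩ : ∃ Q : ℝ, Q = (P:ℝ) + 1 := ⟨_, rfl⟩
    have hQ3 : 3 ≤ Q := by linarith
    push_cast
    rw [← hQ]
    have hQk : (0:ℝ) < Q ^ k := by positivity
    have hw1 : (1:ℝ) ≤ (Q ^ (k + 1)) ^ (1 - ε) := Real.one_le_rpow (one_le_pow₀ (by linarith)) (by linarith)
    have hwe := rpow_conv (R := Q) (ε := ε) (by linarith) k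
    have he : Q ^ (1 - ε * (k + 1)) ≤ Q⁻¹ := by
      rw [← Real.rpow_neg_one]
      exact Real.rpow_le_rpow_of_exponent_le (by linarith) (by linarith)
    set w := (Q ^ (k + 1)) ^ (1 - ε) with hw
    have hwQ : 2 * w ≤ Q ^ k := by
      have : w ≤ Q⁻¹ * Q ^ k := by rw [hwe]; gcongr
      have h4 : Q⁻¹ ≤ 1 / 2 := by rw [inv_eq_one_div]; apply one_div_le_one_div_of_le <;> linarith
      nlinarith
    have hkk : x0 ≤ Q ^ k := by
      have : k < 2 ^ k := Nat.lt_two_pow_self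
      have h5 : (k:ℝ) ≤ (2:ℝ) ^ k := by exact_mod_cast this.le
      have : (2:ℝ) ^ k ≤ Q ^ k := by gcongr; linarith
      linarith
    have hz : Q ^ k * P ≤ Q ^ (k + 1) - 2 * w := by
      rw [pow_succ, hQ] at *; nlinarith
    have hx : x0 ≤ Q ^ (k + 1) - 2 * w := by nlinarith
    obtain ⟨q, hq, q1, q2⟩ := Hh _ hx
    have q3 : (Q ^ (k + 1) - 2 * w) ^ (1 - ε) ≤ w := by
      rw [hw]
      apply Real.rpow_le_rpow (by linarith) _ (by linarith)
      linarith
    have q4 : q + 1 ≤ (P + 1) ^ (k + 1) := by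
      have : (q:ℝ) + 1 ≤ ((P:ℝ) + 1) ^ (k + 1) := by rw [← hQ]; linarith
      exact_mod_cast this
    have q5 : P ^ (k + 1) ≤ q := by
      have : (P:ℝ) ^ (k + 1) ≤ q := by
        refine le_trans ?_ (hz.trans q1.le)
        rw [pow_succ]; gcongr; linarith
      exact_mod_cast this
    obtain ⟨B, hBW, b1, b2, b3, b4⟩ := ext hJ0 H (k := k) (by omega) hAW h1 h2 hq q5 q4
    have hB2 := W_two_le hBW
    have hbB : B < b := by
      by_contra hc
      push Not at hc
      have := pow_diff (by linarith : 1 ≤ A) (by linarith : A ≤ B) (Nat.factorial k)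
      have : (Nat.factorial k : ℝ) * (b - A) ≤ Nat.factorial k * (B - A) := by gcongr
      linarith
    have hAB : B ≤ A := by
      by_contra hc
      exact hb B hBW (not_le.1 hc) hbB
    have hlt : (q:ℝ) ≤ (A ^ Nat.factorial k) ^ (k + 1) := by
      refine b1.trans ?_
      rw [← pow_mul, mul_comm _ (k + 1), ← Nat.factorial_succ]
      gcongr
    set y := A ^ Nat.factorial k
    have hy0 : 0 ≤ y := by linarith
    have hy : y ^ (k + 1) ≤ Q ^ k * y := by rw [pow_succ]; gcongr; linarith
    rw [abs_of_nonpos (by linarith)]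
    apply le_of_mul_le_mul_right _ hQk
    rw [mul_assoc, ← hwe]
    have : Q ^ (k + 1) = Q ^ k * Q := pow_succ _ _
    linarith
end HH

namespace HH

theorem no_rat {K P R m n : ℕ} (hK : 4 ≤ K) (heven : Even K) (hP : P.Prime) (hR : R = P ∨ R = P + 1) (hn : 0 < n) (h : m ^ K = R * n ^ K) : False := by
  have hdvd : n ∣ m := (Nat.pow_dvd_pow_iff (by omega)).1 (Dvd.intro_left R h.symm)
  obtain ⟨a, rfl⟩ := hdvd
  rw [mul_pow, mul_comm] at h
  have ha : a ^ K = R := Nat.eq_of_mul_eq_mul_right (by positivity) h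
  rcases hR with hR | hR
  · rw [hR] at ha
    rw [← ha] at hP
    exact Nat.Prime.not_prime_pow (by omega) hP
  · obtain ⟨t, ht⟩ := heven
    have ha2 : 2 ≤ a := by
      by_contra hc
      have : a ≤ 1 := by omega
      have : a ^ K ≤ 1 := Nat.pow_le_one_iff (by omega) |>.2 this
      have := hP.two_le
      omega
    have hat : 4 ≤ a ^ t := by
      calc 4 = 2 ^ 2 := by norm_num
        _ ≤ 2 ^ t := Nat.pow_le_pow_right (by norm_num) (by omega)
        _ ≤ a ^ t := Nat.pow_le_pow_left ha2 _
    have hPe : P = (a ^ t - 1) * (a ^ t + 1) := by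
      obtain ⟨b, hb⟩ : ∃ b, a ^ t = b + 1 := ⟨a ^ t - 1, by omega⟩
      have h1 : a ^ K = a ^ t * a ^ t := by rw [ht, pow_add]
      rw [hb] at h1 ⊢
      have h2 : (b + 1) * (b + 1) = P + 1 := by rw [← h1, ha, hR]
      simp only [Nat.add_sub_cancel]
      nlinarith
    rw [hPe] at hP
    exact Nat.not_prime_mul (by omega) (by omega) hP

theorem pow_lip {a b c : ℝ} (ha : 0 ≤ a) (hb : 0 ≤ b) (hac : a ≤ c) (hbc : b ≤ c) (hc : 1 ≤ c) (n : ℕ) :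
    |a ^ n - b ^ n| ≤ n * c ^ n * |a - b| := by
  induction n with
  | zero => simp
  | succ n ih =>
    have e : a ^ (n + 1) - b ^ (n + 1) = a * (a ^ n - b ^ n) + b ^ n * (a - b) := by ring
    have h1 : |a * (a ^ n - b ^ n)| ≤ c * (n * c ^ n * |a - b|) := by
      rw [abs_mul, abs_of_nonneg ha]; gcongr
    have h2 : |b ^ n * (a - b)| ≤ c * c ^ n * |a - b| := by
      rw [abs_mul, abs_of_nonneg (by positivity)]
      gcongr
      calc b ^ n ≤ 1 * c ^ n := by rw [one_mul]; gcongr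
        _ ≤ _ := by gcongr
    rw [e]
    refine (abs_add_le _ _).trans ?_
    rw [pow_succ]; push_cast
    linarith

theorem size {B0 C1 : ℝ} (hB0 : 1 ≤ B0) (hC1 : 1 ≤ C1) : ∃ η : ℝ, 0 < η ∧ ∀ l : ℝ, Real.log 3 ≤ l → ∀ k : ℕ, (k:ℝ) ≤ C1 * l → 1 ≤ k → 
    (Nat.factorial k : ℝ) * (l * B0) ≤ Real.exp (η * l * Real.log l) := by
  have h3 : 1 < Real.log 3 := by
    rw [Real.lt_log_iff_exp_lt (by norm_num)]
    linarith [Real.exp_one_lt_d9]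
  set c := Real.log (Real.log 3) with hc
  have hc0 : 0 < c := Real.log_pos h3
  have hlB : 0 ≤ Real.log B0 := Real.log_nonneg hB0
  have hlC : 0 ≤ Real.log C1 := Real.log_nonneg hC1
  refine ⟨C1 * Real.log C1 / c + C1 + 1 + Real.log B0 / c, by positivity, fun l hl k hk hk1 => ?_⟩
  have hl1 : 1 ≤ l := by linarith
  have hcl : c ≤ Real.log l := Real.log_le_log (by linarith) hl
  have hkr : (1:ℝ) ≤ k := by exact_mod_cast hk1
  have hf : (Nat.factorial k : ℝ) ≤ Real.exp (C1 * l * (Real.log C1 + Real.log l)) := by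
    calc (Nat.factorial k : ℝ) ≤ (k:ℝ) ^ k := by exact_mod_cast Nat.factorial_le_pow k
      _ = Real.exp (k * Real.log k) := by
        rw [← Real.rpow_natCast, Real.rpow_def_of_pos (by linarith), mul_comm]
      _ ≤ _ := by
        apply Real.exp_le_exp.2
        have h1 : Real.log k ≤ Real.log C1 + Real.log l := by
          rw [← Real.log_mul (by linarith) (by linarith)]
          exact Real.log_le_log (by linarith) hk
        have h2 : 0 ≤ Real.log k := Real.log_nonneg hkr
        gcongr
  have hlB' : l * B0 = Real.exp (Real.log l + Real.log B0) := by
    rw [Real.exp_add, Real.exp_log (by linarith), Real.exp_log (by linarith)]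
  calc _ ≤ Real.exp (C1 * l * (Real.log C1 + Real.log l)) * Real.exp (Real.log l + Real.log B0) := by
        rw [hlB']; gcongr
    _ ≤ _ := by
        rw [← Real.exp_add]
        apply Real.exp_le_exp.2
        have a1 : C1 * Real.log C1 * l ≤ C1 * Real.log C1 / c * (l * Real.log l) := by
          rw [div_mul_eq_mul_div, le_div_iff₀ hc0]
          have : C1 * Real.log C1 * l * c ≤ C1 * Real.log C1 * l * Real.log l := by gcongr
          linarith
        have a2 : Real.log B0 ≤ Real.log B0 / c * (l * Real.log l) := by
          rw [div_mul_eq_mul_div, le_div_iff₀ hc0]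
          have : c ≤ l * Real.log l := by nlinarith
          gcongr
        have a3 : Real.log l ≤ l * Real.log l := by nlinarith
        linarith
end HH

set_option maxHeartbeats 4000000 in
theorem rational_approximation_subBoundary_Wfact :
    ∀ A ∈ subB Wfact, ∃ η : ℝ, 0 < η ∧
      ∀ m n : ℕ, 3 ≤ m → 3 ≤ n →
        Real.exp (-Real.exp (η * Real.log ((max m n : ℕ) : ℝ) *
          Real.log (Real.log ((max m n : ℕ) : ℝ)))) ≤ |A - (m : ℝ) / (n : ℝ)| := by
  intro A hA
  obtain ⟨ε, hε, k0, hap⟩ := HH.approx hA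
  have hA2 := HH.W_two_le (HH.sub_struct hA).1
  have hlA : 0 ≤ Real.log (A + 1) := Real.log_nonneg (by linarith)
  obtain ⟨η, hη, hsize⟩ := HH.size (B0 := 2 + Real.log (A + 1)) (C1 := 10 / ε + k0 + 4 + 1) (by linarith)
    (by have : 0 < 10 / ε := by positivity
        have : (0:ℝ) ≤ k0 := by positivity
        linarith)
  refine ⟨η, hη, fun m n hm hn => ?_⟩
  obtain ⟨M, hM⟩ : ∃ M : ℕ, M = max m n := ⟨_, rfl⟩
  rw [← hM]
  have hM3 : 3 ≤ M := by rw [hM]; exact le_max_of_le_left hm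
  have hMn : n ≤ M := by rw [hM]; exact le_max_right _ _
  have hM3r : (3:ℝ) ≤ M := by exact_mod_cast hM3
  have hMnr : (n:ℝ) ≤ M := by exact_mod_cast hMn
  have hn0 : (0:ℝ) < n := by exact_mod_cast (by omega : 0 < n)
  obtain ⟨l, hl⟩ : ∃ l : ℝ, l = Real.log M := ⟨_, rfl⟩
  rw [← hl]
  have hl3 : Real.log 3 ≤ l := by rw [hl]; exact Real.log_le_log (by norm_num) hM3r
  have h31 : 1 < Real.log 3 := by
    rw [Real.lt_log_iff_exp_lt (by norm_num)]
    linarith [Real.exp_one_lt_d9]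
  have hl1 : 1 ≤ l := by linarith
  have hεp : 0 < 10 / ε := by positivity
  have hk00 : (0:ℝ) ≤ k0 := by positivity
  obtain ⟨k, hk⟩ : ∃ k : ℕ, k = ⌈(10 / ε + k0 + 4) * l⌉₊ := ⟨_, rfl⟩
  have hk1 : (10 / ε + k0 + 4) * l ≤ k := by rw [hk]; exact Nat.le_ceil _
  have hk2 : (k:ℝ) < (10 / ε + k0 + 4) * l + 1 := by rw [hk]; exact Nat.ceil_lt_add_one (by positivity)
  have hkk0 : k0 ≤ k := by
    have : (k0:ℝ) ≤ k := by nlinarith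
    exact_mod_cast this
  have hk4 : 4 ≤ k := by
    have : ((4:ℕ):ℝ) ≤ k := by push_cast; nlinarith
    exact_mod_cast this
  have hεk : 10 * l ≤ ε * k := by
    have : 10 / ε * l ≤ k := by nlinarith
    rw [div_mul_eq_mul_div, div_le_iff₀ hε] at this
    linarith
  have hsz := hsize l hl3 k (by linarith) (by omega)
  obtain ⟨P, R, hP, hR, hR2, hAR⟩ := hap k hkk0
  obtain ⟨K, hK⟩ : ∃ K : ℕ, K = Nat.factorial k := ⟨_, rfl⟩
  rw [← hK] at hsz hR2 hAR
  have hK4 : 4 ≤ K := by rw [hK]; exact hk4.trans (Nat.self_le_factorial k)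
  have hKe : Even K := by
    rw [hK, even_iff_two_dvd]
    exact Nat.dvd_factorial (by norm_num) (by omega)
  have hKr : (4:ℝ) ≤ K := by exact_mod_cast hK4
  by_contra hcon
  rw [not_le] at hcon
  obtain ⟨X, hX⟩ : ∃ X : ℝ, X = Real.exp (η * l * Real.log l) := ⟨_, rfl⟩
  rw [← hX] at hcon hsz
  have hX0 : 0 < X := by rw [hX]; exact Real.exp_pos _
  have hMK : (0:ℝ) < (M:ℝ) ^ K := by positivity
  -- size
  have hsize2 : 2 * K * (A + 1) ^ K * (M:ℝ) ^ K ≤ Real.exp X := by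
    have e1 : 2 * (K:ℝ) * (A + 1) ^ K * (M:ℝ) ^ K = Real.exp (Real.log 2 + Real.log K + K * Real.log (A + 1) + K * l) := by
      rw [Real.exp_add, Real.exp_add, Real.exp_add, Real.exp_log (by norm_num), Real.exp_log (by linarith), hl,
        Real.exp_nat_mul, Real.exp_nat_mul, Real.exp_log (by linarith), Real.exp_log (by linarith)]
    rw [e1]
    apply Real.exp_le_exp.2
    refine le_trans ?_ hsz
    have g1 : Real.log K ≤ K - 1 := Real.log_le_sub_one_of_pos (by linarith)
    have g2 : Real.log 2 ≤ 1 := by linarith [Real.log_two_lt_d9]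
    have g3 : K * Real.log (A + 1) ≤ K * Real.log (A + 1) * l := by
      have : 0 ≤ K * Real.log (A + 1) := by positivity
      nlinarith
    have g4 : (K:ℝ) ≤ K * l := le_mul_of_one_le_right (by linarith) hl1
    nlinarith
  have hd : Real.exp (-X) * (K * (A + 1) ^ K) ≤ 1 / (2 * (M:ℝ) ^ K) := by
    rw [Real.exp_neg, le_div_iff₀ (by positivity)]
    have := Real.exp_pos X
    rw [inv_mul_eq_div, div_mul_eq_mul_div, div_le_one this]
    linarith
  have hd1 : Real.exp (-X) ≤ 1 := by rw [Real.exp_le_one_iff]; linarith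
  have hr : (m:ℝ) / n ≤ A + 1 := by
    have := (abs_lt.1 hcon).1
    linarith
  have s1 := HH.pow_lip (a := A) (b := (m:ℝ) / n) (c := A + 1) (by linarith) (by positivity) (by linarith) hr (by linarith) K
  have s2 : K * (A + 1) ^ K * |A - (m:ℝ) / n| < 1 / (2 * (M:ℝ) ^ K) := by
    refine lt_of_lt_of_le ?_ hd
    rw [mul_comm]
    have : 0 < K * (A + 1) ^ K := by positivity
    gcongr
  have s3 : 2 * (R:ℝ) ^ (1 - ε * (k + 1)) ≤ 1 / (2 * (M:ℝ) ^ K) := by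
    have hRr : (2:ℝ) ^ K ≤ R := by exact_mod_cast hR2
    have t1 : (R:ℝ) ^ (1 - ε * (k + 1)) ≤ ((2:ℝ) ^ K) ^ (1 - ε * (k + 1)) :=
      Real.rpow_le_rpow_of_nonpos (by positivity) hRr (by linarith)
    have t2 : ((2:ℝ) ^ K) ^ (1 - ε * (k + 1)) = Real.exp (-(Real.log 2 * (K * (ε * (k + 1) - 1)))) := by
      rw [← Real.rpow_natCast, ← Real.rpow_mul (by norm_num), Real.rpow_def_of_pos (by norm_num)]
      congr 1; ring
    have t3 : 4 * (M:ℝ) ^ K = Real.exp (Real.log 4 + K * l) := by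
      rw [Real.exp_add, Real.exp_log (by norm_num), hl, Real.exp_nat_mul, Real.exp_log (by linarith)]
    have t4 : 4 * (M:ℝ) ^ K ≤ Real.exp (Real.log 2 * (K * (ε * (k + 1) - 1))) := by
      rw [t3]
      apply Real.exp_le_exp.2
      have v1 : Real.log 4 ≤ 3 := by
        have := Real.log_le_sub_one_of_pos (show (0:ℝ) < 4 by norm_num); linarith
      have v2 : 9 * l ≤ ε * (k + 1) - 1 := by linarith
      have v3 : (K:ℝ) * (9 * l) ≤ K * (ε * (k + 1) - 1) := by gcongr
      have v4 : 1 / 2 * (K * (9 * l)) ≤ Real.log 2 * (K * (ε * (k + 1) - 1)) := by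
        have : 1 / 2 ≤ Real.log 2 := by linarith [Real.log_two_gt_d9]
        gcongr
      have : (4:ℝ) ≤ K * l := le_trans hKr (le_mul_of_one_le_right (by linarith) hl1)
      linarith
    rw [le_div_iff₀ (by positivity)]
    have t5 := Real.exp_pos (Real.log 2 * (K * (ε * (k + 1) - 1)))
    calc 2 * (R:ℝ) ^ (1 - ε * (k + 1)) * (2 * (M:ℝ) ^ K) ≤ Real.exp (-(Real.log 2 * (K * (ε * (k + 1) - 1)))) * (4 * (M:ℝ) ^ K) := by
          rw [← t2]
          have := mul_le_mul_of_nonneg_right t1 hMK.le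
          linarith
      _ ≤ 1 := by
          rw [Real.exp_neg, inv_mul_eq_div, div_le_one t5]; exact t4
  have s4 : |((m:ℝ) / n) ^ K - R| < 1 / (M:ℝ) ^ K := by
    have e : 1 / (M:ℝ) ^ K = 1 / (2 * (M:ℝ) ^ K) + 1 / (2 * (M:ℝ) ^ K) := by field_simp; norm_num
    rw [e]
    have := abs_sub_le (((m:ℝ) / n) ^ K) (A ^ K) R
    rw [abs_sub_comm (((m:ℝ) / n) ^ K) (A ^ K)] at this
    linarith
  have s5 : |(m:ℝ) ^ K - R * (n:ℝ) ^ K| < 1 := by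
    have hnK : (0:ℝ) < (n:ℝ) ^ K := by positivity
    have e : (m:ℝ) ^ K - R * (n:ℝ) ^ K = (((m:ℝ) / n) ^ K - R) * (n:ℝ) ^ K := by
      rw [div_pow]; field_simp
    rw [e, abs_mul, abs_of_pos hnK]
    calc |((m:ℝ) / n) ^ K - R| * (n:ℝ) ^ K < 1 / (M:ℝ) ^ K * (n:ℝ) ^ K := by gcongr
      _ ≤ 1 / (M:ℝ) ^ K * (M:ℝ) ^ K := by gcongr
      _ = 1 := by field_simp
  have s6 : |(m:ℤ) ^ K - R * (n:ℤ) ^ K| < 1 := by exact_mod_cast s5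
  have s7 : (m:ℤ) ^ K = R * (n:ℤ) ^ K := by
    have := Int.abs_lt_one_iff.1 s6
    linarith
  have s8 : m ^ K = R * n ^ K := by exact_mod_cast s7
  exact HH.no_rat hK4 hKe hP hR (lt_of_lt_of_le three_pos hn) s8
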